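/- arXiv:math/0206293 — 2 statements merged into one kernel-verified Lean document; each statement's English description precedes it below -/
import Mathlib

section
/- For every real y ≥ 1, ∫_1^y ε(u) u du = (B/4) y² + y f(y) − ∫_1^y f(u) du − B/4, and consequently ∫_1^y ε(u) u du = (B/4) y² + O(y^{3/2+ε}) for every ε > 0. -/
open Real MeasureTheory

/-- The singular series of the twin prime / Goldbach type problems. -/
noncomputable def singularSeries (d : ℕ) : ℝ :=
  if Even d then
    2 * (∏' p : Nat.Primes, if 2 < (p : ℕ) then (1 - 1 / ((p : ℝ) - 1) ^ 2) else 1) *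
      ∏ p ∈ d.primeFactors.filter (fun p => 2 < p), ((p : ℝ) - 1) / ((p : ℝ) - 2)
  else 0

/-- The constant `B = -C₀ - log 2π`. -/
noncomputable def Bconst : ℝ := -Real.eulerMascheroniConstant - Real.log (2 * Real.pi)

/-- `ε(y) = Σ_{h ≤ y} 𝔖(h) - y + (1/2) log y`. -/
noncomputable def epsErr (y : ℝ) : ℝ :=
  (∑ h ∈ Finset.Icc 1 ⌊y⌋₊, singularSeries h) - y + Real.log y / 2

/-- `f(y) = ∫_1^y (ε(u) - B/2) du`. -/
noncomputable def fErr (y : ℝ) : ℝ := ∫ u in (1 : ℝ)..y, (epsErr u - Bconst / 2)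

namespace TwinPrimeSeries

/-- The multiplicative function with prescribed values at powers of primes. -/
noncomputable def ofPrimePow (F : ℕ → ℕ → ℝ) : ArithmeticFunction ℝ :=
  ⟨fun n => if n = 0 then 0 else n.factorization.prod F, by simp⟩

theorem ofPrimePow_isMultiplicative (F : ℕ → ℕ → ℝ) : (ofPrimePow F).IsMultiplicative := by
  rw [ArithmeticFunction.IsMultiplicative.iff_ne_zero]
  refine ⟨by simp [ofPrimePow], fun {m n} hm hn hmn => ?_⟩
  simp only [ofPrimePow, ArithmeticFunction.coe_mk, hm, hn, mul_eq_zero, or_self, if_false]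
  rw [Nat.factorization_mul_of_coprime hmn, Finsupp.prod_add_index_of_disjoint]
  simpa using hmn.disjoint_primeFactors

theorem ofPrimePow_apply_prime_pow (F : ℕ → ℕ → ℝ) {p k : ℕ} (hp : p.Prime) (hk : k ≠ 0) :
    ofPrimePow F (p ^ k) = F p k := by
  have h : ¬ (p ^ k = 0) := by simp [hp.ne_zero]
  simp only [ofPrimePow, ArithmeticFunction.coe_mk, h, if_false]
  rw [hp.factorization_pow, Finsupp.prod, Finsupp.support_single p hk]
  simp

theorem mul_apply_prime_pow (f g : ArithmeticFunction ℝ) {p : ℕ} (hp : p.Prime) (k : ℕ) :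
    (f * g) (p ^ k) = ∑ i ∈ Finset.range (k + 1), f (p ^ i) * g (p ^ (k - i)) := by
  rw [ArithmeticFunction.mul_apply, Nat.sum_divisorsAntidiagonal (fun a b => f a * g b),
    Nat.sum_divisors_prime_pow hp]
  refine Finset.sum_congr rfl fun i hi => ?_
  rw [Nat.pow_div (by simpa [Nat.lt_succ_iff] using hi) hp.pos]

/-- The quotient of `sqfreeWeight` by `oddIndicator` for Dirichlet convolution. -/
noncomputable def sievedWeight : ArithmeticFunction ℝ :=
  ofPrimePow fun p k =>
    if p = 2 then 0 else if k = 1 then 2 / ((p : ℝ) - 2)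
    else if k = 2 then -(p : ℝ) / ((p : ℝ) - 2) else 0

/-- The function `d ↦ ∏_{p ∣ d} p / (p - 2)` supported on odd squarefree integers. -/
noncomputable def sqfreeWeight : ArithmeticFunction ℝ :=
  ofPrimePow fun p k => if p = 2 then 0 else if k = 1 then (p : ℝ) / ((p : ℝ) - 2) else 0

/-- The indicator function of odd integers. -/
noncomputable def oddIndicator : ArithmeticFunction ℝ :=
  ⟨fun n => if Odd n then 1 else 0, by simp⟩

/-- The inclusion of the natural numbers, as a real arithmetic function. -/
noncomputable def realId : ArithmeticFunction ℝ := ⟨fun n => (n : ℝ), by simp⟩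

/-- The arithmetic factor of the singular series. -/
noncomputable def oddPrimeFactor : ArithmeticFunction ℝ :=
  ofPrimePow fun p _ => if p = 2 then 1 else ((p : ℝ) - 1) / ((p : ℝ) - 2)

theorem sievedWeight_isMultiplicative : sievedWeight.IsMultiplicative :=
  ofPrimePow_isMultiplicative _

theorem sqfreeWeight_isMultiplicative : sqfreeWeight.IsMultiplicative :=
  ofPrimePow_isMultiplicative _

theorem oddPrimeFactor_isMultiplicative : oddPrimeFactor.IsMultiplicative :=
  ofPrimePow_isMultiplicative _

theorem oddIndicator_apply (n : ℕ) : oddIndicator n = if Odd n then 1 else 0 := rfl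

theorem realId_apply (n : ℕ) : realId n = n := rfl

theorem oddIndicator_isMultiplicative : oddIndicator.IsMultiplicative := by
  refine ⟨by simp [oddIndicator_apply], fun {m n} _ => ?_⟩
  simp only [oddIndicator_apply, Nat.odd_mul, ite_and, ite_mul, one_mul, zero_mul]

theorem realId_isMultiplicative : realId.IsMultiplicative :=
  ⟨by simp [realId_apply], fun {m n} _ => by simp [realId_apply]⟩

theorem two_lt_cast_prime {p : ℕ} (hp : p.Prime) (h2 : p ≠ 2) : (3 : ℝ) ≤ p := by
  exact_mod_cast (hp.two_le.lt_of_ne h2.symm)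

theorem oddIndicator_prime_pow {p : ℕ} (hp : p.Prime) (h2 : p ≠ 2) (k : ℕ) :
    oddIndicator (p ^ k) = 1 := by
  simp [oddIndicator_apply, (hp.odd_of_ne_two h2).pow]

theorem oddIndicator_two_pow {k : ℕ} (hk : k ≠ 0) : oddIndicator (2 ^ k) = 0 := by
  have : Even (2 ^ k) := (Nat.even_pow' hk).2 even_two
  simp [oddIndicator_apply, this]

theorem sievedWeight_two_pow {k : ℕ} (hk : k ≠ 0) : sievedWeight (2 ^ k) = 0 := by
  rw [sievedWeight, ofPrimePow_apply_prime_pow _ Nat.prime_two hk]; simp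

theorem sievedWeight_one : sievedWeight 1 = 1 := sievedWeight_isMultiplicative.1

theorem sievedWeight_prime {p : ℕ} (hp : p.Prime) (h2 : p ≠ 2) :
    sievedWeight p = 2 / ((p : ℝ) - 2) := by
  have := ofPrimePow_apply_prime_pow (fun p k =>
    if p = 2 then 0 else if k = 1 then 2 / ((p : ℝ) - 2)
    else if k = 2 then -(p : ℝ) / ((p : ℝ) - 2) else 0) hp one_ne_zero
  simpa [h2, sievedWeight] using this

theorem sievedWeight_prime_sq {p : ℕ} (hp : p.Prime) (h2 : p ≠ 2) :
    sievedWeight (p ^ 2) = -(p : ℝ) / ((p : ℝ) - 2) := by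
  rw [sievedWeight, ofPrimePow_apply_prime_pow _ hp two_ne_zero]; simp [h2]

theorem sievedWeight_prime_pow {p k : ℕ} (hp : p.Prime) (hk : 3 ≤ k) :
    sievedWeight (p ^ k) = 0 := by
  rw [sievedWeight, ofPrimePow_apply_prime_pow _ hp (by omega)]
  simp [show k ≠ 1 by omega, show k ≠ 2 by omega]

theorem sievedWeight_mul_oddIndicator : sievedWeight * oddIndicator = sqfreeWeight := by
  rw [(sievedWeight_isMultiplicative.mul
    oddIndicator_isMultiplicative).eq_iff_eq_on_prime_powers _ _ sqfreeWeight_isMultiplicative]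
  intro p k hp
  rw [mul_apply_prime_pow _ _ hp]
  rcases Nat.eq_zero_or_pos k with rfl | hk
  · simp [sievedWeight_one, oddIndicator_isMultiplicative.1,
      show sqfreeWeight 1 = 1 from sqfreeWeight_isMultiplicative.1]
  rw [sqfreeWeight, ofPrimePow_apply_prime_pow _ hp hk.ne']
  by_cases h2 : p = 2
  · subst h2
    simp only [if_true]
    refine Finset.sum_eq_zero fun i _ => ?_
    rcases Nat.eq_zero_or_pos i with rfl | hi
    · simp [oddIndicator_two_pow hk.ne']
    · simp [sievedWeight_two_pow hi.ne']
  · have h3 := two_lt_cast_prime hp h2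
    have h4 : (p : ℝ) - 2 ≠ 0 := by linarith
    simp only [oddIndicator_prime_pow hp h2, mul_one, h2, if_false]
    by_cases h1 : k = 1
    · subst h1
      simp [Finset.sum_range_succ, sievedWeight_one, sievedWeight_prime hp h2]
      field_simp; ring
    · obtain ⟨j, rfl⟩ : ∃ j, k = j + 2 := ⟨k - 2, by omega⟩
      rw [show j + 2 + 1 = 3 + j by ring, Finset.sum_range_add,
        Finset.sum_eq_zero (s := Finset.range j) fun i _ => sievedWeight_prime_pow hp (by omega)]
      simp [Finset.sum_range_succ, sievedWeight_one, sievedWeight_prime hp h2,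
        sievedWeight_prime_sq hp h2]
      field_simp; ring

theorem sqfreeWeight_mul_realId (n : ℕ) : (sqfreeWeight * realId) n = n * oddPrimeFactor n := by
  have hm : (realId.pmul oddPrimeFactor).IsMultiplicative :=
    realId_isMultiplicative.pmul oddPrimeFactor_isMultiplicative
  suffices h : sqfreeWeight * realId = realId.pmul oddPrimeFactor by
    rw [h, ArithmeticFunction.pmul_apply, realId_apply]
  rw [(sqfreeWeight_isMultiplicative.mul
    realId_isMultiplicative).eq_iff_eq_on_prime_powers _ _ hm]
  intro p k hp
  rw [mul_apply_prime_pow _ _ hp]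
  have u1 : sqfreeWeight 1 = 1 := sqfreeWeight_isMultiplicative.1
  rcases Nat.eq_zero_or_pos k with rfl | hk
  · simp [u1, realId_apply, oddPrimeFactor_isMultiplicative.1]
  obtain ⟨j, rfl⟩ : ∃ j, k = j + 1 := ⟨k - 1, by omega⟩
  have uk : ∀ i, sqfreeWeight (p ^ (2 + i)) = 0 := fun i => by
    rw [sqfreeWeight, ofPrimePow_apply_prime_pow _ hp (by omega)]
    simp [show 2 + i ≠ 1 by omega]
  have up : sqfreeWeight (p ^ 1) = if p = 2 then 0 else (p : ℝ) / ((p : ℝ) - 2) := by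
    rw [sqfreeWeight, ofPrimePow_apply_prime_pow _ hp one_ne_zero]; simp
  rw [show j + 1 + 1 = 2 + j by ring, Finset.sum_range_add, Finset.sum_eq_zero (s := Finset.range j)
    fun i _ => by rw [uk, zero_mul]]
  rw [ArithmeticFunction.pmul_apply, oddPrimeFactor, ofPrimePow_apply_prime_pow _ hp (by omega)]
  simp only [Finset.sum_range_succ, Finset.sum_range_zero, up, pow_zero, u1, realId_apply]
  by_cases h2 : p = 2
  · simp [h2]
  · have h3 := two_lt_cast_prime hp h2
    have h4 : (p : ℝ) - 2 ≠ 0 := by linarith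
    simp only [h2, if_false]
    push_cast
    field_simp; ring

/-- The product over odd primes appearing in the singular series. -/
noncomputable def twinConst : ℝ :=
  ∏' p : Nat.Primes, if 2 < (p : ℕ) then (1 - 1 / ((p : ℝ) - 1) ^ 2) else 1

theorem oddPrimeFactor_apply {n : ℕ} (hn : n ≠ 0) : oddPrimeFactor n =
    ∏ p ∈ n.primeFactors.filter (fun p => 2 < p), ((p : ℝ) - 1) / ((p : ℝ) - 2) := by
  simp only [oddPrimeFactor, ofPrimePow, ArithmeticFunction.coe_mk, hn, if_false]
  rw [Finsupp.prod, Nat.support_factorization, Finset.prod_filter]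
  refine Finset.prod_congr rfl fun p hp => ?_
  have := (Nat.prime_of_mem_primeFactors hp).two_le
  by_cases h : p = 2
  · simp [h]
  · rw [if_neg h, if_pos (by omega)]

theorem singularSeries_two_mul {m : ℕ} (hm : m ≠ 0) :
    singularSeries (2 * m) = 2 * twinConst * oddPrimeFactor m := by
  rw [singularSeries, if_pos (even_two_mul m), oddPrimeFactor_apply hm, twinConst,
    Nat.primeFactors_mul two_ne_zero hm, Nat.prime_two.primeFactors, Finset.filter_union,
    Finset.filter_singleton]
  simp

theorem singularSeries_of_odd {n : ℕ} (hn : Odd n) : singularSeries n = 0 := by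
  rw [singularSeries, if_neg (Nat.not_even_iff_odd.2 hn)]

theorem sum_mul_convolution (f g : ArithmeticFunction ℝ) (G : ℕ → ℝ) (N : ℕ)
    (hG : ∀ n, N < n → G n = 0) :
    ∑ n ∈ Finset.Ioc 0 N, G n * (f * g) n =
      ∑ a ∈ Finset.Ioc 0 N, f a * ∑ b ∈ Finset.Ioc 0 N, g b * G (a * b) := by
  simp only [ArithmeticFunction.mul_apply, Finset.mul_sum]
  trans ∑ n ∈ Finset.Ioc 0 N, ∑ x ∈ Finset.Ioc 0 N ×ˢ Finset.Ioc 0 N with x.1 * x.2 = n,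
      G n * (f x.1 * g x.2)
  · refine Finset.sum_congr rfl fun n hn => ?_
    simp only [Finset.mem_Ioc] at hn
    rw [Nat.divisorsAntidiagonal_eq_prod_filter_of_le hn.1.ne' hn.2]
  · simp_rw [Finset.sum_filter]
    rw [Finset.sum_comm, Finset.sum_product]
    refine Finset.sum_congr rfl fun a ha => Finset.sum_congr rfl fun b hb => ?_
    rw [Finset.mem_Ioc] at ha hb
    rw [Finset.sum_ite_eq (Finset.Ioc 0 N) (a * b)]
    split_ifs with h
    · ring
    · rw [hG (a * b)]
      · simp
      · have : 0 < a * b := Nat.mul_pos ha.1 hb.1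
        simp only [Finset.mem_Ioc, not_and] at h
        exact not_le.1 (h this)

theorem sievedWeight_two : sievedWeight 2 = 0 := by
  simpa using sievedWeight_two_pow one_ne_zero

theorem sievedWeight_four : sievedWeight 4 = 0 := sievedWeight_two_pow (k := 2) two_ne_zero

theorem summable_of_prime_pow {f g : ℕ → ℝ} (f_nonneg : ∀ n, 0 ≤ f n) (f_zero : f 0 = 0)
    (f_one : f 1 = 1) (f_mul : ∀ {m n : ℕ}, m.Coprime n → f (m * n) = f m * f n)
    (f_pow : ∀ {p k : ℕ}, p.Prime → 3 ≤ k → f (p ^ k) = 0)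
    (g_nonneg : ∀ n, 0 ≤ g n) (hg : Summable g)
    (hfg : ∀ {p : ℕ}, p.Prime → f p + f (p ^ 2) ≤ g p) : Summable f := by
  have tsum_le : ∀ {p : ℕ}, p.Prime → ∑' e, f (p ^ e) ≤ 1 + g p := fun {p} hp => by
    rw [tsum_eq_sum (s := Finset.range 3) fun e he => f_pow hp (by simpa using he)]
    simp only [Finset.sum_range_succ, Finset.sum_range_zero, pow_zero, pow_one, f_one]
    linarith [hfg hp]
  have hs : ∀ {p : ℕ}, p.Prime → Summable fun n => ‖f (p ^ n)‖ := fun {p} hp =>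
    summable_of_ne_finset_zero (s := Finset.range 3) fun e he => by
      rw [f_pow hp (by simpa using he), norm_zero]
  refine summable_of_sum_range_le (c := Real.exp (∑' n, g n)) f_nonneg fun N => ?_
  obtain ⟨h1, h2⟩ := EulerProduct.summable_and_hasSum_factoredNumbers_prod_filter_prime_tsum
    f_one f_mul hs (Finset.range N)
  have h3 : ∑ n ∈ Finset.range N, f n ≤
      ∏ p ∈ Finset.range N with Nat.Prime p, ∑' (n : ℕ), f (p ^ n) := by
    have h4 := (hasSum_subtype_iff_indicator (s := Nat.factoredNumbers (Finset.range N))).1 h2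
    refine le_trans ?_ (sum_le_hasSum (Finset.range N) (fun n _ => ?_) h4)
    · refine Finset.sum_le_sum fun n hn => ?_
      rcases Nat.eq_zero_or_pos n with rfl | hn0
      · rw [f_zero]; exact Set.indicator_nonneg (fun _ _ => f_nonneg _) _
      · rw [Set.indicator_of_mem]
        rw [Nat.mem_factoredNumbers]
        refine ⟨hn0.ne', fun p hp => ?_⟩
        have := Nat.le_of_dvd hn0 (Nat.dvd_of_mem_primeFactorsList hp)
        simp only [Finset.mem_range] at hn ⊢
        omega
    · exact Set.indicator_nonneg (fun _ _ => f_nonneg _) _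
  refine h3.trans ((Finset.prod_le_prod (fun p hp => tsum_nonneg fun _ => f_nonneg _)
    fun p hp => tsum_le (Finset.mem_filter.1 hp).2).trans ?_)
  refine (Real.prod_one_add_le_exp_sum _ g_nonneg).trans ?_
  exact Real.exp_le_exp.2 (hg.sum_le_tsum _ fun _ _ => g_nonneg _)

theorem abs_sievedWeight_prime_le {p : ℕ} (hp : p.Prime) : |sievedWeight p| ≤ 6 / p := by
  by_cases h2 : p = 2
  · rw [h2, sievedWeight_two, abs_zero]; positivity
  · have h3 := two_lt_cast_prime hp h2
    rw [sievedWeight_prime hp h2, abs_of_nonneg (div_nonneg two_pos.le (by linarith)),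
      div_le_div_iff₀ (by linarith) (by linarith)]
    linarith

theorem abs_sievedWeight_prime_sq_le {p : ℕ} (hp : p.Prime) : |sievedWeight (p ^ 2)| ≤ 3 := by
  by_cases h2 : p = 2
  · rw [h2, sievedWeight_two_pow two_ne_zero]; simp
  · have h3 := two_lt_cast_prime hp h2
    rw [sievedWeight_prime_sq hp h2, neg_div, abs_neg,
      abs_of_nonneg (div_nonneg (by linarith) (by linarith)), div_le_iff₀ (by linarith)]
    linarith

theorem summable_abs_sievedWeight_mul_rpow {σ : ℝ} (hσ : 1 / 2 < σ) :
    Summable fun n : ℕ => |sievedWeight n| * (n : ℝ) ^ (-σ) := by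
  refine summable_of_prime_pow
    (g := fun n : ℕ => 6 * (n : ℝ) ^ (-(1 + σ)) + 3 * (n : ℝ) ^ (-(2 * σ)))
    (fun n => by positivity) (by simp) (by simp [sievedWeight_one]) ?_ ?_
    (fun n => by positivity) ?_ ?_
  · intro m n hmn
    rw [sievedWeight_isMultiplicative.2 hmn, abs_mul, Nat.cast_mul,
      Real.mul_rpow (Nat.cast_nonneg _) (Nat.cast_nonneg _)]
    ring
  · intro p k hp hk
    rw [sievedWeight_prime_pow hp hk]; simp
  · exact ((Real.summable_nat_rpow.2 (by linarith)).mul_left 6).add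
      ((Real.summable_nat_rpow.2 (by linarith)).mul_left 3)
  · intro p hp
    have hp0 : (0 : ℝ) < p := by exact_mod_cast hp.pos
    refine add_le_add ?_ ?_
    · refine (mul_le_mul_of_nonneg_right (abs_sievedWeight_prime_le hp) (by positivity)).trans_eq ?_
      rw [neg_add, Real.rpow_add hp0, Real.rpow_neg_one]
      ring
    · refine (mul_le_mul_of_nonneg_right (abs_sievedWeight_prime_sq_le hp)
        (by positivity)).trans_eq ?_
      rw [Nat.cast_pow, ← Real.rpow_natCast, ← Real.rpow_mul hp0.le]
      congr 2
      push_cast; ring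

theorem summable_norm_sievedWeight_div :
    Summable fun n : ℕ => ‖sievedWeight n / n‖ := by
  refine (summable_abs_sievedWeight_mul_rpow (σ := 1) (by norm_num)).congr fun n => ?_
  rw [Real.rpow_neg_one, norm_div, Real.norm_eq_abs, Real.norm_natCast, div_eq_mul_inv]

theorem summable_norm_sievedWeight_div_sq :
    Summable fun n : ℕ => ‖sievedWeight n / (n : ℝ) ^ 2‖ := by
  refine (summable_abs_sievedWeight_mul_rpow (σ := 2) (by norm_num)).congr fun n => ?_
  rw [Real.rpow_neg (Nat.cast_nonneg _), norm_div, Real.norm_eq_abs, norm_pow, Real.norm_natCast,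
    div_eq_mul_inv]
  norm_cast

theorem summable_norm_sievedWeight_mul_log :
    Summable fun n : ℕ => ‖sievedWeight n / n * Real.log n‖ := by
  refine Summable.of_nonneg_of_le (fun _ => norm_nonneg _) (fun n => ?_)
    ((summable_abs_sievedWeight_mul_rpow (σ := 3 / 4) (by norm_num)).mul_left 4)
  rcases Nat.eq_zero_or_pos n with rfl | hn
  · simp
  have hn' : (0 : ℝ) < n := by exact_mod_cast hn
  have h1 : Real.log n ≤ (n : ℝ) ^ (1 / 4 : ℝ) / (1 / 4) :=
    Real.log_le_rpow_div hn'.le (by norm_num)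
  have h2 : (n : ℝ) ^ (-(3 / 4) : ℝ) = (n : ℝ) ^ (1 / 4 : ℝ) / n := by
    rw [← Real.rpow_sub_one hn'.ne']; norm_num
  rw [norm_mul, norm_div, Real.norm_natCast, Real.norm_eq_abs, Real.norm_eq_abs,
    abs_of_nonneg (Real.log_natCast_nonneg n), h2]
  calc |sievedWeight n| / n * Real.log n
      ≤ |sievedWeight n| / n * ((n : ℝ) ^ (1 / 4 : ℝ) / (1 / 4)) := by gcongr
    _ = _ := by ring

theorem tsum_sievedWeight_mul_log_eq_zero : ∑' n : ℕ, sievedWeight n / n * Real.log n = 0 := by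
  let f : ℕ → TrivSqZeroExt ℝ ℝ := fun n =>
    TrivSqZeroExt.inl (sievedWeight n / n) + TrivSqZeroExt.inr (sievedWeight n / n * Real.log n)
  have fst_f : ∀ n, (f n).fst = sievedWeight n / n := fun n => by simp [f]
  have snd_f : ∀ n, (f n).snd = sievedWeight n / n * Real.log n := fun n => by simp [f]
  have hsum : Summable fun n => ‖f n‖ := by
    refine (summable_norm_sievedWeight_div.add summable_norm_sievedWeight_mul_log).congr
      fun n => ?_
    rw [TrivSqZeroExt.norm_def, fst_f, snd_f]
  have hmul : ∀ {m n : ℕ}, m.Coprime n → f (m * n) = f m * f n := fun {m n} hmn => by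
    rcases Nat.eq_zero_or_pos m with rfl | hm
    · simp [f]
    rcases Nat.eq_zero_or_pos n with rfl | hn
    · simp [f]
    have hm' : (m : ℝ) ≠ 0 := by exact_mod_cast hm.ne'
    have hn' : (n : ℝ) ≠ 0 := by exact_mod_cast hn.ne'
    ext
    · rw [TrivSqZeroExt.fst_mul, fst_f, fst_f, fst_f, sievedWeight_isMultiplicative.2 hmn]
      push_cast; field_simp
    · rw [TrivSqZeroExt.snd_mul, fst_f, fst_f, snd_f, snd_f, snd_f,
        sievedWeight_isMultiplicative.2 hmn]
      push_cast
      rw [Real.log_mul hm' hn']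
      simp only [smul_eq_mul, MulOpposite.smul_eq_mul_unop, MulOpposite.unop_op]
      field_simp; ring
  have hprod := EulerProduct.eulerProduct_hasProd (f := f)
    (by ext <;> simp [f, sievedWeight_one]) hmul hsum (by simp [f])
  have hlocal : ∀ p : Nat.Primes, (∑' e, f ((p : ℕ) ^ e)).snd = 0 := fun p => by
    have hp := p.2
    rw [tsum_eq_sum (s := Finset.range 3) fun e he => by
      ext <;> simp [f, sievedWeight_prime_pow hp (show 3 ≤ e by simpa using he)]]
    simp only [Finset.sum_range_succ, Finset.sum_range_zero, TrivSqZeroExt.snd_add, snd_f,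
      TrivSqZeroExt.snd_zero]
    by_cases h2 : (p : ℕ) = 2
    · simp [h2, sievedWeight_two, sievedWeight_four]
    · have h3 := two_lt_cast_prime hp h2
      have h4 : ((p : ℕ) : ℝ) - 2 ≠ 0 := by linarith
      rw [pow_one, sievedWeight_prime hp h2, sievedWeight_prime_sq hp h2]
      push_cast
      rw [Real.log_pow]
      simp
      field_simp
      ring
  have hsnd : (∑' n, f n).snd = 0 := by
    have hc : IsClosed {x : TrivSqZeroExt ℝ ℝ | x.snd = 0} :=
      isClosed_eq TrivSqZeroExt.continuous_snd continuous_const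
    refine hc.mem_of_tendsto hprod (Filter.Eventually.of_forall fun s => ?_)
    refine Finset.prod_induction _ (fun x : TrivSqZeroExt ℝ ℝ => x.snd = 0)
      (fun a b ha hb => ?_) (by simp) fun p _ => hlocal p
    simp [TrivSqZeroExt.snd_mul, ha, hb]
  rw [← hsnd, ← (TrivSqZeroExt.hasSum_snd ℝ hsum.of_norm.hasSum).tsum_eq]
  exact tsum_congr fun n => (snd_f n).symm

theorem hasProd_twinConst : HasProd (fun p : Nat.Primes =>
    if 2 < (p : ℕ) then (1 - 1 / ((p : ℝ) - 1) ^ 2) else 1) twinConst := by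
  refine Multipliable.hasProd ?_
  have h : Summable fun p : Nat.Primes =>
      if 2 < (p : ℕ) then -(1 / ((p : ℝ) - 1) ^ 2) else 0 := by
    refine Summable.of_norm_bounded (g := fun p : Nat.Primes => 4 * (1 / (p : ℝ) ^ 2))
      (((Real.summable_one_div_nat_pow.2 one_lt_two).comp_injective
        Nat.Primes.coe_nat_injective).mul_left 4) fun p => ?_
    split_ifs with h2
    · have h3 : (3 : ℝ) ≤ (p : ℕ) := by exact_mod_cast h2
      rw [norm_neg, Real.norm_of_nonneg (by positivity), mul_one_div,
        div_le_div_iff₀ (by nlinarith) (by positivity)]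
      nlinarith
    · rw [norm_zero]; positivity
  refine (Real.multipliable_one_add_of_summable h).congr fun p => ?_
  split_ifs <;> ring

theorem twinConst_mul_tsum_sievedWeight_div : twinConst * ∑' n : ℕ, sievedWeight n / n = 1 := by
  have hprod := EulerProduct.eulerProduct_hasProd (f := fun n : ℕ => sievedWeight n / n)
    (by simp [sievedWeight_one]) (fun {m n} hmn => by
      simp only [sievedWeight_isMultiplicative.2 hmn, Nat.cast_mul, mul_div_mul_comm])
    summable_norm_sievedWeight_div (by simp)
  refine (hasProd_twinConst.mul hprod).unique ?_
  convert hasProd_one with p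
  have hp := p.2
  rw [tsum_eq_sum (s := Finset.range 3) fun e he => by
    rw [sievedWeight_prime_pow hp (show 3 ≤ e by simpa using he), zero_div]]
  simp only [Finset.sum_range_succ, Finset.sum_range_zero]
  by_cases h2 : (p : ℕ) = 2
  · simp [h2, sievedWeight_two, sievedWeight_four, sievedWeight_one]
  · have h3 := two_lt_cast_prime hp h2
    have h4 : ((p : ℕ) : ℝ) - 2 ≠ 0 := by linarith
    have h5 : ((p : ℕ) : ℝ) - 1 ≠ 0 := by linarith
    rw [if_pos (hp.two_le.lt_of_ne' h2), pow_one, sievedWeight_prime hp h2,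
      sievedWeight_prime_sq hp h2]
    simp only [pow_zero, sievedWeight_one]
    push_cast
    field_simp
    ring

theorem summable_norm_oddIndicator_div_sq :
    Summable fun n : ℕ => ‖oddIndicator n / (n : ℝ) ^ 2‖ := by
  refine Summable.of_nonneg_of_le (fun _ => norm_nonneg _) (fun n => ?_)
    (Real.summable_one_div_nat_pow.2 one_lt_two)
  rw [norm_div, norm_pow, Real.norm_natCast]
  gcongr
  rw [oddIndicator_apply]
  split_ifs <;> simp

theorem twinConst_mul_tsum_div_sq :
    twinConst * ((∑' n : ℕ, oddIndicator n / (n : ℝ) ^ 2) *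
      ∑' n : ℕ, sievedWeight n / (n : ℝ) ^ 2) = 1 := by
  have hprod := EulerProduct.eulerProduct_hasProd (f := fun n : ℕ => sievedWeight n / (n : ℝ) ^ 2)
    (by simp [sievedWeight_one]) (fun {m n} hmn => by
      simp only [sievedWeight_isMultiplicative.2 hmn, Nat.cast_mul, mul_pow, mul_div_mul_comm])
    summable_norm_sievedWeight_div_sq (by simp)
  have hprod' := EulerProduct.eulerProduct_hasProd (f := fun n : ℕ => oddIndicator n / (n : ℝ) ^ 2)
    (by simp [oddIndicator_isMultiplicative.1]) (fun {m n} hmn => by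
      simp only [oddIndicator_isMultiplicative.2 hmn, Nat.cast_mul, mul_pow, mul_div_mul_comm])
    summable_norm_oddIndicator_div_sq (by simp)
  refine (hasProd_twinConst.mul (hprod'.mul hprod)).unique ?_
  convert hasProd_one with p
  have hp := p.2
  rw [tsum_eq_sum (f := fun e => sievedWeight ((p : ℕ) ^ e) / (((p : ℕ) ^ e : ℕ) : ℝ) ^ 2)
    (s := Finset.range 3) fun e he => by
    rw [sievedWeight_prime_pow hp (show 3 ≤ e by simpa using he), zero_div]]
  simp only [Finset.sum_range_succ, Finset.sum_range_zero]
  by_cases h2 : (p : ℕ) = 2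
  · rw [tsum_eq_single 0 fun e he => by rw [h2, oddIndicator_two_pow he, zero_div]]
    simp [h2, sievedWeight_two, sievedWeight_four, sievedWeight_one, oddIndicator_apply]
  · have h3 := two_lt_cast_prime hp h2
    have h4 : ((p : ℕ) : ℝ) - 2 ≠ 0 := by linarith
    have h5 : ((p : ℕ) : ℝ) - 1 ≠ 0 := by linarith
    have h6 : ((p : ℕ) : ℝ) ^ 2 - 1 ≠ 0 := by nlinarith
    have hgeom : ∑' e : ℕ, oddIndicator ((p : ℕ) ^ e) / (((p : ℕ) ^ e : ℕ) : ℝ) ^ 2 =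
        (1 - (((p : ℕ) : ℝ) ^ 2)⁻¹)⁻¹ := by
      rw [← tsum_geometric_of_lt_one (by positivity) (inv_lt_one_of_one_lt₀ (by nlinarith))]
      refine tsum_congr fun e => ?_
      rw [oddIndicator_prime_pow hp h2]
      push_cast
      rw [one_div, inv_pow, ← pow_mul, ← pow_mul, mul_comm]
    rw [hgeom, if_pos (hp.two_le.lt_of_ne' h2), pow_one, sievedWeight_prime hp h2,
      sievedWeight_prime_sq hp h2]
    simp only [pow_zero, sievedWeight_one]
    push_cast
    have h7 : (1 - (((p : ℕ) : ℝ) ^ 2)⁻¹)⁻¹ = ((p : ℕ) : ℝ) ^ 2 / (((p : ℕ) : ℝ) ^ 2 - 1) := by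
      field_simp
    rw [h7]
    field_simp
    ring

/-- The periodic function `{x} (1 - {x}) / 2`. -/
noncomputable def parabolaWave (x : ℝ) : ℝ := Int.fract x * (1 - Int.fract x) / 2

theorem parabolaWave_nonneg (x : ℝ) : 0 ≤ parabolaWave x :=
  div_nonneg (mul_nonneg (Int.fract_nonneg x) (by linarith [Int.fract_lt_one x])) two_pos.le

theorem parabolaWave_le (x : ℝ) : parabolaWave x ≤ 1 / 8 := by
  unfold parabolaWave; nlinarith [sq_nonneg (Int.fract x - 1 / 2)]

theorem abs_parabolaWave_sub_le (x y : ℝ) : |parabolaWave x - parabolaWave y| ≤ |x - y| / 2 := by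
  wlog h : x ≤ y generalizing x y
  · rw [abs_sub_comm, abs_sub_comm x]; exact this y x (not_le.1 h).le
  have hx0 := Int.fract_nonneg x
  have hx1 := Int.fract_lt_one x
  have hy0 := Int.fract_nonneg y
  have hy1 := Int.fract_lt_one y
  have hx := Int.floor_add_fract x
  have hy := Int.floor_add_fract y
  rw [abs_sub_comm x, abs_of_nonneg (sub_nonneg.2 h), abs_le]
  unfold parabolaWave
  rcases (Int.floor_mono h).eq_or_lt with he | hlt
  · rw [he] at hx
    constructor <;> nlinarith
  · have : (⌊x⌋ : ℝ) + 1 ≤ ⌊y⌋ := by exact_mod_cast hlt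
    constructor <;> nlinarith

theorem continuous_parabolaWave : Continuous parabolaWave :=
  (LipschitzWith.of_dist_le_mul (K := 1) fun x y => by
    rw [Real.dist_eq, Real.dist_eq, NNReal.coe_one, one_mul]
    linarith [abs_parabolaWave_sub_le x y, abs_nonneg (x - y)]).continuous

theorem parabolaWave_of_mem {n : ℕ} {u : ℝ} (h1 : (n : ℝ) ≤ u) (h2 : u ≤ n + 1) :
    parabolaWave u = (u - n) * (n + 1 - u) / 2 := by
  unfold parabolaWave
  rcases h2.eq_or_lt with rfl | h2
  · rw [show ((n : ℝ) + 1) = ((n + 1 : ℕ) : ℝ) by push_cast; ring, Int.fract_natCast]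
    push_cast; ring
  · have : ⌊u⌋ = n := Int.floor_eq_iff.2 ⟨by exact_mod_cast h1, by exact_mod_cast h2⟩
    rw [Int.fract, this]
    push_cast; ring

/-- The sum of `(x - m)₊` over positive integers `m`. -/
noncomputable def rieszSum (x : ℝ) : ℝ := ∑ m ∈ Finset.Ioc 0 ⌊x⌋₊, (x - m)

theorem sum_Ioc_sub_cast (x : ℝ) (n : ℕ) :
    ∑ m ∈ Finset.Ioc 0 n, (x - m) = n * x - n * (n + 1) / 2 := by
  induction n with
  | zero => simp
  | succ n ih => rw [Finset.sum_Ioc_succ_top (Nat.zero_le _), ih]; push_cast; ring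

theorem rieszSum_eq {x : ℝ} (hx : 0 ≤ x) : rieszSum x = x ^ 2 / 2 - x / 2 + parabolaWave x := by
  rw [rieszSum, sum_Ioc_sub_cast,
    parabolaWave_of_mem (Nat.floor_le hx) (Nat.lt_floor_add_one x).le]
  ring

theorem rieszSum_of_lt_one {x : ℝ} (hx : x < 1) : rieszSum x = 0 := by
  rw [rieszSum, Nat.floor_eq_zero.2 hx]; simp

/-- The integral of `parabolaWave u / u ^ 2` from `1` to `v`. -/
noncomputable def waveIntegral (v : ℝ) : ℝ := ∫ u in (1 : ℝ)..v, parabolaWave u / u ^ 2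

theorem continuousOn_parabolaWave_div_sq {s : Set ℝ} (hs : ∀ u ∈ s, 0 < u) :
    ContinuousOn (fun u => parabolaWave u / u ^ 2) s :=
  continuous_parabolaWave.continuousOn.div (by fun_prop) fun u hu => pow_ne_zero 2 (hs u hu).ne'

theorem uIcc_pos {a b : ℝ} (ha : 0 < a) (hb : 0 < b) : ∀ u ∈ Set.uIcc a b, 0 < u :=
  fun _ hu => (lt_min ha hb).trans_le hu.1

theorem intervalIntegrable_parabolaWave_div_sq {a b : ℝ} (ha : 0 < a) (hb : 0 < b) :
    IntervalIntegrable (fun u => parabolaWave u / u ^ 2) volume a b :=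
  (continuousOn_parabolaWave_div_sq (uIcc_pos ha hb)).intervalIntegrable

theorem hasDerivAt_waveIntegral {v : ℝ} (hv : 0 < v) :
    HasDerivAt waveIntegral (parabolaWave v / v ^ 2) v :=
  intervalIntegral.integral_hasDerivAt_right (intervalIntegrable_parabolaWave_div_sq one_pos hv)
    ((continuousOn_parabolaWave_div_sq (s := Set.Ioi 0) fun _ h => h).stronglyMeasurableAtFilter
      isOpen_Ioi _ hv)
    ((continuousOn_parabolaWave_div_sq (s := Set.Ioi 0) fun _ h => h).continuousAt
      (Ioi_mem_nhds hv))

theorem waveIntegral_mono {v w : ℝ} (hv : 0 < v) (h : v ≤ w) :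
    waveIntegral v ≤ waveIntegral w := by
  have : MonotoneOn waveIntegral (Set.Ioi 0) := by
    refine monotoneOn_of_deriv_nonneg (convex_Ioi 0)
      (fun u hu => (hasDerivAt_waveIntegral hu).continuousAt.continuousWithinAt)
      (fun u hu => ?_) fun u hu => ?_
    · rw [interior_Ioi] at hu
      exact (hasDerivAt_waveIntegral hu).differentiableAt.differentiableWithinAt
    · rw [interior_Ioi] at hu
      rw [(hasDerivAt_waveIntegral hu).deriv]
      exact div_nonneg (parabolaWave_nonneg u) (sq_nonneg u)
  exact this hv (hv.trans_le h) h

theorem waveIntegral_sub_le {v w : ℝ} (hv : 0 < v) (h : v ≤ w) :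
    waveIntegral w - waveIntegral v ≤ (v⁻¹ - w⁻¹) / 8 := by
  have hd : ∀ u : ℝ, 0 < u → HasDerivAt (fun u => waveIntegral u + u⁻¹ / 8)
      (parabolaWave u / u ^ 2 + -(u ^ 2)⁻¹ / 8) u := fun u hu =>
    (hasDerivAt_waveIntegral hu).add ((hasDerivAt_inv hu.ne').div_const 8)
  have : AntitoneOn (fun u => waveIntegral u + u⁻¹ / 8) (Set.Ioi 0) := by
    refine antitoneOn_of_deriv_nonpos (convex_Ioi 0)
      (fun u hu => (hd u hu).continuousAt.continuousWithinAt)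
      (fun u hu => ?_) fun u hu => ?_
    · rw [interior_Ioi] at hu
      exact (hd u hu).differentiableAt.differentiableWithinAt
    · rw [interior_Ioi] at hu
      rw [(hd u hu).deriv]
      have := mul_le_mul_of_nonneg_right (parabolaWave_le u) (inv_nonneg.2 (sq_nonneg u))
      rw [div_eq_mul_inv]
      linarith
  have := this hv (hv.trans_le h) h
  simp only at this
  linarith

theorem waveIntegral_succ_sub {n : ℕ} (hn : n ≠ 0) :
    waveIntegral (n + 1 : ℕ) - waveIntegral n =
      Real.log (Stirling.stirlingSeq n) - Real.log (Stirling.stirlingSeq (n + 1)) := by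
  have hn0 : (0 : ℝ) < n := by exact_mod_cast Nat.pos_of_ne_zero hn
  have hn1 : (0 : ℝ) < (n + 1 : ℕ) := by positivity
  have hle : (n : ℝ) ≤ (n + 1 : ℕ) := by push_cast; linarith
  rw [waveIntegral, waveIntegral, intervalIntegral.integral_interval_sub_left
    (intervalIntegrable_parabolaWave_div_sq one_pos hn1)
    (intervalIntegrable_parabolaWave_div_sq one_pos hn0)]
  have key : ∀ u ∈ Set.uIcc (n : ℝ) (n + 1 : ℕ),
      HasDerivAt (fun u : ℝ => (-u + (2 * n + 1) * Real.log u + n * (n + 1) * u⁻¹) / 2)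
        (parabolaWave u / u ^ 2) u := fun u hu => by
    have hu0 := uIcc_pos hn0 hn1 u hu
    rw [Set.uIcc_of_le hle] at hu
    have := ((((hasDerivAt_id u).neg.add ((Real.hasDerivAt_log hu0.ne').const_mul
      (2 * (n : ℝ) + 1))).add ((hasDerivAt_inv hu0.ne').const_mul ((n : ℝ) * (n + 1)))).div_const 2)
    refine HasDerivAt.congr_deriv this ?_
    rw [parabolaWave_of_mem hu.1 (by simpa using hu.2)]
    field_simp
    ring
  rw [intervalIntegral.integral_eq_sub_of_hasDerivAt key
    (intervalIntegrable_parabolaWave_div_sq hn0 hn1), Stirling.log_stirlingSeq_formula,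
    Stirling.log_stirlingSeq_formula, Nat.factorial_succ, Nat.cast_mul,
    Real.log_mul hn1.ne' (by positivity), Real.log_div hn0.ne' (by positivity),
    Real.log_div hn1.ne' (by positivity), Real.log_exp, Real.log_mul two_ne_zero hn0.ne',
    Real.log_mul two_ne_zero hn1.ne']
  push_cast
  field_simp
  ring

theorem waveIntegral_natCast {n : ℕ} (hn : n ≠ 0) :
    waveIntegral n = Real.log (Stirling.stirlingSeq 1) - Real.log (Stirling.stirlingSeq n) := by
  induction n with
  | zero => exact absurd rfl hn
  | succ n ih =>
    rcases Nat.eq_zero_or_pos n with rfl | h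
    · simp [waveIntegral]
    · linarith [ih h.ne', waveIntegral_succ_sub h.ne']

theorem tendsto_waveIntegral_natCast : Filter.Tendsto (fun n : ℕ => waveIntegral n) Filter.atTop
    (nhds (1 - Real.log (2 * Real.pi) / 2)) := by
  have h := (Stirling.tendsto_stirlingSeq_sqrt_pi.log
    (Real.sqrt_ne_zero'.2 Real.pi_pos)).const_sub (Real.log (Stirling.stirlingSeq 1))
  have h1 : Real.log (Stirling.stirlingSeq 1) - Real.log (√Real.pi) =
      1 - Real.log (2 * Real.pi) / 2 := by
    rw [Stirling.log_stirlingSeq_formula, Real.log_sqrt Real.pi_pos.le,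
      Real.log_mul two_ne_zero Real.pi_ne_zero]
    simp
    ring
  rw [h1] at h
  refine h.congr' ?_
  filter_upwards [Filter.eventually_ne_atTop 0] with n hn
  exact (waveIntegral_natCast hn).symm

theorem waveIntegral_le_limit {v : ℝ} (hv : 0 < v) :
    waveIntegral v ≤ 1 - Real.log (2 * Real.pi) / 2 := by
  refine ge_of_tendsto tendsto_waveIntegral_natCast ?_
  filter_upwards [Filter.eventually_ge_atTop ⌈v⌉₊] with n hn
  exact waveIntegral_mono hv (Nat.ceil_le.1 hn)

theorem limit_sub_waveIntegral_le {v : ℝ} (hv : 0 < v) :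
    1 - Real.log (2 * Real.pi) / 2 - waveIntegral v ≤ v⁻¹ / 8 := by
  refine le_of_tendsto (tendsto_waveIntegral_natCast.sub_const _) ?_
  filter_upwards [Filter.eventually_ge_atTop ⌈v⌉₊] with n hn
  have := waveIntegral_sub_le hv (Nat.ceil_le.1 hn)
  have h2 : (0 : ℝ) ≤ (n : ℝ)⁻¹ := by positivity
  linarith

theorem abs_parabolaWave_sub_waveIntegral_le {x : ℝ} (hx : 0 < x) {b : ℕ} (hb : b ≠ 0) :
    |parabolaWave (x / b) - x * (waveIntegral (x / b) - waveIntegral (x / (b + 1 : ℕ)))| ≤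
      (x / b - x / (b + 1 : ℕ)) / 2 := by
  have hb0 : (0 : ℝ) < b := by exact_mod_cast Nat.pos_of_ne_zero hb
  have hlt : (b : ℝ) < (b + 1 : ℕ) := by push_cast; linarith
  have hd : ∀ t : ℝ, 0 < t →
      HasDerivAt (fun t => x * waveIntegral (x / t)) (-parabolaWave (x / t)) t := fun t ht => by
    have h1 : HasDerivAt (fun t => x / t) (-x / t ^ 2) t := by
      simpa using (hasDerivAt_const t x).fun_div (hasDerivAt_id' t) ht.ne'
    have h2 := ((hasDerivAt_waveIntegral (div_pos hx ht)).comp t h1).const_mul x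
    refine HasDerivAt.congr_deriv h2 ?_
    field_simp
  obtain ⟨c, hc, he⟩ := exists_hasDerivAt_eq_slope (fun t => x * waveIntegral (x / t))
    (fun t => -parabolaWave (x / t)) hlt
    (fun t ht => (hd t (hb0.trans_le ht.1)).continuousAt.continuousWithinAt)
    fun t ht => hd t (hb0.trans ht.1)
  have hc0 : 0 < c := hb0.trans hc.1
  have h3 : x * (waveIntegral (x / b) - waveIntegral (x / (b + 1 : ℕ))) = parabolaWave (x / c) := by
    have : ((b + 1 : ℕ) : ℝ) - b = 1 := by push_cast; ring
    rw [this, div_one] at he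
    linarith
  rw [h3]
  refine (abs_parabolaWave_sub_le _ _).trans ?_
  have h4 : x / c ≤ x / b := div_le_div_of_nonneg_left hx.le hb0 hc.1.le
  have h5 : x / (b + 1 : ℕ) ≤ x / c := div_le_div_of_nonneg_left hx.le hc0 hc.2.le
  rw [abs_of_nonneg (by linarith)]
  linarith

theorem abs_sum_parabolaWave_sub_le {x : ℝ} (hx : 1 ≤ x) :
    |∑ b ∈ Finset.Ioc 0 ⌊x⌋₊, parabolaWave (x / b) - x * (1 - Real.log (2 * Real.pi) / 2)| ≤
      2 * √x := by
  have hx0 : 0 < x := by linarith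
  have hs1 : 1 ≤ √x := Real.one_le_sqrt.2 hx
  have hss : √x * √x = x := Real.mul_self_sqrt hx0.le
  set N := ⌊x⌋₊ with hN
  set B := ⌊√x⌋₊ with hB
  have hBN : B ≤ N := Nat.floor_mono (by nlinarith)
  have hB1 : (B : ℝ) ≤ √x := Nat.floor_le (by positivity)
  have hB2 : √x < B + 1 := Nat.lt_floor_add_one _
  have hN1 : (N : ℝ) ≤ x := Nat.floor_le hx0.le
  have hN2 : x < N + 1 := Nat.lt_floor_add_one _
  have hsmall : |∑ b ∈ Finset.Ioc 0 B, parabolaWave (x / b)| ≤ √x / 8 := by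
    rw [abs_of_nonneg (Finset.sum_nonneg fun _ _ => parabolaWave_nonneg _)]
    have := Finset.sum_le_card_nsmul (Finset.Ioc 0 B) (fun b => parabolaWave (x / b)) (1 / 8)
      fun _ _ => parabolaWave_le _
    simp at this
    linarith
  have htel1 : ∑ b ∈ Finset.Ioc B N, x * (waveIntegral (x / b) - waveIntegral (x / (b + 1 : ℕ))) =
      x * (waveIntegral (x / (B + 1 : ℕ)) - waveIntegral (x / (N + 1 : ℕ))) := by
    rw [← Finset.mul_sum, ← Finset.Ico_add_one_add_one_eq_Ioc,
      ← neg_inj, ← mul_neg, ← Finset.sum_neg_distrib]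
    simp only [neg_sub]
    rw [Finset.sum_Ico_sub (fun b : ℕ => waveIntegral (x / b)) (by omega)]
    ring
  have htel2 : ∑ b ∈ Finset.Ioc B N, (x / b - x / (b + 1 : ℕ)) / 2 ≤ √x / 2 := by
    rw [← Finset.sum_div, ← Finset.Ico_add_one_add_one_eq_Ioc]
    have : ∑ b ∈ Finset.Ico (B + 1) (N + 1), (x / b - x / (b + 1 : ℕ)) =
        x / (B + 1 : ℕ) - x / (N + 1 : ℕ) := by
      rw [← neg_inj, ← Finset.sum_neg_distrib]
      simp only [neg_sub]
      rw [Finset.sum_Ico_sub (fun b : ℕ => x / (b : ℝ)) (by omega)]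
    rw [this]
    have h1 : x / (B + 1 : ℕ) ≤ √x := by
      rw [div_le_iff₀ (by positivity)]; push_cast; nlinarith
    have h2 : 0 ≤ x / (N + 1 : ℕ) := by positivity
    linarith
  have hlarge : |∑ b ∈ Finset.Ioc B N, parabolaWave (x / b) -
      x * (waveIntegral (x / (B + 1 : ℕ)) - waveIntegral (x / (N + 1 : ℕ)))| ≤ √x / 2 := by
    rw [← htel1, ← Finset.sum_sub_distrib]
    refine (Finset.abs_sum_le_sum_abs _ _).trans ((Finset.sum_le_sum fun b hb => ?_).trans htel2)
    exact abs_parabolaWave_sub_waveIntegral_le hx0 (by have := Finset.mem_Ioc.1 hb; omega)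
  have hv : 0 < x / (B + 1 : ℕ) := by positivity
  have hw : 0 < x / (N + 1 : ℕ) := by positivity
  have hw1 : x / (N + 1 : ℕ) ≤ 1 := by
    rw [div_le_one (by positivity)]; push_cast; exact hN2.le
  have hK1 : waveIntegral 1 = 0 := by simp [waveIntegral]
  have e1 : 0 ≤ x * (1 - Real.log (2 * Real.pi) / 2 - waveIntegral (x / (B + 1 : ℕ))) :=
    mul_nonneg hx0.le (by linarith [waveIntegral_le_limit hv])
  have e2 : x * (1 - Real.log (2 * Real.pi) / 2 - waveIntegral (x / (B + 1 : ℕ))) ≤ √x / 4 := by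
    refine (mul_le_mul_of_nonneg_left (limit_sub_waveIntegral_le hv) hx0.le).trans ?_
    rw [inv_div]
    have : x * (((B + 1 : ℕ) : ℝ) / x / 8) = ((B + 1 : ℕ) : ℝ) / 8 := by field_simp
    rw [this]
    push_cast
    linarith
  have e3 : 0 ≤ x * (0 - waveIntegral (x / (N + 1 : ℕ))) :=
    mul_nonneg hx0.le (by linarith [waveIntegral_mono hw hw1])
  have e4 : x * (0 - waveIntegral (x / (N + 1 : ℕ))) ≤ 1 / 8 := by
    have h1 := waveIntegral_sub_le hw hw1
    rw [hK1] at h1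
    refine (mul_le_mul_of_nonneg_left h1 hx0.le).trans ?_
    rw [inv_div]
    have : x * ((((N + 1 : ℕ) : ℝ) / x - 1⁻¹) / 8) = (((N + 1 : ℕ) : ℝ) - x) / 8 := by
      field_simp
    rw [this]
    push_cast
    linarith
  have hsplit : ∑ b ∈ Finset.Ioc 0 N, parabolaWave (x / b) =
      ∑ b ∈ Finset.Ioc 0 B, parabolaWave (x / b) + ∑ b ∈ Finset.Ioc B N, parabolaWave (x / b) :=
    (Finset.sum_Ioc_consecutive _ (Nat.zero_le _) hBN).symm
  rw [hsplit]
  rw [abs_le] at hsmall hlarge ⊢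
  constructor <;> linarith

theorem abs_sum_one_div_sub_le {x : ℝ} (hx : 1 ≤ x) :
    |x / 2 * (∑ b ∈ Finset.Ioc 0 ⌊x⌋₊, (1 : ℝ) / b - Real.log x -
      Real.eulerMascheroniConstant)| ≤ 1 := by
  have hx0 : 0 < x := by linarith
  set N := ⌊x⌋₊ with hN
  have hN0 : N ≠ 0 := (Nat.floor_pos.2 hx).ne'
  have hNp : (1 : ℝ) ≤ N := by exact_mod_cast Nat.floor_pos.2 hx
  have hN1 : (N : ℝ) ≤ x := Nat.floor_le hx0.le
  have hN2 : x < N + 1 := Nat.lt_floor_add_one _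
  have hh : ∑ b ∈ Finset.Ioc 0 N, (1 : ℝ) / b = harmonic N := by
    rw [harmonic_eq_sum_Icc, show Finset.Icc 1 N = Finset.Ioc 0 N by ext; simp; omega]
    push_cast
    simp
  rw [hh]
  have h1 := Real.eulerMascheroniSeq_lt_eulerMascheroniConstant N
  have h2 := Real.eulerMascheroniConstant_lt_eulerMascheroniSeq' N
  rw [Real.eulerMascheroniSeq] at h1
  rw [Real.eulerMascheroniSeq', if_neg hN0] at h2
  have h3 : Real.log x ≤ Real.log (N + 1) := Real.log_le_log hx0 hN2.le
  have h4 : Real.log N ≤ Real.log x := Real.log_le_log (by linarith) hN1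
  have h5 : Real.log (N + 1) - Real.log N ≤ 1 / N := by
    rw [← Real.log_div (by linarith) (by linarith)]
    refine (Real.log_le_sub_one_of_pos (by positivity)).trans_eq ?_
    field_simp; ring
  have h6 : |(harmonic N : ℝ) - Real.log x - Real.eulerMascheroniConstant| ≤ 1 / N := by
    rw [abs_le]; constructor <;> linarith
  rw [abs_mul, abs_of_pos (by linarith)]
  calc x / 2 * _ ≤ x / 2 * (1 / N) := by gcongr
    _ ≤ 1 := by rw [mul_one_div, div_div, div_le_one (by positivity)]; linarith

theorem tendsto_sum_one_div_sq : Filter.Tendsto (fun n : ℕ => ∑ b ∈ Finset.Ioc 0 n, 1 / (b : ℝ) ^ 2)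
    Filter.atTop (nhds (∑' b : ℕ, 1 / (b : ℝ) ^ 2)) := by
  have h := (Real.summable_one_div_nat_pow.2 one_lt_two).hasSum.tendsto_sum_nat
  refine (h.comp (Filter.tendsto_add_atTop_nat 1)).congr fun n => ?_
  simp only [Function.comp]
  rw [Finset.range_eq_Ico, Finset.sum_eq_sum_Ico_succ_bot (by omega)]
  simp only [Nat.cast_zero, ne_eq, OfNat.ofNat_ne_zero, not_false_eq_true, zero_pow, div_zero,
    zero_add]
  rfl

theorem tsum_one_div_sq_le {N : ℕ} (hN : N ≠ 0) :
    ∑' b : ℕ, 1 / (b : ℝ) ^ 2 ≤ ∑ b ∈ Finset.Ioc 0 N, 1 / (b : ℝ) ^ 2 + (1 : ℝ) / (N : ℝ) := by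
  refine le_of_tendsto tendsto_sum_one_div_sq ?_
  filter_upwards [Filter.eventually_ge_atTop N] with n hn
  have : ∑ b ∈ Finset.Ioc 0 n, 1 / (b : ℝ) ^ 2 + (1 : ℝ) / (n : ℝ) ≤
      ∑ b ∈ Finset.Ioc 0 N, 1 / (b : ℝ) ^ 2 + (1 : ℝ) / (N : ℝ) := by
    induction n, hn using Nat.le_induction with
    | base => exact le_rfl
    | succ n hn ih =>
      refine le_trans ?_ ih
      have hn0 : (0 : ℝ) < n := by exact_mod_cast (Nat.pos_of_ne_zero hN).trans_le hn
      rw [Finset.sum_Ioc_succ_top (Nat.zero_le _)]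
      push_cast
      have : (1 : ℝ) / n - (1 / (n + 1) ^ 2 + 1 / (n + 1)) = 1 / (n * (n + 1) ^ 2) := by
        field_simp; ring
      have h2 : (0 : ℝ) ≤ 1 / (n * (n + 1) ^ 2) := by positivity
      linarith
  have h2 : (0 : ℝ) ≤ 1 / (n : ℝ) := by positivity
  linarith

theorem le_tsum_one_div_sq (N : ℕ) :
    ∑ b ∈ Finset.Ioc 0 N, 1 / (b : ℝ) ^ 2 + (1 : ℝ) / ((N : ℝ) + 1) ≤
      ∑' b : ℕ, 1 / (b : ℝ) ^ 2 := by
  have hlim : Filter.Tendsto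
      (fun n : ℕ => ∑ b ∈ Finset.Ioc 0 n, 1 / (b : ℝ) ^ 2 + 1 / ((n : ℝ) + 1)) Filter.atTop
      (nhds (∑' b : ℕ, 1 / (b : ℝ) ^ 2)) := by
    simpa using tendsto_sum_one_div_sq.add tendsto_one_div_add_atTop_nhds_zero_nat
  refine Monotone.ge_of_tendsto (monotone_nat_of_le_succ fun n => ?_) hlim N
  rw [Finset.sum_Ioc_succ_top (Nat.zero_le _)]
  push_cast
  have : (1 / (n + 1) ^ 2 + 1 / (n + 1 + 1)) - (1 : ℝ) / (n + 1) =
      1 / ((n + 1) ^ 2 * (n + 1 + 1)) := by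
    field_simp; ring
  have h2 : (0 : ℝ) ≤ 1 / ((n + 1) ^ 2 * (n + 1 + 1)) := by positivity
  linarith

theorem abs_sq_mul_sum_one_div_sq_sub_le {x : ℝ} (hx : 1 ≤ x) :
    |x ^ 2 / 2 * (∑' b : ℕ, 1 / (b : ℝ) ^ 2 - ∑ b ∈ Finset.Ioc 0 ⌊x⌋₊, 1 / (b : ℝ) ^ 2) -
      x / 2| ≤ 1 := by
  have hx0 : 0 < x := by linarith
  set N := ⌊x⌋₊ with hN
  have hN0 : N ≠ 0 := (Nat.floor_pos.2 hx).ne'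
  have hNp : (1 : ℝ) ≤ N := by exact_mod_cast Nat.floor_pos.2 hx
  have hN1 : (N : ℝ) ≤ x := Nat.floor_le hx0.le
  have hN2 : x < N + 1 := Nat.lt_floor_add_one _
  have h1 := tsum_one_div_sq_le hN0
  have h2 := le_tsum_one_div_sq N
  set T := ∑' b : ℕ, 1 / (b : ℝ) ^ 2 - ∑ b ∈ Finset.Ioc 0 N, 1 / (b : ℝ) ^ 2 with hT
  have h3 : x ^ 2 * T ≤ x + 2 := by
    calc x ^ 2 * T ≤ x ^ 2 * (1 / N) := by gcongr; linarith
      _ ≤ x + 2 := by rw [mul_one_div, div_le_iff₀ (by linarith)]; nlinarith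
  have h4 : x - 1 ≤ x ^ 2 * T := by
    calc x - 1 ≤ x ^ 2 * (1 / (N + 1)) := by
          rw [mul_one_div, le_div_iff₀ (by linarith)]; nlinarith
      _ ≤ x ^ 2 * T := by gcongr; linarith
  rw [abs_le]
  constructor <;> linarith

/-- The sum of `rieszSum (x / b)` over positive integers `b`. -/
noncomputable def rieszDivisorSum (x : ℝ) : ℝ := ∑ b ∈ Finset.Ioc 0 ⌊x⌋₊, rieszSum (x / b)

/-- The main term in the asymptotic expansion of `rieszDivisorSum`. -/
noncomputable def rieszDivisorMain (x : ℝ) : ℝ :=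
  (∑' b : ℕ, 1 / (b : ℝ) ^ 2) / 2 * x ^ 2 - x * Real.log x / 2 + (1 + Bconst) / 2 * x

theorem abs_rieszDivisorSum_sub_le {x : ℝ} (hx : 1 ≤ x) :
    |rieszDivisorSum x - rieszDivisorMain x| ≤ 4 * √x := by
  have hs1 : 1 ≤ √x := Real.one_le_sqrt.2 hx
  have h1 := abs_sq_mul_sum_one_div_sq_sub_le hx
  have h2 := abs_sum_one_div_sub_le hx
  have h3 := abs_sum_parabolaWave_sub_le hx
  have h4 : rieszDivisorSum x = x ^ 2 / 2 * ∑ b ∈ Finset.Ioc 0 ⌊x⌋₊, 1 / (b : ℝ) ^ 2 -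
      x / 2 * ∑ b ∈ Finset.Ioc 0 ⌊x⌋₊, 1 / (b : ℝ) +
      ∑ b ∈ Finset.Ioc 0 ⌊x⌋₊, parabolaWave (x / b) := by
    rw [rieszDivisorSum, Finset.mul_sum, Finset.mul_sum, ← Finset.sum_sub_distrib,
      ← Finset.sum_add_distrib]
    refine Finset.sum_congr rfl fun b _ => ?_
    rw [rieszSum_eq (by positivity)]
    ring
  rw [h4, rieszDivisorMain, Bconst]
  rw [abs_le] at h1 h2 h3 ⊢
  constructor <;> nlinarith

theorem abs_rieszDivisorSum_sub_le_rpow {σ : ℝ} (h1 : 1 / 2 ≤ σ) (h2 : σ < 1) :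
    ∃ C : ℝ, 0 ≤ C ∧ ∀ x : ℝ, 0 < x →
      |rieszDivisorSum x - rieszDivisorMain x| ≤ C * x ^ σ := by
  set A := (∑' b : ℕ, 1 / (b : ℝ) ^ 2) / 2 with hA
  have hσ : 0 < 1 - σ := by linarith
  refine ⟨4 + (|A| + 1 / (1 - σ) / 2 + |(1 + Bconst) / 2|), by positivity, fun x hx => ?_⟩
  have hxσ : 0 < x ^ σ := Real.rpow_pos_of_pos hx σ
  rcases le_or_gt 1 x with h | h
  · refine (abs_rieszDivisorSum_sub_le h).trans ?_
    have h3 : √x ≤ x ^ σ := by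
      rw [Real.sqrt_eq_rpow]; exact Real.rpow_le_rpow_of_exponent_le h h1
    have h4 : 0 ≤ (|A| + 1 / (1 - σ) / 2 + |(1 + Bconst) / 2|) * x ^ σ := by positivity
    nlinarith
  · have hR : rieszDivisorSum x = 0 := by
      rw [rieszDivisorSum, Nat.floor_eq_zero.2 h]; simp
    have hx1 : x ≤ x ^ σ := by
      simpa using Real.rpow_le_rpow_of_exponent_ge hx h.le h2.le
    have hx2 : x ^ 2 ≤ x ^ σ := by nlinarith
    have hlog : |x * Real.log x| ≤ 1 / (1 - σ) * x ^ σ := by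
      have h5 := (Real.abs_log_mul_self_rpow_lt x (1 - σ) hx h.le hσ).le
      have h6 : x * Real.log x = (Real.log x * x ^ (1 - σ)) * x ^ σ := by
        rw [mul_assoc, ← Real.rpow_add hx]; simp; ring
      rw [h6, abs_mul, abs_of_pos hxσ]
      gcongr
    rw [hR, zero_sub, abs_neg, rieszDivisorMain, ← hA]
    have t1 : |A * x ^ 2| ≤ |A| * x ^ σ := by
      rw [abs_mul, abs_of_nonneg (sq_nonneg x)]; gcongr
    have t3 : |(1 + Bconst) / 2 * x| ≤ |(1 + Bconst) / 2| * x ^ σ := by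
      rw [abs_mul, abs_of_pos hx]; gcongr
    rw [abs_le] at hlog t1 t3 ⊢
    constructor <;> nlinarith

theorem sum_Ioc_eq_odd_add_even (f : ℕ → ℝ) (N : ℕ) :
    ∑ n ∈ Finset.Ioc 0 N, f n =
      ∑ n ∈ Finset.Ioc 0 N, oddIndicator n * f n + ∑ m ∈ Finset.Ioc 0 (N / 2), f (2 * m) := by
  induction N with
  | zero => simp
  | succ N ih =>
    rw [Finset.sum_Ioc_succ_top (Nat.zero_le _), Finset.sum_Ioc_succ_top (Nat.zero_le _), ih,
      oddIndicator_apply]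
    rcases Nat.even_or_odd (N + 1) with h | h
    · obtain ⟨k, hk⟩ := h
      rw [if_neg (Nat.not_odd_iff_even.2 ⟨k, hk⟩), show (N + 1) / 2 = N / 2 + 1 by omega,
        Finset.sum_Ioc_succ_top (Nat.zero_le _), show 2 * (N / 2 + 1) = N + 1 by omega]
      ring
    · have h' := h
      obtain ⟨k, hk⟩ := h'
      rw [if_pos h, show (N + 1) / 2 = N / 2 by omega]
      ring

theorem rieszDivisorSum_eq {x : ℝ} {N : ℕ} (hN : ⌊x⌋₊ ≤ N) :
    rieszDivisorSum x = ∑ b ∈ Finset.Ioc 0 N, rieszSum (x / b) := by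
  refine Finset.sum_subset (Finset.Ioc_subset_Ioc_right hN) fun b hb hb' => rieszSum_of_lt_one ?_
  simp only [Finset.mem_Ioc, not_and, not_le] at hb hb'
  have hb0 : (0 : ℝ) < b := by exact_mod_cast hb.1
  rw [div_lt_one hb0]
  exact Nat.lt_of_floor_lt (hb' hb.1)

theorem sum_oddIndicator_mul_rieszSum {x : ℝ} {N : ℕ} (hN : ⌊x⌋₊ ≤ N) :
    ∑ b ∈ Finset.Ioc 0 N, oddIndicator b * rieszSum (x / b) =
      rieszDivisorSum x - rieszDivisorSum (x / 2) := by
  have h2 : ⌊x / 2⌋₊ ≤ N / 2 := by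
    rw [Nat.floor_div_ofNat]; exact Nat.div_le_div_right hN
  rw [rieszDivisorSum_eq hN, rieszDivisorSum_eq h2,
    sum_Ioc_eq_odd_add_even (fun b => rieszSum (x / b)) N]
  have : ∀ m : ℕ, x / ((2 * m : ℕ) : ℝ) = x / 2 / m := fun m => by
    push_cast; rw [div_div]
  simp only [this]
  ring

theorem sum_sub_mul_singularSeries (y : ℝ) :
    ∑ h ∈ Finset.Ioc 0 ⌊y⌋₊, (y - h) * singularSeries h =
      2 * twinConst * ∑ m ∈ Finset.Ioc 0 ⌊y / 2⌋₊, (y - 2 * m) * oddPrimeFactor m := by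
  rw [sum_Ioc_eq_odd_add_even, Finset.sum_eq_zero, zero_add, Nat.floor_div_ofNat, Finset.mul_sum]
  · refine Finset.sum_congr rfl fun m hm => ?_
    rw [singularSeries_two_mul (by have := Finset.mem_Ioc.1 hm; omega)]
    push_cast
    ring
  · intro n _
    rw [oddIndicator_apply]
    split_ifs with h
    · rw [singularSeries_of_odd h]; ring
    · ring

theorem sum_truncated_eq_rieszSum (y : ℝ) {a : ℕ} (ha : a ≠ 0) :
    ∑ c ∈ Finset.Ioc 0 ⌊y / 2⌋₊, (c : ℝ) *
      (if a * c ≤ ⌊y / 2⌋₊ then (y - 2 * (a * c : ℕ)) / (a * c : ℕ) else 0) =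
      2 * rieszSum (y / 2 / a) := by
  have ha0 : (a : ℝ) ≠ 0 := by exact_mod_cast ha
  rw [rieszSum, Nat.floor_div_natCast, Finset.mul_sum]
  symm
  have hsub : Finset.Ioc 0 (⌊y / 2⌋₊ / a) ⊆ Finset.Ioc 0 ⌊y / 2⌋₊ :=
    Finset.Ioc_subset_Ioc_right (Nat.div_le_self _ _)
  rw [← Finset.sum_subset hsub]
  · refine Finset.sum_congr rfl fun c hc => ?_
    rw [Finset.mem_Ioc, Nat.le_div_iff_mul_le (Nat.pos_of_ne_zero ha), mul_comm c] at hc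
    have hc0 : (c : ℝ) ≠ 0 := by exact_mod_cast hc.1.ne'
    rw [if_pos hc.2]
    push_cast
    field_simp
  · intro c hc hc'
    rw [Finset.mem_Ioc] at hc
    rw [Finset.mem_Ioc, Nat.le_div_iff_mul_le (Nat.pos_of_ne_zero ha), mul_comm c] at hc'
    rw [if_neg fun h => hc' ⟨hc.1, h⟩, mul_zero]

theorem sum_sub_mul_oddPrimeFactor (y : ℝ) :
    ∑ m ∈ Finset.Ioc 0 ⌊y / 2⌋₊, (y - 2 * m) * oddPrimeFactor m =
      2 * ∑ a ∈ Finset.Ioc 0 ⌊y / 2⌋₊, sievedWeight a *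
        (rieszDivisorSum (y / a / 2) - rieszDivisorSum (y / a / 4)) := by
  set M := ⌊y / 2⌋₊ with hM
  let G : ℕ → ℝ := fun n => if n ≤ M then (y - 2 * n) / n else 0
  have hG : ∀ n, M < n → G n = 0 := fun n hn => if_neg (not_le.2 hn)
  have h1 : ∑ m ∈ Finset.Ioc 0 M, (y - 2 * m) * oddPrimeFactor m =
      ∑ m ∈ Finset.Ioc 0 M, G m * (sievedWeight * (oddIndicator * realId)) m := by
    refine Finset.sum_congr rfl fun m hm => ?_
    rw [Finset.mem_Ioc] at hm
    have hm0 : (m : ℝ) ≠ 0 := by exact_mod_cast hm.1.ne'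
    rw [← mul_assoc, sievedWeight_mul_oddIndicator, sqfreeWeight_mul_realId]
    simp only [G, if_pos hm.2]
    field_simp
  rw [h1, sum_mul_convolution _ _ G M hG, Finset.mul_sum]
  refine Finset.sum_congr rfl fun a ha => ?_
  rw [Finset.mem_Ioc] at ha
  have h2 : ∑ n ∈ Finset.Ioc 0 M, (oddIndicator * realId) n * G (a * n) =
      ∑ n ∈ Finset.Ioc 0 M, G (a * n) * (oddIndicator * realId) n :=
    Finset.sum_congr rfl fun _ _ => mul_comm _ _
  rw [h2, sum_mul_convolution _ _ (fun n => G (a * n)) M fun n hn =>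
    hG _ (hn.trans_le (Nat.le_mul_of_pos_left n ha.1))]
  have h3 : ∑ b ∈ Finset.Ioc 0 M, oddIndicator b *
      ∑ c ∈ Finset.Ioc 0 M, realId c * G (a * (b * c)) =
      2 * ∑ b ∈ Finset.Ioc 0 M, oddIndicator b * rieszSum (y / a / 2 / b) := by
    rw [Finset.mul_sum]
    refine Finset.sum_congr rfl fun b hb => ?_
    rw [Finset.mem_Ioc] at hb
    have h4 := sum_truncated_eq_rieszSum y (Nat.mul_pos ha.1 hb.1).ne'
    have h5 : y / 2 / (a * b : ℕ) = y / a / 2 / b := by push_cast; field_simp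
    rw [h5] at h4
    simp only [realId_apply, G, ← mul_assoc a b]
    rw [h4]
    ring
  have h6 : ⌊y / a / 2⌋₊ ≤ M := by
    rw [div_right_comm, Nat.floor_div_natCast]; exact Nat.div_le_self _ _
  rw [h3, sum_oddIndicator_mul_rieszSum h6, show y / a / 2 / 2 = y / a / 4 by ring]
  ring

theorem sum_sub_mul_singularSeries_eq_tsum (y : ℝ) :
    ∑ h ∈ Finset.Ioc 0 ⌊y⌋₊, (y - h) * singularSeries h =
      4 * twinConst * ∑' a : ℕ, sievedWeight a *
        (rieszDivisorSum (y / a / 2) - rieszDivisorSum (y / a / 4)) := by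
  have hz : ∀ x : ℝ, x < 1 → rieszDivisorSum x = 0 := fun x hx => by
    rw [rieszDivisorSum, Nat.floor_eq_zero.2 hx]; simp
  rw [sum_sub_mul_singularSeries, sum_sub_mul_oddPrimeFactor,
    tsum_eq_sum (s := Finset.Ioc 0 ⌊y / 2⌋₊)]
  · ring
  · intro a ha
    rcases Nat.eq_zero_or_pos a with rfl | ha0
    · simp
    · simp only [Finset.mem_Ioc, not_and, not_le] at ha
      have ha' : (0 : ℝ) < a := by exact_mod_cast ha0
      have h1 : y / 2 < a := Nat.lt_of_floor_lt (ha ha0)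
      rw [hz, hz, sub_zero, mul_zero]
      · rw [div_lt_iff₀ (by norm_num), div_lt_iff₀ ha']; linarith
      · rw [div_lt_iff₀ (by norm_num), div_lt_iff₀ ha']; linarith

theorem tsum_oddIndicator_div_sq :
    ∑' n : ℕ, oddIndicator n / (n : ℝ) ^ 2 = 3 / 4 * ∑' n : ℕ, 1 / (n : ℝ) ^ 2 := by
  have hi2 : Function.Injective fun k : ℕ => 2 * k := fun a b h => by dsimp only at h; omega
  have hi1 : Function.Injective fun k : ℕ => 2 * k + 1 := fun a b h => by dsimp only at h; omega
  have split : ∀ f : ℕ → ℝ, Summable f → ∑' k, f (2 * k) + ∑' k, f (2 * k + 1) = ∑' k, f k :=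
    fun f hf => tsum_even_add_odd (hf.comp_injective hi2) (hf.comp_injective hi1)
  have h1 := split _ (Real.summable_one_div_nat_pow.2 one_lt_two)
  have h2 := split _ summable_norm_oddIndicator_div_sq.of_norm
  have h3 : ∀ k : ℕ, (1 : ℝ) / ((2 * k : ℕ) : ℝ) ^ 2 = 1 / 4 * (1 / (k : ℝ) ^ 2) := fun k => by
    push_cast; ring
  have h4 : ∀ k : ℕ, oddIndicator (2 * k) / ((2 * k : ℕ) : ℝ) ^ 2 = 0 := fun k => by
    rw [oddIndicator_apply, if_neg (by simp), zero_div]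
  have h5 : ∀ k : ℕ, oddIndicator (2 * k + 1) = 1 := fun k => by
    rw [oddIndicator_apply, if_pos (odd_two_mul_add_one k)]
  simp only [h3, tsum_mul_left] at h1
  simp only [h4, h5, tsum_zero] at h2
  linarith

theorem hasSum_sievedWeight_mul_main {y : ℝ} (hy : 0 < y) :
    HasSum (fun a : ℕ => 4 * twinConst * (sievedWeight a *
      (rieszDivisorMain (y / a / 2) - rieszDivisorMain (y / a / 4))))
      (y ^ 2 / 2 - y * Real.log y / 2 + (1 + Bconst) / 2 * y) := by
  have hW := summable_norm_sievedWeight_div.of_norm.hasSum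
  have hW2 := summable_norm_sievedWeight_div_sq.of_norm.hasSum
  have hL := summable_norm_sievedWeight_mul_log.of_norm.hasSum
  rw [tsum_sievedWeight_mul_log_eq_zero] at hL
  have hc1 := twinConst_mul_tsum_sievedWeight_div
  have hc2 := twinConst_mul_tsum_div_sq
  rw [tsum_oddIndicator_div_sq] at hc2
  set Z := ∑' n : ℕ, 1 / (n : ℝ) ^ 2 with hZ
  have h := ((((hW2.mul_left (3 / 32 * Z * y ^ 2)).sub
    (hW.mul_left (y * Real.log y / 8))).add (hL.mul_left (y / 8))).add
    (hW.mul_left ((1 + Bconst) / 8 * y))).mul_left (4 * twinConst)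
  have hval : 4 * twinConst * (3 / 32 * Z * y ^ 2 * ∑' n : ℕ, sievedWeight n / (n : ℝ) ^ 2 -
      y * Real.log y / 8 * ∑' n : ℕ, sievedWeight n / (n : ℝ) + y / 8 * 0 +
      (1 + Bconst) / 8 * y * ∑' n : ℕ, sievedWeight n / (n : ℝ)) =
      y ^ 2 / 2 - y * Real.log y / 2 + (1 + Bconst) / 2 * y := by
    linear_combination (y ^ 2 / 2) * hc2 + (-y * Real.log y / 2 + (1 + Bconst) / 2 * y) * hc1
  rw [hval] at h
  refine h.congr_fun fun a => ?_
  rcases Nat.eq_zero_or_pos a with rfl | ha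
  · simp
  have ha' : (0 : ℝ) < a := by exact_mod_cast ha
  have hya : y / a ≠ 0 := by positivity
  rw [rieszDivisorMain, rieszDivisorMain, Real.log_div hya two_ne_zero,
    Real.log_div hya four_ne_zero, Real.log_div hy.ne' ha'.ne',
    show (4 : ℝ) = 2 ^ 2 by norm_num, Real.log_pow, ← hZ]
  push_cast
  field_simp
  ring

theorem abs_sum_sub_mul_singularSeries_le {σ : ℝ} (h1 : 1 / 2 < σ) (h2 : σ < 1) :
    ∃ C : ℝ, 0 ≤ C ∧ ∀ y : ℝ, 0 < y →
      |∑ h ∈ Finset.Ioc 0 ⌊y⌋₊, (y - h) * singularSeries h -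
        (y ^ 2 / 2 - y * Real.log y / 2 + (1 + Bconst) / 2 * y)| ≤ C * y ^ σ := by
  obtain ⟨C, hC, hR⟩ := abs_rieszDivisorSum_sub_le_rpow h1.le h2
  have hS := summable_abs_sievedWeight_mul_rpow h1
  refine ⟨4 * |twinConst| * (2 * C) * ∑' n : ℕ, |sievedWeight n| * (n : ℝ) ^ (-σ),
    mul_nonneg (by positivity) (tsum_nonneg fun n => by positivity), fun y hy => ?_⟩
  have hmain := hasSum_sievedWeight_mul_main hy
  have hbound : ∀ a : ℕ, ‖4 * twinConst * (sievedWeight a *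
      (rieszDivisorSum (y / a / 2) - rieszDivisorSum (y / a / 4))) -
      4 * twinConst * (sievedWeight a *
      (rieszDivisorMain (y / a / 2) - rieszDivisorMain (y / a / 4)))‖ ≤
      4 * |twinConst| * (2 * C) * y ^ σ * (|sievedWeight a| * (a : ℝ) ^ (-σ)) := fun a => by
    rcases Nat.eq_zero_or_pos a with rfl | ha
    · simp
    have ha' : (0 : ℝ) < a := by exact_mod_cast ha
    have hya : 0 < y / a := by positivity
    have e : ∀ d : ℝ, 1 ≤ d →
        |rieszDivisorSum (y / a / d) - rieszDivisorMain (y / a / d)| ≤ C * (y / a) ^ σ :=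
      fun d hd => (hR _ (by positivity)).trans (mul_le_mul_of_nonneg_left
        (Real.rpow_le_rpow (by positivity) (div_le_self hya.le hd) (by linarith)) hC)
    have e2 := e 2 (by norm_num)
    have e4 := e 4 (by norm_num)
    have e6 : |(rieszDivisorSum (y / a / 2) - rieszDivisorSum (y / a / 4)) -
        (rieszDivisorMain (y / a / 2) - rieszDivisorMain (y / a / 4))| ≤
        2 * C * (y / a) ^ σ := by
      rw [abs_le] at e2 e4 ⊢
      constructor <;> linarith
    rw [← mul_sub, ← mul_sub, norm_mul, norm_mul, norm_mul, Real.norm_eq_abs, Real.norm_eq_abs,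
      Real.norm_eq_abs, Real.norm_eq_abs, abs_of_pos (show (0 : ℝ) < 4 by norm_num)]
    calc 4 * |twinConst| * (|sievedWeight a| * _)
        ≤ 4 * |twinConst| * (|sievedWeight a| * (2 * C * (y / a) ^ σ)) := by gcongr
      _ = _ := by
        rw [Real.div_rpow hy.le ha'.le, Real.rpow_neg ha'.le]
        ring
  have hdiff := (hS.mul_left (4 * |twinConst| * (2 * C) * y ^ σ)).of_norm_bounded hbound
  have hsum : Summable fun a : ℕ => 4 * twinConst * (sievedWeight a *
      (rieszDivisorSum (y / a / 2) - rieszDivisorSum (y / a / 4))) := by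
    simpa using hdiff.add hmain.summable
  rw [sum_sub_mul_singularSeries_eq_tsum, ← tsum_mul_left, ← hmain.tsum_eq,
    ← hsum.tsum_sub hmain.summable]
  refine (tsum_of_norm_bounded (hS.mul_left _).hasSum hbound).trans_eq ?_
  rw [tsum_mul_left]
  ring

theorem intervalIntegrable_sum_singularSeries {a b : ℝ} (ha : 0 ≤ a) (hab : a ≤ b) :
    IntervalIntegrable (fun u : ℝ => ∑ h ∈ Finset.Icc 1 ⌊u⌋₊, singularSeries h) volume a b := by
  rw [intervalIntegrable_iff_integrableOn_Icc_of_le hab]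
  simpa using integrableOn_mul_sum_Icc (fun n => singularSeries n) (m := 1) ha
    (g := fun _ => (1 : ℝ)) (b := b) (by simp)

theorem integral_sum_singularSeries {y : ℝ} (hy : 1 ≤ y) :
    ∫ u in (1 : ℝ)..y, ∑ h ∈ Finset.Icc 1 ⌊u⌋₊, singularSeries h =
      ∑ h ∈ Finset.Ioc 0 ⌊y⌋₊, (y - h) * singularSeries h := by
  have hc : ∀ (n : ℕ) (g : ℕ → ℝ), ∑ k ∈ Finset.Icc 0 n, g k * (if k = 0 then 0 else
      singularSeries k) = ∑ k ∈ Finset.Ioc 0 n, g k * singularSeries k := fun n g => by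
    rw [← Finset.add_sum_Ioc_eq_sum_Icc (Nat.zero_le n), if_pos rfl, mul_zero, zero_add]
    exact Finset.sum_congr rfl fun k hk => by rw [if_neg (Finset.mem_Ioc.1 hk).1.ne']
  have hc1 : ∀ n : ℕ, ∑ k ∈ Finset.Icc 0 n, (if k = 0 then 0 else singularSeries k) =
      ∑ k ∈ Finset.Ioc 0 n, singularSeries k := fun n => by simpa using hc n fun _ => 1
  have h := sum_mul_eq_sub_integral_mul₀ (fun n => if n = 0 then 0 else singularSeries n)
    (f := fun t : ℝ => t) (by simp) y (fun t _ => differentiableAt_id) (by simp)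
  simp only [deriv_id'', one_mul, hc1] at h
  rw [hc _ fun k => (k : ℝ)] at h
  rw [intervalIntegral.integral_of_le hy]
  simp only [sub_mul, Finset.sum_sub_distrib, ← Finset.mul_sum]
  have : ∀ n : ℕ, Finset.Icc 1 n = Finset.Ioc 0 n := fun n => by ext; simp; omega
  simp only [this]
  linarith

theorem intervalIntegrable_epsErr {y : ℝ} (hy : 1 ≤ y) :
    IntervalIntegrable epsErr volume 1 y :=
  ((intervalIntegrable_sum_singularSeries zero_le_one hy).sub
    intervalIntegral.intervalIntegrable_id).add
    (intervalIntegral.intervalIntegrable_log'.div_const 2)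

theorem fErr_eq {y : ℝ} (hy : 1 ≤ y) :
    fErr y = ∑ h ∈ Finset.Ioc 0 ⌊y⌋₊, (y - h) * singularSeries h -
      (y ^ 2 / 2 - y * Real.log y / 2 + (1 + Bconst) / 2 * y) + (1 + Bconst / 2) := by
  have i1 := intervalIntegrable_sum_singularSeries zero_le_one hy
  have i2 : IntervalIntegrable (fun u : ℝ => u) volume 1 y :=
    intervalIntegral.intervalIntegrable_id
  have i3 : IntervalIntegrable (fun u : ℝ => Real.log u / 2) volume 1 y :=
    intervalIntegral.intervalIntegrable_log'.div_const 2
  simp only [fErr, epsErr]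
  rw [intervalIntegral.integral_sub ((i1.sub i2).add i3) intervalIntegrable_const,
    intervalIntegral.integral_add (i1.sub i2) i3, intervalIntegral.integral_sub i1 i2,
    integral_sum_singularSeries hy, integral_id, intervalIntegral.integral_div, integral_log,
    intervalIntegral.integral_const]
  simp
  ring

theorem abs_fErr_le {σ : ℝ} (h1 : 1 / 2 < σ) (h2 : σ < 1) :
    ∃ C : ℝ, 0 ≤ C ∧ ∀ y : ℝ, 1 ≤ y → |fErr y| ≤ C * y ^ σ := by
  obtain ⟨C, hC, h⟩ := abs_sum_sub_mul_singularSeries_le h1 h2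
  refine ⟨C + |1 + Bconst / 2|, by positivity, fun y hy => ?_⟩
  rw [fErr_eq hy, add_mul]
  refine (abs_add_le _ _).trans (add_le_add (h y (by linarith)) ?_)
  exact le_mul_of_one_le_right (abs_nonneg _) (Real.one_le_rpow hy (by linarith))

theorem measurable_epsErr : Measurable epsErr := by
  have : Measurable fun u : ℝ => ∑ h ∈ Finset.Icc 1 ⌊u⌋₊, singularSeries h :=
    (measurable_from_nat (f := fun n : ℕ => ∑ h ∈ Finset.Icc 1 n, singularSeries h)).comp
      Nat.measurable_floor
  exact (this.sub measurable_id).add (Real.measurable_log.div_const 2)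

theorem continuousWithinAt_epsErr {x : ℝ} (hx : 0 < x) :
    ContinuousWithinAt epsErr (Set.Ioi x) x := by
  have h1 : ContinuousWithinAt (fun u : ℝ => ∑ h ∈ Finset.Icc 1 ⌊u⌋₊, singularSeries h)
      (Set.Ioi x) x := by
    refine ContinuousWithinAt.congr_of_eventuallyEq continuousWithinAt_const ?_ rfl
    filter_upwards [Ioo_mem_nhdsGT (Nat.lt_floor_add_one x)] with u hu
    rw [(Nat.floor_eq_iff (hx.trans hu.1).le).2 ⟨(Nat.floor_le hx.le).trans hu.1.le, hu.2⟩]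
  exact (h1.sub continuousWithinAt_id).add
    ((Real.continuousAt_log hx.ne').continuousWithinAt.div_const 2)

theorem integral_epsErr_mul_self {y : ℝ} (hy : 1 ≤ y) :
    (∫ u in (1 : ℝ)..y, epsErr u * u) =
      Bconst / 4 * y ^ 2 + y * fErr y - (∫ u in (1 : ℝ)..y, fErr u) - Bconst / 4 := by
  have hint : ∀ z, 1 ≤ z → IntervalIntegrable (fun u => epsErr u - Bconst / 2) volume 1 z :=
    fun z hz => (intervalIntegrable_epsErr hz).sub intervalIntegrable_const
  have hparts := intervalIntegral.integral_mul_deriv_eq_deriv_mul_of_hasDeriv_right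
    (a := 1) (b := y) (u := fun x : ℝ => x) (u' := fun _ => (1 : ℝ)) (v := fErr)
    (v' := fun u => epsErr u - Bconst / 2) continuousOn_id
    (intervalIntegral.continuousOn_primitive_interval' (hint y hy) Set.left_mem_uIcc)
    (fun x _ => (hasDerivAt_id x).hasDerivWithinAt)
    (fun x hx => by
      rw [min_eq_left hy] at hx
      refine (intervalIntegral.integral_hasDerivWithinAt_right (s := Set.Ici x)
        (t := Set.Ioi x) (hint x hx.1.le)
        ((measurable_epsErr.sub_const _).stronglyMeasurable.stronglyMeasurableAtFilter)
        ((continuousWithinAt_epsErr (by linarith [hx.1])).sub continuousWithinAt_const)).mono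
          Set.Ioi_subset_Ici_self)
    intervalIntegrable_const (hint y hy)
  have h1 : fErr 1 = 0 := by simp [fErr]
  have h2 : ∀ u : ℝ, epsErr u * u = u * (epsErr u - Bconst / 2) + Bconst / 2 * u := fun u => by
    ring
  simp only [h2]
  have i1 : IntervalIntegrable (fun u : ℝ => u * (epsErr u - Bconst / 2)) volume 1 y :=
    (hint y hy).continuousOn_mul continuousOn_id
  have i2 : IntervalIntegrable (fun u : ℝ => Bconst / 2 * u) volume 1 y :=
    intervalIntegral.intervalIntegrable_id.const_mul _
  have i3 : ∫ u in (1 : ℝ)..y, Bconst / 2 * u = Bconst / 2 * ((y ^ 2 - 1 ^ 2) / 2) := by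
    rw [intervalIntegral.integral_const_mul, integral_id]
  rw [intervalIntegral.integral_add i1 i2, hparts, h1, i3]
  simp only [one_mul]
  ring

theorem abs_integral_epsErr_mul_self_sub_le {σ : ℝ} (h1 : 1 / 2 < σ) (h2 : σ < 1) :
    ∃ C : ℝ, 0 < C ∧ ∀ y : ℝ, 1 ≤ y →
      |(∫ u in (1 : ℝ)..y, epsErr u * u) - Bconst / 4 * y ^ 2| ≤ C * y ^ (1 + σ) := by
  obtain ⟨C, hC, h⟩ := abs_fErr_le h1 h2
  refine ⟨2 * C + |Bconst| / 4 + 1, by positivity, fun y hy => ?_⟩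
  have hy0 : 0 < y := by linarith
  have hpow : y ^ (1 + σ) = y * y ^ σ := by rw [Real.rpow_add hy0, Real.rpow_one]
  have hpow1 : 1 ≤ y ^ (1 + σ) := Real.one_le_rpow hy (by linarith)
  have e1 : |y * fErr y| ≤ C * y ^ (1 + σ) := by
    rw [abs_mul, abs_of_pos hy0, hpow]
    nlinarith [h y hy]
  have e2 : |∫ u in (1 : ℝ)..y, fErr u| ≤ C * y ^ (1 + σ) := by
    have h3 := intervalIntegral.norm_integral_le_of_norm_le_const (a := 1) (b := y) (f := fErr)
      (C := C * y ^ σ) fun u hu => by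
        rw [Set.uIoc_of_le hy] at hu
        refine (h u hu.1.le).trans ?_
        have := Real.rpow_le_rpow (by linarith [hu.1]) hu.2 (show 0 ≤ σ by linarith)
        gcongr
    rw [Real.norm_eq_abs, abs_of_nonneg (sub_nonneg.2 hy)] at h3
    refine h3.trans ?_
    rw [hpow]
    have : 0 ≤ C * y ^ σ := by positivity
    nlinarith
  have e3 : |Bconst / 4| ≤ |Bconst| / 4 * y ^ (1 + σ) := by
    rw [abs_div, abs_of_pos (show (0 : ℝ) < 4 by norm_num)]
    exact le_mul_of_one_le_right (by positivity) hpow1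
  rw [integral_epsErr_mul_self hy]
  rw [abs_le] at e1 e2 e3 ⊢
  constructor <;> linarith

end TwinPrimeSeries

/-- Formula (4): for `y ≥ 1`,
`∫_1^y ε(u) u du = (B/4) y² + y f(y) - ∫_1^y f(u) du - B/4`, and consequently
`∫_1^y ε(u) u du = (B/4) y² + O(y^{3/2+ε})` for every `ε > 0`. -/
theorem integral_epsErr_weighted :
    (∀ y : ℝ, 1 ≤ y →
      (∫ u in (1 : ℝ)..y, epsErr u * u) =
        Bconst / 4 * y ^ 2 + y * fErr y - (∫ u in (1 : ℝ)..y, fErr u) - Bconst / 4) ∧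
    ∀ ε : ℝ, 0 < ε → ∃ C : ℝ, 0 < C ∧ ∀ y : ℝ, 1 ≤ y →
      |(∫ u in (1 : ℝ)..y, epsErr u * u) - Bconst / 4 * y ^ 2| ≤
        C * y ^ ((3 : ℝ) / 2 + ε) := by
  refine ⟨fun y hy => TwinPrimeSeries.integral_epsErr_mul_self hy, fun ε hε => ?_⟩
  have hm : 0 < min ε (1 / 4) := lt_min hε (by norm_num)
  obtain ⟨C, hC, h⟩ := TwinPrimeSeries.abs_integral_epsErr_mul_self_sub_le
    (σ := 1 / 2 + min ε (1 / 4)) (by linarith) (by linarith [min_le_right ε (1 / 4)])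
  refine ⟨C, hC, fun y hy => (h y hy).trans (mul_le_mul_of_nonneg_left ?_ hC.le)⟩
  exact Real.rpow_le_rpow_of_exponent_le hy (by linarith [min_le_left ε (1 / 4)])
end

section
/- For every real y ≥ 1, ∫_y^∞ ε(u)/u³ du = B/(4y²) − f(y)/y³ + 3 ∫_y^∞ f(u)/u⁴ du, and consequently ∫_y^∞ ε(u)/u³ du = B/(4y²) + O(y^{−5/2+ε}) for every ε > 0 (all integrals converge). -/
open Real MeasureTheory

theorem finset_Icc_one_eq_Ioc_zero (n : ℕ) : Finset.Icc 1 n = Finset.Ioc 0 n := by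
  ext k
  simp only [Finset.mem_Icc, Finset.mem_Ioc]
  omega

/-- A convergent sequence whose steps are dominated by the steps of `b → 0` is within `b` of its
limit. -/
theorem abs_sub_le_of_abs_step_le {E b : ℕ → ℝ} {L : ℝ} {n : ℕ}
    (hE : Filter.Tendsto E Filter.atTop (nhds L)) (hb : Filter.Tendsto b Filter.atTop (nhds 0))
    (h : ∀ k, n ≤ k → |E (k + 1) - E k| ≤ b k - b (k + 1)) : |E n - L| ≤ b n := by
  have hle : ∀ k, |E n - E (k + n)| ≤ b n - b (k + n) := by
    intro k
    induction k with
    | zero => simp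
    | succ k ih =>
      have h1 := h (k + n) (by omega)
      rw [abs_le] at *
      rw [show k + 1 + n = k + n + 1 by ring]
      constructor <;> linarith
  have h1 := ((Filter.tendsto_add_atTop_iff_nat n).2 hE).const_sub (E n) |>.abs
  have h2 := ((Filter.tendsto_add_atTop_iff_nat n).2 hb).const_sub (b n)
  rw [sub_zero] at h2
  exact le_of_tendsto_of_tendsto' h1 h2 hle

theorem log_succ_sub_log_le (n : ℕ) (hn : 1 ≤ n) :
    Real.log ((n : ℝ) + 1) - Real.log n ≤ (1 / (n : ℝ) + 1 / ((n : ℝ) + 1)) / 2 := by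
  have hn' : (1 : ℝ) ≤ n := by exact_mod_cast hn
  rw [← Real.log_div (by positivity) (by positivity)]
  have h1 : 0 ≤ Real.log (((n : ℝ) + 1) / n) :=
    Real.log_nonneg (by rw [le_div_iff₀ (by positivity)]; linarith)
  have h2 := Real.self_le_sinh_iff.2 h1
  rw [Real.sinh_log (by positivity)] at h2
  refine h2.trans (le_of_eq ?_)
  field_simp
  ring

theorem le_log_succ_sub_log (n : ℕ) (hn : 1 ≤ n) :
    2 / (2 * (n : ℝ) + 1) ≤ Real.log ((n : ℝ) + 1) - Real.log n := by
  have hn' : (1 : ℝ) ≤ n := by exact_mod_cast hn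
  rw [← Real.log_div (by positivity) (by positivity)]
  have h := Real.le_log_one_add_of_nonneg (x := 1 / (n : ℝ)) (by positivity)
  rw [show ((n : ℝ) + 1) / n = 1 + 1 / n by field_simp]
  refine le_trans (le_of_eq ?_) h
  field_simp
  ring

/-- Second order asymptotics of the harmonic numbers. -/
theorem abs_harmonic_sub_le (n : ℕ) (hn : 1 ≤ n) :
    |(∑ k ∈ Finset.Ioc 0 n, 1 / (k : ℝ)) -
      (Real.log n + Real.eulerMascheroniConstant + 1 / (2 * n))| ≤ 1 / (n : ℝ) ^ 2 := by
  set E : ℕ → ℝ := fun n => (∑ k ∈ Finset.Ioc 0 n, 1 / (k : ℝ)) - Real.log n - 1 / (2 * n) with hE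
  have h0 := tendsto_one_div_atTop_nhds_zero_nat (𝕜 := ℝ)
  have hlim : Filter.Tendsto E Filter.atTop (nhds Real.eulerMascheroniConstant) := by
    have := Real.tendsto_harmonic_sub_log.sub (h0.const_mul (1 / 2))
    rw [mul_zero, sub_zero] at this
    refine this.congr fun n => ?_
    simp only [hE, harmonic_eq_sum_Icc, finset_Icc_one_eq_Ioc_zero]
    push_cast
    simp only [one_div]
    ring
  have hb := h0.pow 2
  simp only [ne_eq, OfNat.ofNat_ne_zero, not_false_eq_true, zero_pow] at hb
  have key := abs_sub_le_of_abs_step_le (n := n) hlim hb ?_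
  · simp only [hE, one_div_pow] at key
    refine le_trans (le_of_eq ?_) key
    congr 1
    ring
  intro k hk
  have h1 : E (k + 1) - E k =
      (1 / (k : ℝ) + 1 / ((k : ℝ) + 1)) / 2 - (Real.log ((k : ℝ) + 1) - Real.log k) := by
    simp only [hE]
    rw [Finset.sum_Ioc_succ_top (by omega)]
    have : (1 : ℝ) ≤ k := by exact_mod_cast hn.trans hk
    push_cast
    field_simp
    ring
  have h2 := log_succ_sub_log_le k (by omega)
  have h3 := le_log_succ_sub_log k (by omega)
  rw [h1, abs_of_nonneg (by linarith)]
  have hpos : (1 : ℝ) ≤ k := by exact_mod_cast hn.trans hk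
  push_cast
  generalize (k : ℝ) = t at *
  have h7 : (1 / t + 1 / (t + 1)) / 2 - 2 / (2 * t + 1) ≤ (1 / t) ^ 2 - (1 / (t + 1)) ^ 2 := by
    have e1 : (1 / t + 1 / (t + 1)) / 2 - 2 / (2 * t + 1) =
      1 / (2 * t * (t + 1) * (2 * t + 1)) := by field_simp; ring
    have e2 : (1 / t) ^ 2 - (1 / (t + 1)) ^ 2 = (2 * t + 1) / (t ^ 2 * (t + 1) ^ 2) := by
      field_simp; ring
    rw [e1, e2, div_le_div_iff₀ (by positivity) (by positivity)]
    have : 0 ≤ t * (t + 1) * (2 * (2 * t + 1) ^ 2 - t * (t + 1)) := by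
      have : 0 ≤ 2 * (2 * t + 1) ^ 2 - t * (t + 1) := by nlinarith
      positivity
    nlinarith
  linarith

/-- Partial sums of `∑ 1 / m ^ 2` to third order. -/
theorem abs_sum_inv_sq_sub_le (n : ℕ) (hn : 1 ≤ n) :
    |(∑ k ∈ Finset.Ioc 0 n, 1 / (k : ℝ) ^ 2) -
      ((∑' k : ℕ, 1 / (k : ℝ) ^ 2) - 1 / n + 1 / (2 * (n : ℝ) ^ 2))| ≤ 1 / (n : ℝ) ^ 3 := by
  set E : ℕ → ℝ := fun n => (∑ k ∈ Finset.Ioc 0 n, 1 / (k : ℝ) ^ 2) + 1 / n - 1 / (2 * (n : ℝ) ^ 2)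
    with hE
  have h0 := tendsto_one_div_atTop_nhds_zero_nat (𝕜 := ℝ)
  have hlim : Filter.Tendsto E Filter.atTop (nhds (∑' k : ℕ, 1 / (k : ℝ) ^ 2)) := by
    have h1 := (Real.summable_one_div_nat_pow.2 (one_lt_two)).hasSum.tendsto_sum_nat
    have h1' := (Filter.tendsto_add_atTop_iff_nat 1).2 h1
    have := (h1'.add h0).sub ((h0.pow 2).const_mul (1 / 2))
    simp only [ne_eq, OfNat.ofNat_ne_zero, not_false_eq_true, zero_pow, mul_zero, add_zero,
      sub_zero] at this
    refine this.congr fun n => ?_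
    simp only [hE]
    have : ∑ k ∈ Finset.range (n + 1), 1 / (k : ℝ) ^ 2 = ∑ k ∈ Finset.Ioc 0 n, 1 / (k : ℝ) ^ 2 := by
      rw [Finset.sum_range_succ', ← finset_Icc_one_eq_Ioc_zero, Finset.range_eq_Ico,
        Finset.sum_Ico_add' (fun k : ℕ => 1 / (k : ℝ) ^ 2) 0 n 1]
      simp
      rfl
    rw [this]
    ring
  have hb := h0.pow 3
  simp only [ne_eq, OfNat.ofNat_ne_zero, not_false_eq_true, zero_pow] at hb
  have key := abs_sub_le_of_abs_step_le (n := n) hlim hb ?_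
  · simp only [hE, one_div_pow] at key
    refine le_trans (le_of_eq ?_) key
    congr 1
    ring
  intro k hk
  have hpos : (1 : ℝ) ≤ k := by exact_mod_cast hn.trans hk
  have h1 : E (k + 1) - E k = 1 / (2 * (k : ℝ) ^ 2 * ((k : ℝ) + 1) ^ 2) := by
    simp only [hE]
    rw [Finset.sum_Ioc_succ_top (by omega)]
    push_cast
    field_simp
    ring
  rw [h1, abs_of_nonneg (by positivity)]
  push_cast
  generalize (k : ℝ) = t at *
  have e2 : (1 / t) ^ 3 - (1 / (t + 1)) ^ 3 =
      (3 * t ^ 2 + 3 * t + 1) / (t ^ 3 * (t + 1) ^ 3) := by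
    field_simp; ring
  rw [e2, div_le_div_iff₀ (by positivity) (by positivity)]
  have : 0 ≤ t ^ 2 * (t + 1) ^ 2 * (2 * (3 * t ^ 2 + 3 * t + 1) - t * (t + 1)) := by
    have : 0 ≤ 2 * (3 * t ^ 2 + 3 * t + 1) - t * (t + 1) := by nlinarith
    positivity
  nlinarith

/-- Stirling's formula with an explicit error term. -/
theorem abs_log_factorial_sub_le (n : ℕ) (hn : 1 ≤ n) :
    |Real.log (n.factorial : ℝ) -
      (n * Real.log n - n + Real.log n / 2 + Real.log (2 * Real.pi) / 2)| ≤ 1 / (n : ℝ) := by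
  have h0 := tendsto_one_div_atTop_nhds_zero_nat (𝕜 := ℝ)
  have hlim : Filter.Tendsto (fun n => Real.log (Stirling.stirlingSeq n)) Filter.atTop
      (nhds (Real.log (√Real.pi))) :=
    Stirling.tendsto_stirlingSeq_sqrt_pi.log (by positivity)
  have key := abs_sub_le_of_abs_step_le (n := n) hlim h0 ?_
  · rw [Stirling.log_stirlingSeq_formula] at key
    have hpos : (1 : ℝ) ≤ n := by exact_mod_cast hn
    rw [Real.log_sqrt (by positivity), Real.log_mul (by positivity) (by positivity),
      Real.log_div (by positivity) (by positivity), Real.log_exp] at key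
    rw [Real.log_mul (by positivity) (by positivity)]
    refine le_trans (le_of_eq ?_) key
    congr 1
    ring
  intro k hk
  have hpos : (1 : ℝ) ≤ k := by exact_mod_cast hn.trans hk
  have h1 := Stirling.log_stirlingSeq_sdiff_le k
  have h2 : Real.log (Stirling.stirlingSeq (k + 1)) ≤ Real.log (Stirling.stirlingSeq k) := by
    obtain ⟨j, rfl⟩ : ∃ j, k = j + 1 := ⟨k - 1, by omega⟩
    exact Stirling.log_stirlingSeq'_antitone (Nat.le_succ j)
  rw [abs_of_nonpos (by linarith)]
  have : 1 / (12 * (k : ℝ) * (k + 1)) ≤ 1 / (k : ℝ) - 1 / ((k + 1 : ℕ) : ℝ) := by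
    have e : 1 / (k : ℝ) - 1 / ((k + 1 : ℕ) : ℝ) = 1 / ((k : ℝ) * (k + 1)) := by
      push_cast
      field_simp
      ring
    rw [e]
    apply one_div_le_one_div_of_le (by positivity)
    nlinarith
  linarith

/-- The Riesz mean `∑_{n ≤ x} (x - n) F(n)`. -/
noncomputable def rieszSum (F : ℕ → ℝ) (x : ℝ) : ℝ :=
  ∑ n ∈ Finset.Ioc 0 ⌊x⌋₊, (x - n) * F n

theorem sum_Ioc_zero_natCast (n : ℕ) : ∑ k ∈ Finset.Ioc 0 n, (k : ℝ) = n * (n + 1) / 2 := by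
  induction n with
  | zero => simp
  | succ n ih => rw [Finset.sum_Ioc_succ_top (by omega), ih]; push_cast; ring

theorem rieszSum_mul (F G : ArithmeticFunction ℝ) (x : ℝ) :
    rieszSum (F * G : ArithmeticFunction ℝ) x =
      ∑ a ∈ Finset.Ioc 0 ⌊x⌋₊, F a * a * rieszSum G (x / a) := by
  let D : ArithmeticFunction ℝ → ArithmeticFunction ℝ := fun F => ⟨fun n => n * F n, by simp⟩
  have hD : ∀ (F : ArithmeticFunction ℝ) n, D F n = n * F n := fun F n => rfl
  have hmul : ∀ n : ℕ, (n : ℝ) * (F * G) n = (D F * D G) n := by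
    intro n
    rw [ArithmeticFunction.mul_apply, ArithmeticFunction.mul_apply, Finset.mul_sum]
    refine Finset.sum_congr rfl fun p hp => ?_
    rw [← (Nat.mem_divisorsAntidiagonal.1 hp).1, hD, hD]
    push_cast
    ring
  unfold rieszSum
  simp only [sub_mul, Finset.sum_sub_distrib, ← Finset.mul_sum, hmul]
  rw [ArithmeticFunction.sum_Ioc_mul_eq_sum_sum, ArithmeticFunction.sum_Ioc_mul_eq_sum_sum,
    Finset.mul_sum, ← Finset.sum_sub_distrib]
  refine Finset.sum_congr rfl fun a ha => ?_
  have ha' : (a : ℝ) ≠ 0 := by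
    have := (Finset.mem_Ioc.1 ha).1
    positivity
  rw [Nat.floor_div_natCast]
  simp only [hD]
  field_simp

/-- The function `n ↦ 1 / n`. -/
noncomputable def invFun : ArithmeticFunction ℝ := ⟨fun n => (n : ℝ)⁻¹, by simp⟩

theorem invFun_apply (n : ℕ) : invFun n = (n : ℝ)⁻¹ := rfl

theorem rieszSum_one_sub_abs_le {t : ℝ} (ht : 0 ≤ t) :
    |rieszSum (fun _ => 1) t - (t ^ 2 / 2 - t / 2)| ≤ 1 := by
  have h1 : rieszSum (fun _ => 1) t = ⌊t⌋₊ * t - ⌊t⌋₊ * (⌊t⌋₊ + 1) / 2 := by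
    unfold rieszSum
    simp only [mul_one, Finset.sum_sub_distrib, sum_Ioc_zero_natCast]
    simp
  have h2 := Nat.floor_le ht
  have h3 := Nat.lt_floor_add_one t
  rw [h1]
  generalize (⌊t⌋₊ : ℝ) = n at *
  rw [abs_le]
  constructor <;> nlinarith

theorem abs_sum_inv_sub_le {b : ℝ} (hb : 1 ≤ b) :
    |(∑ k ∈ Finset.Ioc 0 ⌊b⌋₊, (1 / (k : ℝ) - 1 / b)) -
      (Real.log b + Real.eulerMascheroniConstant - 1 + 1 / (2 * b))| ≤ 7 / b ^ 2 := by
  have hn : 1 ≤ ⌊b⌋₊ := (Nat.one_le_floor_iff b).2 hb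
  have h1 := abs_harmonic_sub_le _ hn
  have h2 := Nat.floor_le (zero_le_one.trans hb)
  have h3 := Nat.lt_floor_add_one b
  rw [Finset.sum_sub_distrib]
  simp only [Finset.sum_const, Nat.card_Ioc, tsub_zero, nsmul_eq_mul]
  generalize ∑ k ∈ Finset.Ioc 0 ⌊b⌋₊, 1 / (k : ℝ) = H at *
  have hn' : (1 : ℝ) ≤ ⌊b⌋₊ := by exact_mod_cast hn
  generalize (⌊b⌋₊ : ℝ) = n at *
  have hn0 : 0 < n := by linarith
  have hb0 : 0 < b := by linarith
  have h4 : Real.log b - Real.log n ≤ b / n - 1 := by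
    rw [← Real.log_div hb0.ne' hn0.ne']
    exact Real.log_le_sub_one_of_pos (by positivity)
  have h5 : 1 - n / b ≤ Real.log b - Real.log n := by
    rw [← Real.log_div hb0.ne' hn0.ne']
    have := Real.one_sub_inv_le_log_of_pos (x := b / n) (by positivity)
    rwa [inv_div] at this
  have h6 : b / n - 1 - (1 - n / b) ≤ 2 / b ^ 2 := by
    have : b / n - 1 - (1 - n / b) = (b - n) ^ 2 / (n * b) := by
      field_simp
    rw [this, div_le_div_iff₀ (by positivity) (by positivity)]
    have : (b - n) ^ 2 ≤ 1 := by nlinarith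
    have : b ≤ 2 * n := by linarith
    nlinarith [mul_le_mul_of_nonneg_right this hb0.le,
      mul_le_mul_of_nonneg_right ‹(b - n) ^ 2 ≤ 1› (sq_nonneg b)]
  have h7 : 1 / (2 * n) - 1 / (2 * b) ≤ 1 / b ^ 2 := by
    have : 1 / (2 * n) - 1 / (2 * b) = (b - n) / (2 * n * b) := by field_simp
    rw [this, div_le_div_iff₀ (by positivity) (by positivity)]
    nlinarith [mul_le_mul_of_nonneg_right (by linarith : b - n ≤ 1) (sq_nonneg b),
      mul_le_mul_of_nonneg_right (by linarith : b ≤ 2 * n) hb0.le]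
  have h8 : 1 / (2 * b) ≤ 1 / (2 * n) :=
    one_div_le_one_div_of_le (by positivity) (by linarith)
  have h9 : 1 / n ^ 2 ≤ 4 / b ^ 2 := by
    rw [div_le_div_iff₀ (by positivity) (by positivity)]
    nlinarith
  have h10 : 7 / b ^ 2 = 2 / b ^ 2 + 1 / b ^ 2 + 4 / b ^ 2 := by ring
  have h11 : n * (1 / b) = n / b := by ring
  have h12 : 0 ≤ 2 / b ^ 2 := by positivity
  have h13 : 0 ≤ 1 / b ^ 2 := by positivity
  rw [abs_le] at h1 ⊢
  rw [h11]
  constructor <;> linarith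

theorem sum_hyperbola (g : ℕ → ℕ → ℝ) {M N : ℕ} (h1 : M * M ≤ N) (h2 : N < (M + 1) * (M + 1)) :
    ∑ m ∈ Finset.Ioc 0 N, ∑ k ∈ Finset.Ioc 0 (N / m), g m k =
      (∑ m ∈ Finset.Ioc 0 M, ∑ k ∈ Finset.Ioc 0 (N / m), g m k) +
      (∑ k ∈ Finset.Ioc 0 M, ∑ m ∈ Finset.Ioc 0 (N / k), g m k) -
      ∑ m ∈ Finset.Ioc 0 M, ∑ k ∈ Finset.Ioc 0 M, g m k := by
  have hMN : M ≤ N := by nlinarith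
  have inner : ∀ (f : ℕ → ℝ) m, 0 < m → ∑ k ∈ Finset.Ioc 0 (N / m), f k =
      ∑ k ∈ Finset.Ioc 0 N, if m * k ≤ N then f k else 0 := by
    intro f m hm
    rw [← Finset.sum_filter]
    refine Finset.sum_congr ?_ fun _ _ => rfl
    ext k
    simp only [Finset.mem_Ioc, Finset.mem_filter, Nat.le_div_iff_mul_le hm]
    constructor
    · rintro ⟨h, h'⟩
      exact ⟨⟨h, by nlinarith⟩, by linarith⟩
    · rintro ⟨⟨h, _⟩, h'⟩
      exact ⟨h, by linarith⟩
  have outer : ∀ f : ℕ → ℝ, ∑ m ∈ Finset.Ioc 0 M, f m =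
      ∑ m ∈ Finset.Ioc 0 N, if m ≤ M then f m else 0 := by
    intro f
    rw [← Finset.sum_filter]
    refine Finset.sum_congr ?_ fun _ _ => rfl
    ext k
    simp only [Finset.mem_Ioc, Finset.mem_filter]
    omega
  have e1 : ∑ m ∈ Finset.Ioc 0 N, ∑ k ∈ Finset.Ioc 0 (N / m), g m k =
      ∑ m ∈ Finset.Ioc 0 N, ∑ k ∈ Finset.Ioc 0 N, if m * k ≤ N then g m k else 0 :=
    Finset.sum_congr rfl fun m hm => inner _ _ (Finset.mem_Ioc.1 hm).1
  have e2 : ∑ m ∈ Finset.Ioc 0 M, ∑ k ∈ Finset.Ioc 0 (N / m), g m k =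
      ∑ m ∈ Finset.Ioc 0 N, ∑ k ∈ Finset.Ioc 0 N,
        if m ≤ M then (if m * k ≤ N then g m k else 0) else 0 := by
    rw [outer]
    refine Finset.sum_congr rfl fun m hm => ?_
    split_ifs with h
    · rw [inner _ _ (Finset.mem_Ioc.1 hm).1]
    · simp
  have e3 : ∑ k ∈ Finset.Ioc 0 M, ∑ m ∈ Finset.Ioc 0 (N / k), g m k =
      ∑ m ∈ Finset.Ioc 0 N, ∑ k ∈ Finset.Ioc 0 N,
        if k ≤ M then (if k * m ≤ N then g m k else 0) else 0 := by
    rw [outer, Finset.sum_comm (s := Finset.Ioc 0 N) (t := Finset.Ioc 0 N)]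
    refine Finset.sum_congr rfl fun m hm => ?_
    split_ifs with h
    · rw [inner _ _ (Finset.mem_Ioc.1 hm).1]
    · simp
  have e4 : ∑ m ∈ Finset.Ioc 0 M, ∑ k ∈ Finset.Ioc 0 M, g m k =
      ∑ m ∈ Finset.Ioc 0 N, ∑ k ∈ Finset.Ioc 0 N,
        if m ≤ M then (if k ≤ M then g m k else 0) else 0 := by
    rw [outer]
    refine Finset.sum_congr rfl fun m hm => ?_
    split_ifs with h
    · rw [outer]
    · simp
  rw [e1, e2, e3, e4, ← Finset.sum_add_distrib, ← Finset.sum_sub_distrib]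
  refine Finset.sum_congr rfl fun m hm => ?_
  rw [← Finset.sum_add_distrib, ← Finset.sum_sub_distrib]
  refine Finset.sum_congr rfl fun k hk => ?_
  rw [mul_comm k m]
  by_cases hm' : m ≤ M <;> by_cases hk' : k ≤ M
  · have : m * k ≤ N := (Nat.mul_le_mul hm' hk').trans h1
    simp [hm', hk', this]
  · simp [hm', hk']
  · simp [hm', hk']
  · have : ¬ m * k ≤ N := by
      have := Nat.mul_le_mul (Nat.succ_le_of_lt (not_le.1 hm')) (Nat.succ_le_of_lt (not_le.1 hk'))
      have h3 : N < m * k := lt_of_lt_of_le h2 this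
      omega
    simp [hm', hk', this]

/-- The main term of `∑_{n ≤ x} (x - n) σ(n) / n`. -/
noncomputable def rieszMain (x : ℝ) : ℝ :=
  (∑' k : ℕ, 1 / (k : ℝ) ^ 2) / 2 * x ^ 2 - x / 2 * Real.log x +
    (1 - Real.eulerMascheroniConstant - Real.log (2 * Real.pi)) / 2 * x

set_option maxHeartbeats 1000000 in
theorem hyperbola_assembly {x M Z g lp lx lM H Q F P₁ P₂ : ℝ} (hM : 1 ≤ M) (h1 : M ^ 2 ≤ x)
    (h2 : x < (M + 1) ^ 2) (hℓ : lx - 2 * lM ≤ x / M ^ 2 - 1) (hℓ' : 1 - M ^ 2 / x ≤ lx - 2 * lM)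
    (hH : |H - (lM + g + 1 / (2 * M))| ≤ 1 / M ^ 2)
    (hQ : |Q - (Z - 1 / M + 1 / (2 * M ^ 2))| ≤ 1 / M ^ 3)
    (hF : |F - (M * lM - M + lM / 2 + lp / 2)| ≤ 1 / M)
    (hP₁ : |P₁ - (x ^ 2 / 2 * Q - x / 2 * H)| ≤ M)
    (hP₂ : |P₂ - (x * (M * lx - F + M * (g - 1)) + M * (M + 1) / 4)| ≤ 7 * M) :
    |P₁ + P₂ - (x * M * H - M * (M * (M + 1) / 2)) -
      (Z / 2 * x ^ 2 - x / 2 * lx + (1 - g - lp) / 2 * x)| ≤ 100 * M := by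
  obtain ⟨ℓ, rfl⟩ : ∃ ℓ, lx = 2 * lM + ℓ := ⟨lx - 2 * lM, by ring⟩
  obtain ⟨r, rfl⟩ : ∃ r, x = M ^ 2 + r := ⟨x - M ^ 2, by ring⟩
  obtain ⟨e₁, rfl⟩ : ∃ e, H = lM + g + 1 / (2 * M) + e := ⟨H - (lM + g + 1 / (2 * M)), by ring⟩
  obtain ⟨e₂, rfl⟩ : ∃ e, Q = Z - 1 / M + 1 / (2 * M ^ 2) + e :=
    ⟨Q - (Z - 1 / M + 1 / (2 * M ^ 2)), by ring⟩
  obtain ⟨e₃, rfl⟩ : ∃ e, F = M * lM - M + lM / 2 + lp / 2 + e :=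
    ⟨F - (M * lM - M + lM / 2 + lp / 2), by ring⟩
  obtain ⟨d₁, rfl⟩ := show ∃ e, P₁ = _ + e from
    ⟨P₁ - ((M ^ 2 + r) ^ 2 / 2 * (Z - 1 / M + 1 / (2 * M ^ 2) + e₂) -
      (M ^ 2 + r) / 2 * (lM + g + 1 / (2 * M) + e₁)), (add_sub_cancel _ _).symm⟩
  obtain ⟨d₂, rfl⟩ := show ∃ e, P₂ = _ + e from ⟨P₂ - _, (add_sub_cancel
    ((M ^ 2 + r) * (M * (2 * lM + ℓ) - (M * lM - M + lM / 2 + lp / 2 + e₃) + M * (g - 1)) +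
      M * (M + 1) / 4) _).symm⟩
  simp only [add_sub_cancel_left] at hH hQ hF hP₁ hP₂
  have hM0 : 0 < M := by linarith
  have hr0 : 0 ≤ r := by linarith
  have hr1 : r ≤ 3 * M := by nlinarith
  have hx : M ^ 2 + r ≤ 4 * M ^ 2 := by nlinarith
  have hxpos : 0 < M ^ 2 + r := by positivity
  have key : (M ^ 2 + r) ^ 2 / 2 * (Z - 1 / M + 1 / (2 * M ^ 2) + e₂) -
      (M ^ 2 + r) / 2 * (lM + g + 1 / (2 * M) + e₁) + d₁ +
      ((M ^ 2 + r) * (M * (2 * lM + ℓ) - (M * lM - M + lM / 2 + lp / 2 + e₃) + M * (g - 1)) +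
      M * (M + 1) / 4 + d₂) -
      ((M ^ 2 + r) * M * (lM + g + 1 / (2 * M) + e₁) - M * (M * (M + 1) / 2)) -
      (Z / 2 * (M ^ 2 + r) ^ 2 - (M ^ 2 + r) / 2 * (2 * lM + ℓ) + (1 - g - lp) / 2 * (M ^ 2 + r)) =
      ((M ^ 2 + r) ^ 2 / 2 * e₂ - (M ^ 2 + r) / 2 * e₁ - (M ^ 2 + r) * e₃ - (M ^ 2 + r) * M * e₁) +
      (d₁ + d₂) + ((M ^ 2 + r) * M * ℓ - M * r) + (M ^ 2 + r) / 2 * ℓ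
      - r ^ 2 / (2 * M) - r / 2 + r ^ 2 / (4 * M ^ 2) - r / (4 * M) := by
    field_simp
    ring
  rw [key]
  have b1 : |(M ^ 2 + r) ^ 2 / 2 * e₂| ≤ 8 * M := by
    rw [abs_mul, abs_of_nonneg (by positivity)]
    calc (M ^ 2 + r) ^ 2 / 2 * |e₂| ≤ (4 * M ^ 2) ^ 2 / 2 * (1 / M ^ 3) := by gcongr
      _ = 8 * M := by field_simp; ring
  have b2 : |(M ^ 2 + r) / 2 * e₁| ≤ 2 * M := by
    rw [abs_mul, abs_of_nonneg (by positivity)]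
    calc (M ^ 2 + r) / 2 * |e₁| ≤ (4 * M ^ 2) / 2 * (1 / M ^ 2) := by gcongr
      _ = 2 := by field_simp; ring
      _ ≤ 2 * M := by linarith
  have b3 : |(M ^ 2 + r) * e₃| ≤ 4 * M := by
    rw [abs_mul, abs_of_nonneg (by positivity)]
    calc (M ^ 2 + r) * |e₃| ≤ (4 * M ^ 2) * (1 / M) := by gcongr
      _ = 4 * M := by field_simp
  have b4 : |(M ^ 2 + r) * M * e₁| ≤ 4 * M := by
    rw [abs_mul, abs_of_nonneg (by positivity)]
    calc (M ^ 2 + r) * M * |e₁| ≤ (4 * M ^ 2) * M * (1 / M ^ 2) := by gcongr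
      _ = 4 * M := by field_simp
  have hℓ1 : ℓ ≤ r / M ^ 2 := by
    have : (M ^ 2 + r) / M ^ 2 - 1 = r / M ^ 2 := by field_simp; ring
    linarith
  have hℓ2 : r / (M ^ 2 + r) ≤ ℓ := by
    have : 1 - M ^ 2 / (M ^ 2 + r) = r / (M ^ 2 + r) := by field_simp; ring
    linarith
  have hℓ0 : 0 ≤ ℓ := le_trans (by positivity) hℓ2
  have b5 : (M ^ 2 + r) * M * ℓ - M * r ≤ 9 * M := by
    calc (M ^ 2 + r) * M * ℓ - M * r ≤ (M ^ 2 + r) * M * (r / M ^ 2) - M * r := by gcongr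
      _ = r ^ 2 / M := by field_simp; ring
      _ ≤ (3 * M) ^ 2 / M := by gcongr
      _ = 9 * M := by field_simp; ring
  have b5' : 0 ≤ (M ^ 2 + r) * M * ℓ - M * r := by
    rw [div_le_iff₀ hxpos] at hℓ2
    nlinarith
  have b6 : (M ^ 2 + r) / 2 * ℓ ≤ 6 * M := by
    calc (M ^ 2 + r) / 2 * ℓ ≤ 4 * M ^ 2 / 2 * (3 * M / M ^ 2) := by
          gcongr
          exact hℓ1.trans (by gcongr)
      _ = 6 * M := by field_simp; ring
  have b6' : 0 ≤ (M ^ 2 + r) / 2 * ℓ := by positivity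
  have b7 : r ^ 2 / (2 * M) ≤ 5 * M := by
    rw [div_le_iff₀ (by positivity)]; nlinarith
  have b8 : r ^ 2 / (4 * M ^ 2) ≤ 3 * M := by
    rw [div_le_iff₀ (by positivity)]
    have h1 : r ^ 2 ≤ (3 * M) ^ 2 := pow_le_pow_left₀ hr0 hr1 2
    have h2 : M ^ 2 * 1 ≤ M ^ 2 * M := by gcongr
    linarith
  have b9 : r / (4 * M) ≤ M := by
    rw [div_le_iff₀ (by positivity)]
    have : M * 1 ≤ M * M := by gcongr
    linarith
  have b7' : 0 ≤ r ^ 2 / (2 * M) := by positivity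
  have b8' : 0 ≤ r ^ 2 / (4 * M ^ 2) := by positivity
  have b9' : 0 ≤ r / (4 * M) := by positivity
  rw [abs_le] at b1 b2 b3 b4 hP₁ hP₂ ⊢
  obtain ⟨b1, b1'⟩ := b1
  obtain ⟨b2, b2'⟩ := b2
  obtain ⟨b3, b3'⟩ := b3
  obtain ⟨b4, b4'⟩ := b4
  obtain ⟨hP₁, hP₁'⟩ := hP₁
  obtain ⟨hP₂, hP₂'⟩ := hP₂
  clear key hH hQ hF h1 h2 hℓ hℓ' hℓ1 hℓ2 hx hxpos
  constructor <;> linarith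

theorem abs_rieszSum_sub_main_le {x : ℝ} (hx : 1 ≤ x) :
    |rieszSum (invFun * ArithmeticFunction.zeta : ArithmeticFunction ℝ) x - rieszMain x| ≤
      100 * √x := by
  have hx0 : 0 < x := by linarith
  set N := ⌊x⌋₊ with hN
  set M := Nat.sqrt N with hMdef
  have hN1 : 1 ≤ N := (Nat.one_le_floor_iff x).2 hx
  have hM1 : 1 ≤ M := Nat.le_sqrt.2 (by simpa using hN1)
  have hMM : M * M ≤ N := Nat.sqrt_le N
  have hMM' : N < (M + 1) * (M + 1) := Nat.lt_succ_sqrt N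
  have hNx : (N : ℝ) ≤ x := Nat.floor_le hx0.le
  have hMx : (M : ℝ) ^ 2 ≤ x := by
    refine le_trans ?_ hNx
    rw [sq]
    exact_mod_cast hMM
  have hMx' : x < ((M : ℝ) + 1) ^ 2 := by
    refine (Nat.lt_floor_add_one x).trans_le ?_
    rw [sq]
    exact_mod_cast hMM'
  have hM1' : (1 : ℝ) ≤ M := by exact_mod_cast hM1
  have hM0 : (0 : ℝ) < M := by linarith
  have hfl : ∀ m : ℕ, N / m = ⌊x / m⌋₊ := fun m => (Nat.floor_div_natCast x m).symm
  have hS : rieszSum (invFun * ArithmeticFunction.zeta : ArithmeticFunction ℝ) x =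
      ∑ m ∈ Finset.Ioc 0 N, ∑ k ∈ Finset.Ioc 0 (N / m), (x / m - k) := by
    rw [rieszSum_mul]
    refine Finset.sum_congr rfl fun m hm => ?_
    have : (m : ℝ) ≠ 0 := by
      have := (Finset.mem_Ioc.1 hm).1
      positivity
    rw [invFun_apply, inv_mul_cancel₀ this, one_mul, rieszSum, hfl]
    refine Finset.sum_congr rfl fun k hk => ?_
    have := (Finset.mem_Ioc.1 hk).1
    simp [ArithmeticFunction.zeta_apply, this.ne']
  rw [hS, sum_hyperbola _ hMM hMM']
  have hP₃ : ∑ m ∈ Finset.Ioc 0 M, ∑ k ∈ Finset.Ioc 0 M, (x / (m : ℝ) - (k : ℝ)) =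
      x * M * (∑ m ∈ Finset.Ioc 0 M, 1 / (m : ℝ)) - M * (M * (M + 1) / 2) := by
    simp only [Finset.sum_sub_distrib, sum_Ioc_zero_natCast, Finset.sum_const, Nat.card_Ioc,
      tsub_zero, nsmul_eq_mul, ← Finset.mul_sum]
    congr 1
    rw [Finset.mul_sum, Finset.mul_sum]
    exact Finset.sum_congr rfl fun _ _ => by ring
  rw [hP₃]
  have hP₁ : |(∑ m ∈ Finset.Ioc 0 M, ∑ k ∈ Finset.Ioc 0 (N / m), (x / (m : ℝ) - (k : ℝ))) -
      (x ^ 2 / 2 * (∑ m ∈ Finset.Ioc 0 M, 1 / (m : ℝ) ^ 2) -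
        x / 2 * (∑ m ∈ Finset.Ioc 0 M, 1 / (m : ℝ)))| ≤ (M : ℝ) := by
    rw [Finset.mul_sum, Finset.mul_sum, ← Finset.sum_sub_distrib, ← Finset.sum_sub_distrib]
    refine (Finset.abs_sum_le_sum_abs _ _).trans ?_
    refine (Finset.sum_le_sum (g := fun _ => (1 : ℝ)) fun m hm => ?_).trans (by simp)
    have := rieszSum_one_sub_abs_le (t := x / m) (by positivity)
    simp only [rieszSum, mul_one] at this
    rw [hfl]
    refine le_trans (le_of_eq ?_) this
    congr 1
    ring
  have hP₂ : |(∑ k ∈ Finset.Ioc 0 M, ∑ m ∈ Finset.Ioc 0 (N / k), (x / (m : ℝ) - (k : ℝ))) -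
      (x * (M * Real.log x - Real.log (M.factorial : ℝ) +
        M * (Real.eulerMascheroniConstant - 1)) + M * (M + 1) / 4)| ≤ 7 * M := by
    have hlf : Real.log (M.factorial : ℝ) = ∑ k ∈ Finset.Ioc 0 M, Real.log k := by
      clear * -
      induction M with
      | zero => simp
      | succ n ih =>
        rw [Finset.sum_Ioc_succ_top (by omega), ← ih, Nat.factorial_succ, Nat.cast_mul,
          Real.log_mul (by positivity) (by positivity), add_comm]
    have hmain : x * (M * Real.log x - Real.log (M.factorial : ℝ) +
        M * (Real.eulerMascheroniConstant - 1)) + M * (M + 1) / 4 =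
        ∑ k ∈ Finset.Ioc 0 M, (x * (Real.log x - Real.log k + Real.eulerMascheroniConstant - 1) +
          k / 2) := by
      rw [hlf]
      simp only [Finset.sum_add_distrib, ← Finset.mul_sum, Finset.sum_sub_distrib, ← Finset.sum_div,
        sum_Ioc_zero_natCast, Finset.sum_const, Nat.card_Ioc, tsub_zero, nsmul_eq_mul]
      ring
    rw [hmain, ← Finset.sum_sub_distrib]
    refine (Finset.abs_sum_le_sum_abs _ _).trans ?_
    refine (Finset.sum_le_sum (g := fun _ => (7 : ℝ)) fun k hk => ?_).trans
      (by simp [mul_comm])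
    have hk0 := (Finset.mem_Ioc.1 hk).1
    have hkM := (Finset.mem_Ioc.1 hk).2
    have hk1 : (0 : ℝ) < k := by positivity
    have hkM' : (k : ℝ) ≤ M := by exact_mod_cast hkM
    have hkx : (k : ℝ) ^ 2 ≤ x := le_trans (by gcongr) hMx
    have hb : 1 ≤ x / k := by
      rw [le_div_iff₀ hk1]
      have : (1 : ℝ) ≤ k := by exact_mod_cast hk0
      nlinarith
    have := abs_sum_inv_sub_le hb
    rw [Real.log_div hx0.ne' hk1.ne'] at this
    have h7 : x * (7 / (x / k) ^ 2) ≤ 7 := by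
      have : x * (7 / (x / k) ^ 2) = 7 * k ^ 2 / x := by field_simp
      rw [this, div_le_iff₀ hx0]
      linarith
    refine le_trans ?_ h7
    refine le_trans (le_of_eq ?_) (mul_le_mul_of_nonneg_left this hx0.le)
    rw [← abs_of_pos hx0, ← abs_mul, abs_of_pos hx0, mul_sub x (Finset.sum _ _), Finset.mul_sum, hfl]
    congr 2
    · refine Finset.sum_congr rfl fun m hm => ?_
      field_simp
    · field_simp
  have hl1 := Real.log_le_sub_one_of_pos (x := x / (M : ℝ) ^ 2) (by positivity)
  have hl2 := Real.one_sub_inv_le_log_of_pos (x := x / (M : ℝ) ^ 2) (by positivity)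
  rw [Real.log_div hx0.ne' (by positivity), Real.log_pow] at hl1 hl2
  rw [inv_div] at hl2
  have := hyperbola_assembly hM1' hMx hMx' hl1 hl2 (abs_harmonic_sub_le M hM1)
    (abs_sum_inv_sq_sub_le M hM1) (abs_log_factorial_sub_le M hM1) hP₁ hP₂
  refine this.trans ?_
  gcongr
  exact Real.le_sqrt_of_sq_le hMx

theorem exists_abs_rieszSum_sub_main_le {a : ℝ} (ha : 1 / 2 ≤ a) (ha1 : a < 1) :
    ∃ K : ℝ, 0 < K ∧ ∀ x : ℝ, 0 < x →
      |rieszSum (invFun * ArithmeticFunction.zeta : ArithmeticFunction ℝ) x - rieszMain x| ≤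
        K * x ^ a := by
  set c := (1 - Real.eulerMascheroniConstant - Real.log (2 * Real.pi)) / 2 with hc
  set Z := ∑' k : ℕ, 1 / (k : ℝ) ^ 2 with hZ
  have hZ0 : 0 ≤ Z := tsum_nonneg fun k => by positivity
  have h1a : 0 < 1 - a := by linarith
  refine ⟨100 + Z + 1 / (1 - a) + |c|, by positivity, fun x hx => ?_⟩
  rcases le_or_gt 1 x with h | h
  · refine (abs_rieszSum_sub_main_le h).trans ?_
    rw [Real.sqrt_eq_rpow]
    have : x ^ (1 / 2 : ℝ) ≤ x ^ a := Real.rpow_le_rpow_of_exponent_le h ha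
    have h0 : 0 ≤ x ^ a := by positivity
    have : 0 ≤ (Z + 1 / (1 - a) + |c|) * x ^ a := by positivity
    nlinarith
  · have h0 : ⌊x⌋₊ = 0 := Nat.floor_eq_zero.2 h
    have hS : rieszSum (invFun * ArithmeticFunction.zeta : ArithmeticFunction ℝ) x = 0 := by
      simp [rieszSum, h0]
    have hxa : x ≤ x ^ a := by
      have := Real.rpow_le_rpow_of_exponent_ge hx h.le ha1.le
      rwa [Real.rpow_one] at this
    have hlog : |x * Real.log x| ≤ 1 / (1 - a) * x ^ a := by
      have := Real.abs_log_mul_self_rpow_lt x (1 - a) hx h.le h1a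
      have e : x * Real.log x = x ^ a * (Real.log x * x ^ (1 - a)) := by
        rw [mul_left_comm, ← Real.rpow_add hx]
        simp [mul_comm]
      rw [e, abs_mul, abs_of_pos (Real.rpow_pos_of_pos hx a), mul_comm]
      gcongr
    rw [hS, rieszMain, zero_sub, abs_neg]
    have t1 : |Z / 2 * x ^ 2| ≤ Z * x ^ a := by
      rw [abs_of_nonneg (by positivity)]
      have : x ^ 2 ≤ x ^ a := by nlinarith
      nlinarith [mul_le_mul_of_nonneg_left this hZ0, Real.rpow_pos_of_pos hx a,
        mul_nonneg hZ0 (Real.rpow_pos_of_pos hx a).le]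
    have t2 : |x / 2 * Real.log x| ≤ 1 / (1 - a) * x ^ a := by
      rw [show x / 2 * Real.log x = (x * Real.log x) / 2 by ring, abs_div, abs_two]
      have := abs_nonneg (x * Real.log x)
      linarith
    have t3 : |c * x| ≤ |c| * x ^ a := by
      rw [abs_mul, abs_of_pos hx]
      gcongr
    have := Real.rpow_pos_of_pos hx a
    rw [← hZ, ← hc]
    calc |Z / 2 * x ^ 2 - x / 2 * Real.log x + c * x|
        ≤ |Z / 2 * x ^ 2| + |x / 2 * Real.log x| + |c * x| :=
          (abs_add_le _ _).trans (add_le_add_left (abs_sub _ _) _)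
      _ ≤ _ := by nlinarith

/-- The excess `1 / (p - 2)` of the local factor of the singular series at an odd prime. -/
noncomputable def localExcess (p : ℕ) : ℝ := if 2 < p then 1 / ((p : ℝ) - 2) else 0

/-- The multiplicative part of the singular series. -/
noncomputable def oddFactor : ArithmeticFunction ℝ :=
  ArithmeticFunction.prodPrimeFactors (fun p => 1 + localExcess p)

/-- The function `n ↦ μ(n) / n`. -/
noncomputable def moebiusDiv : ArithmeticFunction ℝ :=
  ArithmeticFunction.pmul (ArithmeticFunction.moebius : ArithmeticFunction ℝ) invFun

/-- The convolution quotient of `oddFactor` by `n ↦ ∑ d ∣ n, 1 / d`. -/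
noncomputable def weight : ArithmeticFunction ℝ :=
  oddFactor * (ArithmeticFunction.moebius : ArithmeticFunction ℝ) * moebiusDiv

theorem isMultiplicative_invFun : invFun.IsMultiplicative := by
  refine ⟨by simp [invFun_apply], fun {m n} _ => ?_⟩
  simp [invFun_apply, mul_comm]

theorem isMultiplicative_moebius_real :
    (ArithmeticFunction.moebius : ArithmeticFunction ℝ).IsMultiplicative :=
  ArithmeticFunction.isMultiplicative_moebius.intCast

theorem isMultiplicative_moebiusDiv : moebiusDiv.IsMultiplicative :=
  isMultiplicative_moebius_real.pmul isMultiplicative_invFun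

theorem isMultiplicative_oddFactor : oddFactor.IsMultiplicative :=
  ArithmeticFunction.IsMultiplicative.prodPrimeFactors _

theorem isMultiplicative_weight : weight.IsMultiplicative :=
  (isMultiplicative_oddFactor.mul isMultiplicative_moebius_real).mul isMultiplicative_moebiusDiv

theorem moebiusDiv_mul_invFun : moebiusDiv * invFun = 1 := by
  ext n
  rcases Nat.eq_zero_or_pos n with rfl | hn
  · simp
  have h := congrArg (fun F : ArithmeticFunction ℝ => F n)
    (ArithmeticFunction.coe_moebius_mul_coe_zeta (R := ℝ))
  simp only [ArithmeticFunction.mul_apply] at h ⊢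
  have h2 : ∑ x ∈ n.divisorsAntidiagonal, moebiusDiv x.1 * invFun x.2
      = (n : ℝ)⁻¹ * (1 : ArithmeticFunction ℝ) n := by
    rw [← h, Finset.mul_sum]
    refine Finset.sum_congr rfl fun x hx => ?_
    have hx' := Nat.mem_divisorsAntidiagonal.1 hx
    have h2 : x.2 ≠ 0 := fun h => by simp [h] at hx'; omega
    rw [← hx'.1]
    simp [moebiusDiv, ArithmeticFunction.pmul_apply, invFun_apply, h2]
    ring
  rw [h2]
  by_cases h1 : n = 1
  · simp [h1]
  · simp [ArithmeticFunction.one_apply_ne h1]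

theorem weight_mul : weight * (invFun * (ArithmeticFunction.zeta : ArithmeticFunction ℝ))
    = oddFactor := by
  have : weight * (invFun * (ArithmeticFunction.zeta : ArithmeticFunction ℝ)) = oddFactor *
      ((ArithmeticFunction.moebius : ArithmeticFunction ℝ) *
        (ArithmeticFunction.zeta : ArithmeticFunction ℝ)) * (moebiusDiv * invFun) := by
    unfold weight; ring
  rw [this, moebiusDiv_mul_invFun, ArithmeticFunction.coe_moebius_mul_coe_zeta]
  simp

theorem mul_apply_prime_pow {F G : ArithmeticFunction ℝ} {p : ℕ} (hp : p.Prime)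
    (hG : ∀ k, 2 ≤ k → G (p ^ k) = 0) (k : ℕ) :
    (F * G) (p ^ (k + 1)) = F (p ^ (k + 1)) * G 1 + F (p ^ k) * G p := by
  rw [ArithmeticFunction.mul_apply, Nat.sum_divisorsAntidiagonal (fun a b => F a * G b),
    Nat.divisors_prime_pow hp, Finset.sum_map]
  have : ∀ i ∈ Finset.range (k + 1 + 1), F (p ^ i) * G (p ^ (k + 1) / p ^ i)
      = F (p ^ i) * G (p ^ (k + 1 - i)) := by
    intro i hi
    rw [Nat.pow_div (by simp at hi; omega) hp.pos]
  simp only [Function.Embedding.coeFn_mk]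
  rw [Finset.sum_congr rfl this, Finset.sum_range_succ, Finset.sum_range_succ,
    Finset.sum_eq_zero]
  · simp; ring
  · intro i hi
    rw [hG _ (by simp at hi; omega), mul_zero]

theorem moebius_real_prime_pow {p : ℕ} (hp : p.Prime) (k : ℕ) (hk : 2 ≤ k) :
    (ArithmeticFunction.moebius : ArithmeticFunction ℝ) (p ^ k) = 0 := by
  simp [ArithmeticFunction.moebius_apply_prime_pow hp (by omega : k ≠ 0)]
  omega

theorem moebiusDiv_prime_pow {p : ℕ} (hp : p.Prime) (k : ℕ) (hk : 2 ≤ k) :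
    moebiusDiv (p ^ k) = 0 := by
  rw [moebiusDiv, ArithmeticFunction.pmul_apply, moebius_real_prime_pow hp k hk, zero_mul]

theorem oddFactor_prime_pow {p : ℕ} (hp : p.Prime) (k : ℕ) (hk : k ≠ 0) :
    oddFactor (p ^ k) = 1 + localExcess p := by
  rw [oddFactor, ArithmeticFunction.prodPrimeFactors_apply (pow_ne_zero _ hp.ne_zero),
    Nat.primeFactors_prime_pow hk hp, Finset.prod_singleton]

theorem oddFactor_mul_moebius_prime_pow {p : ℕ} (hp : p.Prime) (k : ℕ) :
    (oddFactor * (ArithmeticFunction.moebius : ArithmeticFunction ℝ)) (p ^ (k + 1))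
      = if k = 0 then localExcess p else 0 := by
  rw [mul_apply_prime_pow hp (moebius_real_prime_pow hp)]
  have hm : (ArithmeticFunction.moebius : ArithmeticFunction ℝ) p = -1 := by
    simp [ArithmeticFunction.moebius_apply_prime hp]
  have h1 : (ArithmeticFunction.moebius : ArithmeticFunction ℝ) 1 = 1 := by simp
  rw [hm, h1, oddFactor_prime_pow hp _ (by omega)]
  split_ifs with h
  · simp [h, isMultiplicative_oddFactor.map_one]
  · rw [oddFactor_prime_pow hp _ h]; ring

theorem weight_one : weight 1 = 1 := isMultiplicative_weight.map_one

theorem moebiusDiv_prime {p : ℕ} (hp : p.Prime) : moebiusDiv p = -1 / p := by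
  simp [moebiusDiv, ArithmeticFunction.pmul_apply, ArithmeticFunction.moebius_apply_prime hp,
    invFun_apply]
  ring

theorem weight_prime {p : ℕ} (hp : p.Prime) : weight p = localExcess p - 1 / p := by
  have h := mul_apply_prime_pow
    (F := oddFactor * (ArithmeticFunction.moebius : ArithmeticFunction ℝ))
    hp (moebiusDiv_prime_pow hp) 0
  rw [oddFactor_mul_moebius_prime_pow hp] at h
  rw [weight]
  simp only [zero_add, pow_one, pow_zero] at h
  rw [h, moebiusDiv_prime hp, isMultiplicative_moebiusDiv.map_one,
    (isMultiplicative_oddFactor.mul isMultiplicative_moebius_real).map_one]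
  simp; ring

theorem weight_prime_sq {p : ℕ} (hp : p.Prime) : weight (p ^ 2) = -localExcess p / p := by
  have h := mul_apply_prime_pow
    (F := oddFactor * (ArithmeticFunction.moebius : ArithmeticFunction ℝ))
    hp (moebiusDiv_prime_pow hp) 1
  have h1 := oddFactor_mul_moebius_prime_pow hp 0
  simp only [zero_add, pow_one, if_true] at h1
  rw [oddFactor_mul_moebius_prime_pow hp] at h
  rw [weight]
  simp only [one_ne_zero, if_false, pow_one] at h
  rw [h, moebiusDiv_prime hp, h1]
  ring

theorem weight_prime_pow {p : ℕ} (hp : p.Prime) (k : ℕ) (hk : 3 ≤ k) : weight (p ^ k) = 0 := by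
  obtain ⟨j, rfl⟩ : ∃ j, k = j + 1 + 1 + 1 := ⟨k - 3, by omega⟩
  rw [weight, mul_apply_prime_pow hp (moebiusDiv_prime_pow hp),
    oddFactor_mul_moebius_prime_pow hp, oddFactor_mul_moebius_prime_pow hp]
  simp

theorem summable_of_coprime_mul {g c : ℕ → ℝ} (hg : ∀ n, 0 ≤ g n) (h0 : g 0 = 0) (h1 : g 1 = 1)
    (hmul : ∀ {m n}, Nat.Coprime m n → g (m * n) = g m * g n)
    (h3 : ∀ p k, p.Prime → 3 ≤ k → g (p ^ k) = 0)
    (hc0 : ∀ p, 0 ≤ c p) (hc : ∀ p, p.Prime → g p + g (p ^ 2) ≤ c p) (hsum : Summable c) :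
    Summable g := by
  have hloc : ∀ p : ℕ, p.Prime → HasSum (fun k => g (p ^ k)) (1 + g p + g (p ^ 2)) := by
    intro p hp
    have : HasSum (fun k => g (p ^ k)) (∑ k ∈ Finset.range 3, g (p ^ k)) :=
      hasSum_sum_of_ne_finset_zero fun k hk => h3 p k hp (by simpa using hk)
    simpa [Finset.sum_range_succ, h1] using this
  refine summable_of_sum_le (c := Real.exp (∑' p, c p)) hg fun u => ?_
  have hn : ∀ {p : ℕ}, p.Prime → Summable (fun k => ‖g (p ^ k)‖) := by
    intro p hp
    simpa [abs_of_nonneg (hg _)] using (hloc p hp).summable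
  obtain ⟨N, hN⟩ : ∃ N, ∀ n ∈ u, n < N :=
    ⟨u.sup id + 1, fun n hn => Nat.lt_succ_of_le (Finset.le_sup (f := id) hn)⟩
  have key := (EulerProduct.summable_and_hasSum_factoredNumbers_prod_filter_prime_tsum h1 hmul hn
    (Finset.range N)).2
  calc ∑ n ∈ u, g n = ∑ n ∈ u.filter (· ∈ Nat.factoredNumbers (Finset.range N)), g n := by
        rw [Finset.sum_filter]
        refine Finset.sum_congr rfl fun n hn => ?_
        split_ifs with h
        · rfl
        · rcases Nat.eq_zero_or_pos n with rfl | hpos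
          · exact h0
          · refine absurd ?_ h
            rw [Nat.mem_factoredNumbers_iff_forall_le]
            refine ⟨hpos.ne', fun p hp hpp hd => ?_⟩
            exact Finset.mem_range.2 ((Nat.le_of_dvd hpos hd).trans_lt (hN n hn))
    _ = ∑ m ∈ u.subtype (· ∈ Nat.factoredNumbers (Finset.range N)), g m := by
        rw [← Finset.sum_subtype_eq_sum_filter]
    _ ≤ ∏ p ∈ Finset.range N with p.Prime, ∑' k : ℕ, g (p ^ k) :=
        sum_le_hasSum _ (fun m _ => hg m) key
    _ ≤ ∏ p ∈ Finset.range N with p.Prime, Real.exp (c p) := by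
        refine Finset.prod_le_prod (fun p hp => tsum_nonneg fun k => hg _) fun p hp => ?_
        have hpp := (Finset.mem_filter.1 hp).2
        rw [(hloc p hpp).tsum_eq]
        have := hc p hpp
        have := Real.add_one_le_exp (c p)
        linarith
    _ = Real.exp (∑ p ∈ Finset.range N with p.Prime, c p) := (Real.exp_sum _ _).symm
    _ ≤ Real.exp (∑' p, c p) :=
        Real.exp_le_exp.2 (hsum.sum_le_tsum _ fun p _ => hc0 p)

theorem localExcess_nonneg (p : ℕ) : 0 ≤ localExcess p := by
  unfold localExcess
  split_ifs with h
  · have : (2 : ℝ) < p := by exact_mod_cast h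
    exact div_nonneg zero_le_one (by linarith)
  · exact le_rfl

theorem localExcess_le (p : ℕ) (hp : 2 ≤ p) : localExcess p ≤ 3 / p := by
  unfold localExcess
  have hp' : (2 : ℝ) ≤ p := by exact_mod_cast hp
  split_ifs with h
  · have : (3 : ℝ) ≤ p := by exact_mod_cast h
    rw [div_le_div_iff₀ (by linarith) (by linarith)]
    linarith
  · positivity

theorem abs_weight_prime_le {p : ℕ} (hp : p.Prime) : |weight p| ≤ 6 / (p : ℝ) ^ 2 := by
  rw [weight_prime hp, localExcess]
  have hp' : (2 : ℝ) ≤ p := by exact_mod_cast hp.two_le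
  split_ifs with h
  · have h3 : (3 : ℝ) ≤ p := by exact_mod_cast h
    have : 1 / ((p : ℝ) - 2) - 1 / p = 2 / ((p - 2) * p) := by
      have : (p : ℝ) - 2 ≠ 0 := by linarith
      field_simp
      ring
    rw [this, abs_of_nonneg (div_nonneg (by norm_num)
      (mul_nonneg (by linarith) (by linarith))), div_le_div_iff₀ (by nlinarith) (by positivity)]
    nlinarith
  · have : p = 2 := by have := hp.two_le; omega
    subst this
    norm_num [abs_le]

theorem abs_weight_prime_sq_le {p : ℕ} (hp : p.Prime) : |weight (p ^ 2)| ≤ 3 / (p : ℝ) ^ 2 := by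
  have hp' : (0 : ℝ) < p := by exact_mod_cast hp.pos
  rw [weight_prime_sq hp, abs_div, abs_neg, abs_of_nonneg (localExcess_nonneg p),
    abs_of_pos hp', div_le_iff₀ hp']
  refine (localExcess_le p hp.two_le).trans_eq ?_
  field_simp

theorem summable_abs_weight_mul_rpow {b : ℝ} (hb : 0 ≤ b) (hb' : b < 1 / 2) :
    Summable fun n : ℕ => |weight n| * (n : ℝ) ^ b := by
  refine summable_of_coprime_mul (c := fun p : ℕ => 9 * (p : ℝ) ^ (2 * b - 2))
    (fun n => by positivity) (by simp) (by simp [weight_one]) ?_ ?_ (fun p => by positivity) ?_ ?_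
  · intro m n hmn
    rw [isMultiplicative_weight.map_mul_of_coprime hmn, abs_mul, Nat.cast_mul,
      Real.mul_rpow (Nat.cast_nonneg _) (Nat.cast_nonneg _)]
    ring
  · intro p k hp hk
    simp [weight_prime_pow hp k hk]
  · intro p hp
    have hp' : (1 : ℝ) ≤ p := by exact_mod_cast hp.one_le
    have hp0 : (0 : ℝ) < p := by linarith
    have e1 : (p : ℝ) ^ b ≤ (p : ℝ) ^ (2 * b) :=
      Real.rpow_le_rpow_of_exponent_le hp' (by linarith)
    have e2 : ((p ^ 2 : ℕ) : ℝ) ^ b = (p : ℝ) ^ (2 * b) := by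
      rw [Nat.cast_pow, ← Real.rpow_natCast, ← Real.rpow_mul hp0.le]; norm_num
    have e3 : (p : ℝ) ^ (2 * b - 2) = (p : ℝ) ^ (2 * b) / (p : ℝ) ^ 2 := by
      rw [Real.rpow_sub hp0]; norm_num
    rw [e2, e3]
    calc _ ≤ 6 / (p : ℝ) ^ 2 * (p : ℝ) ^ (2 * b) + 3 / (p : ℝ) ^ 2 * (p : ℝ) ^ (2 * b) := by
          have := abs_weight_prime_le hp
          have := abs_weight_prime_sq_le hp
          gcongr
      _ = _ := by ring
  · exact (Real.summable_nat_rpow.2 (by linarith)).mul_left 9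

theorem summable_abs_weight : Summable fun n : ℕ => |weight n| := by
  simpa using summable_abs_weight_mul_rpow (b := 0) le_rfl (by norm_num)

theorem summable_abs_weight_mul_log : Summable fun n : ℕ => |weight n| * Real.log n := by
  refine Summable.of_nonneg_of_le
    (fun n => mul_nonneg (abs_nonneg _) (Real.log_natCast_nonneg n)) (fun n => ?_)
    ((summable_abs_weight_mul_rpow (b := 1 / 4) (by norm_num) (by norm_num)).mul_left 4)
  have := Real.log_le_rpow_div (Nat.cast_nonneg n) (show (0 : ℝ) < 1 / 4 by norm_num)
  calc _ ≤ |weight n| * ((n : ℝ) ^ (1 / 4 : ℝ) / (1 / 4)) := by gcongr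
    _ = _ := by ring

theorem hasProd_of_coprime_mul {g : ℕ → ℝ} (h0 : g 0 = 0) (h1 : g 1 = 1)
    (hmul : ∀ {m n}, Nat.Coprime m n → g (m * n) = g m * g n)
    (h3 : ∀ p k, p.Prime → 3 ≤ k → g (p ^ k) = 0) (hsum : Summable fun n => |g n|) :
    HasProd (fun p : Nat.Primes => 1 + g p + g ((p : ℕ) ^ 2)) (∑' n, g n) := by
  have h := EulerProduct.eulerProduct_hasProd h1 hmul hsum h0
  have e : (fun p : Nat.Primes => ∑' k : ℕ, g ((p : ℕ) ^ k)) =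
      fun p : Nat.Primes => 1 + g p + g ((p : ℕ) ^ 2) := by
    funext p
    have : HasSum (fun k => g ((p : ℕ) ^ k)) (∑ k ∈ Finset.range 3, g ((p : ℕ) ^ k)) :=
      hasSum_sum_of_ne_finset_zero fun k hk => h3 p k p.2 (by simpa using hk)
    rw [this.tsum_eq]
    simp [Finset.sum_range_succ, h1]
  rwa [e] at h

/-- The constant `∏ (1 - 1 / (p - 1) ^ 2)` over odd primes. -/
noncomputable def twinConst : ℝ :=
  ∏' p : Nat.Primes, if 2 < (p : ℕ) then (1 - 1 / ((p : ℝ) - 1) ^ 2) else 1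

theorem hasProd_twinConst :
    HasProd (fun p : Nat.Primes => if 2 < (p : ℕ) then (1 - 1 / ((p : ℝ) - 1) ^ 2) else 1)
      twinConst := by
  have hs : Summable fun n : ℕ => 4 / (n : ℝ) ^ 2 := by
    simpa [div_eq_mul_inv] using
      (Real.summable_one_div_nat_pow.2 (show 1 < 2 by norm_num)).mul_left 4
  have hs' : Summable fun p : Nat.Primes => 4 / (p : ℝ) ^ 2 :=
    hs.comp_injective Nat.Primes.coe_nat_injective
  have : Summable fun p : Nat.Primes => if 2 < (p : ℕ) then -(1 / ((p : ℝ) - 1) ^ 2) else 0 := by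
    refine Summable.of_norm_bounded hs' fun p => ?_
    split_ifs with h
    · have h3 : (3 : ℝ) ≤ p := by exact_mod_cast h
      rw [norm_neg, Real.norm_of_nonneg (by positivity),
        div_le_div_iff₀ (by nlinarith) (by positivity)]
      nlinarith
    · rw [norm_zero]; positivity
  have h := (Real.multipliable_one_add_of_summable this).hasProd
  have e : (fun p : Nat.Primes => if 2 < (p : ℕ) then (1 - 1 / ((p : ℝ) - 1) ^ 2) else 1) =
      fun p : Nat.Primes => 1 + if 2 < (p : ℕ) then -(1 / ((p : ℝ) - 1) ^ 2) else 0 := by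
    funext p
    split_ifs <;> ring
  rw [twinConst, e]
  exact h

theorem hasProd_weight :
    HasProd (fun p : Nat.Primes => 1 + weight p + weight ((p : ℕ) ^ 2)) (∑' n, weight n) :=
  hasProd_of_coprime_mul (by simp) weight_one isMultiplicative_weight.map_mul_of_coprime
    (fun _ k hp hk => weight_prime_pow hp k hk) summable_abs_weight

theorem prime_eq_two_of_not_lt (p : Nat.Primes) (h : ¬ 2 < (p : ℕ)) : (p : ℕ) = 2 := by
  have := p.2.two_le; omega

theorem twinConst_mul_tsum_weight : twinConst * ∑' n, weight n = 1 / 2 := by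
  have h := hasProd_twinConst.mul hasProd_weight
  refine h.unique ?_
  have h2 := hasProd_single (f := fun p : Nat.Primes =>
    (if 2 < (p : ℕ) then (1 - 1 / ((p : ℝ) - 1) ^ 2) else 1) *
      (1 + weight p + weight ((p : ℕ) ^ 2))) ⟨2, Nat.prime_two⟩ (fun p hp => ?_)
  · convert h2 using 1
    have e1 := weight_prime Nat.prime_two
    have e2 := weight_prime_sq Nat.prime_two
    simp only [localExcess, lt_irrefl, if_false] at e1 e2 ⊢
    rw [e1, e2]
    norm_num
  · have h : 2 < (p : ℕ) := by
      by_contra h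
      exact hp (Subtype.ext (prime_eq_two_of_not_lt p h))
    have h3 : (3 : ℝ) ≤ p := by exact_mod_cast h
    have a1 : (p : ℝ) - 2 ≠ 0 := by linarith
    have a2 : (p : ℝ) - 1 ≠ 0 := by linarith
    have a3 : (p : ℝ) ≠ 0 := by linarith
    simp only [weight_prime p.2, weight_prime_sq p.2, localExcess, h, if_true]
    field_simp
    ring

theorem summable_abs_weight_div : Summable fun n : ℕ => |weight n / n| := by
  refine Summable.of_nonneg_of_le (fun _ => abs_nonneg _) (fun n => ?_) summable_abs_weight
  rcases Nat.eq_zero_or_pos n with rfl | hn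
  · simp
  · rw [abs_div, Nat.abs_cast]
    exact div_le_self (abs_nonneg _) (by exact_mod_cast hn)

theorem twinConst_mul_tsum_weight_div :
    twinConst * ((∑' k : ℕ, 1 / (k : ℝ) ^ 2) * ∑' n : ℕ, weight n / n) = 1 := by
  have h1 : HasProd (fun p : Nat.Primes =>
      1 + weight p / ((p : ℕ) : ℝ) + weight ((p : ℕ) ^ 2) / (((p : ℕ) ^ 2 : ℕ) : ℝ))
      (∑' n : ℕ, weight n / n) := by
    refine hasProd_of_coprime_mul (g := fun n => weight n / n) (by simp) (by simp [weight_one])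
      ?_ ?_ summable_abs_weight_div
    · intro m n hmn
      simp only [isMultiplicative_weight.map_mul_of_coprime hmn, Nat.cast_mul]
      rw [mul_div_mul_comm]
    · intro p k hp hk
      simp [weight_prime_pow hp k hk]
  let z : ℕ →*₀ ℝ :=
    { toFun := fun n => 1 / (n : ℝ) ^ 2
      map_zero' := by simp
      map_one' := by simp
      map_mul' := fun m n => by push_cast; rw [mul_pow, one_div_mul_one_div] }
  have hz : ∀ n, z n = 1 / (n : ℝ) ^ 2 := fun _ => rfl
  have h2 : HasProd (fun p : Nat.Primes => (1 - 1 / ((p : ℕ) : ℝ) ^ 2)⁻¹)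
      (∑' k : ℕ, 1 / (k : ℝ) ^ 2) := by
    refine EulerProduct.eulerProduct_completely_multiplicative_hasProd (f := z) ?_
    simp [hz]
  refine (hasProd_twinConst.mul (h2.mul h1)).unique ?_
  convert hasProd_one using 2 with p
  have p0 : ((p : ℕ) : ℝ) ≠ 0 := by exact_mod_cast p.2.ne_zero
  by_cases h : 2 < (p : ℕ)
  · have h3 : (3 : ℝ) ≤ p := by exact_mod_cast h
    have a1 : (p : ℝ) - 2 ≠ 0 := by linarith
    have a2 : (p : ℝ) - 1 ≠ 0 := by linarith
    have a4 : (p : ℝ) ^ 2 - 1 ≠ 0 := by nlinarith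
    simp only [weight_prime p.2, weight_prime_sq p.2, localExcess, h, if_true, Nat.cast_pow]
    field_simp
    ring
  · have e := prime_eq_two_of_not_lt p h
    have e1 := weight_prime Nat.prime_two
    have e2 := weight_prime_sq Nat.prime_two
    simp only [localExcess, lt_irrefl, if_false] at e1 e2
    simp only [e, e1, e2, lt_irrefl, if_false]
    norm_num

theorem factorization_mul_log_le (p n : ℕ) :
    (n.factorization p : ℝ) * Real.log p ≤ Real.log n := by
  rcases Nat.eq_zero_or_pos n with rfl | hn
  · simp
  rcases Nat.eq_zero_or_pos p with rfl | hp
  · simpa using Real.log_natCast_nonneg n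
  rw [← Real.log_pow]
  refine Real.log_le_log (by positivity) ?_
  exact_mod_cast Nat.ordProj_le p hn.ne'

theorem summable_weight_mul_factorization {p : ℕ} (hp : p.Prime) :
    Summable fun n : ℕ => weight n * n.factorization p := by
  have hl : 0 < Real.log p := Real.log_pos (by exact_mod_cast hp.one_lt)
  refine Summable.of_norm_bounded (summable_abs_weight_mul_log.mul_left (Real.log p)⁻¹)
    fun n => ?_
  rw [norm_mul, Real.norm_eq_abs, Real.norm_natCast]
  have := factorization_mul_log_le p n
  rw [← le_div_iff₀ hl] at this
  calc _ ≤ |weight n| * (Real.log n / Real.log p) := by gcongr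
    _ = _ := by ring

theorem hasProd_weight_mul_one_add_factorization {q : ℕ} (hq : q.Prime) :
    HasProd (fun p : Nat.Primes => if (p : ℕ) = q then 1 + 2 * weight q + 3 * weight (q ^ 2) else
      1 + weight p + weight ((p : ℕ) ^ 2))
      (∑' n, weight n + ∑' n : ℕ, weight n * n.factorization q) := by
  have hs : Summable fun n => weight n := summable_abs_weight.of_abs
  rw [← hs.tsum_add (summable_weight_mul_factorization hq)]
  have := hasProd_of_coprime_mul (g := fun n => weight n + weight n * n.factorization q) (by simp)
    (by simp [weight_one]) ?_ ?_ (hs.add (summable_weight_mul_factorization hq)).abs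
  · convert this using 2 with p
    split_ifs with h
    · rw [h, hq.factorization_self, hq.factorization_pow]
      simp; ring
    · have : ∀ k, ((p : ℕ) ^ k).factorization q = 0 := fun k => by
        rw [p.2.factorization_pow, Finsupp.single_eq_of_ne (Ne.symm h)]
      have h1 := this 1
      rw [pow_one] at h1
      simp [h1]
  · intro m n hmn
    simp only [isMultiplicative_weight.map_mul_of_coprime hmn]
    rw [Nat.factorization_mul_of_coprime hmn]
    have : m.factorization q = 0 ∨ n.factorization q = 0 := by
      by_contra! h
      have h1 := Nat.dvd_of_factorization_pos h.1
      have h2 := Nat.dvd_of_factorization_pos h.2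
      exact Nat.not_coprime_of_dvd_of_dvd hq.one_lt h1 h2 hmn
    rcases this with h | h <;> simp [h] <;> ring
  · intro p k hp hk
    simp [weight_prime_pow hp k hk]

theorem tsum_weight_mul_factorization_of_two_lt {q : ℕ} (hq : q.Prime) (h : 2 < q) :
    ∑' n : ℕ, weight n * n.factorization q = 0 := by
  have h1 := hasProd_weight_mul_one_add_factorization hq
  have h2 : (fun p : Nat.Primes => if (p : ℕ) = q then 1 + 2 * weight q + 3 * weight (q ^ 2) else
      1 + weight p + weight ((p : ℕ) ^ 2)) =
      fun p : Nat.Primes => 1 + weight p + weight ((p : ℕ) ^ 2) := by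
    funext p
    split_ifs with hp
    · have h3 : (3 : ℝ) ≤ q := by exact_mod_cast h
      have a1 : (q : ℝ) - 2 ≠ 0 := by linarith
      rw [hp, weight_prime hq, weight_prime_sq hq, localExcess, if_pos h]
      field_simp
      ring
    · rfl
  rw [h2] at h1
  linarith [h1.unique hasProd_weight]

theorem tsum_weight_mul_factorization_two :
    ∑' n : ℕ, weight n * n.factorization 2 = -∑' n, weight n := by
  have h1 := hasProd_weight_mul_one_add_factorization Nat.prime_two
  have h2 := h1.unique (hasProd_zero_of_exists_eq_zero ⟨⟨2, Nat.prime_two⟩, by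
    rw [if_pos rfl, weight_prime Nat.prime_two, weight_prime_sq Nat.prime_two, localExcess]
    norm_num⟩)
  linarith

theorem hasSum_factorization_mul_log (n : ℕ) :
    HasSum (fun p : ℕ => (n.factorization p : ℝ) * Real.log p) (Real.log n) := by
  rw [Real.log_nat_eq_sum_factorization]
  exact hasSum_sum_of_ne_finset_zero fun p hp => by simp [Finsupp.notMem_support_iff.1 hp]

theorem tsum_weight_mul_log : ∑' n : ℕ, weight n * Real.log n = -Real.log 2 * ∑' n, weight n := by
  have hs : Summable fun x : ℕ × ℕ =>
      weight x.1 * ((x.1.factorization x.2 : ℝ) * Real.log x.2) := by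
    have : Summable fun x : ℕ × ℕ =>
        |weight x.1| * ((x.1.factorization x.2 : ℝ) * Real.log x.2) := by
      refine (summable_prod_of_nonneg fun x => ?_).2
        ⟨fun n => (hasSum_factorization_mul_log n).summable.mul_left |weight n|, ?_⟩
      · exact mul_nonneg (abs_nonneg _)
          (mul_nonneg (Nat.cast_nonneg _) (Real.log_natCast_nonneg x.2))
      · refine summable_abs_weight_mul_log.congr fun n => ?_
        change _ = ∑' p : ℕ, |weight n| * ((n.factorization p : ℝ) * Real.log p)
        rw [tsum_mul_left, (hasSum_factorization_mul_log n).tsum_eq]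
    refine Summable.of_norm_bounded this fun x => ?_
    have := Real.log_natCast_nonneg x.2
    rw [norm_mul, Real.norm_eq_abs, Real.norm_of_nonneg (by positivity)]
  calc ∑' n : ℕ, weight n * Real.log n
      = ∑' n : ℕ, ∑' p : ℕ, weight n * ((n.factorization p : ℝ) * Real.log p) := by
        refine tsum_congr fun n => ?_
        rw [tsum_mul_left, (hasSum_factorization_mul_log n).tsum_eq]
    _ = ∑' p : ℕ, ∑' n : ℕ, weight n * ((n.factorization p : ℝ) * Real.log p) :=
        (Summable.tsum_comm hs).symm
    _ = ∑' p : ℕ, (∑' n : ℕ, weight n * n.factorization p) * Real.log p := by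
        simp only [← mul_assoc, tsum_mul_right]
    _ = (∑' n : ℕ, weight n * n.factorization 2) * Real.log (2 : ℕ) := by
        refine tsum_eq_single 2 fun p hp => ?_
        by_cases hpp : p.Prime
        · have := hpp.two_le
          rw [tsum_weight_mul_factorization_of_two_lt hpp (by omega), zero_mul]
        · simp [Nat.factorization_eq_zero_of_not_prime _ hpp]
    _ = _ := by rw [tsum_weight_mul_factorization_two]; push_cast; ring

theorem rieszSum_of_lt_one (F : ℕ → ℝ) {x : ℝ} (hx : x < 1) : rieszSum F x = 0 := by
  simp [rieszSum, Nat.floor_eq_zero.2 hx]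

theorem hasSum_weight_mul_rieszMain {x : ℝ} (hx : 0 < x) :
    HasSum (fun n : ℕ => weight n * n * rieszMain (x / n))
      ((∑' k : ℕ, 1 / (k : ℝ) ^ 2) / 2 * (∑' n : ℕ, weight n / n) * x ^ 2
        - x / 2 * ((∑' n : ℕ, weight n) * (Real.log x + Real.log 2))
        + (1 - eulerMascheroniConstant - Real.log (2 * π)) / 2 * (∑' n : ℕ, weight n) * x) := by
  have h1 := summable_abs_weight_div.of_abs.hasSum
  have h2 := summable_abs_weight.of_abs.hasSum
  have h3 : HasSum (fun n : ℕ => weight n * Real.log n) (-Real.log 2 * ∑' n, weight n) := by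
    rw [← tsum_weight_mul_log]
    refine (Summable.of_norm ?_).hasSum
    refine summable_abs_weight_mul_log.congr fun n => ?_
    rw [norm_mul, Real.norm_eq_abs, Real.norm_of_nonneg (Real.log_natCast_nonneg n)]
  have := ((h1.mul_left ((∑' k : ℕ, 1 / (k : ℝ) ^ 2) / 2 * x ^ 2)).sub
    ((h2.mul_left (x / 2 * Real.log x)).sub (h3.mul_left (x / 2)))).add
    (h2.mul_left ((1 - eulerMascheroniConstant - Real.log (2 * π)) / 2 * x))
  have e : ∀ n : ℕ, weight n * n * rieszMain (x / n) =
      (∑' k : ℕ, 1 / (k : ℝ) ^ 2) / 2 * x ^ 2 * (weight n / n) -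
        (x / 2 * Real.log x * weight n - x / 2 * (weight n * Real.log n)) +
      (1 - eulerMascheroniConstant - Real.log (2 * π)) / 2 * x * weight n := by
    intro n
    rcases Nat.eq_zero_or_pos n with rfl | hn
    · simp
    have hn' : (n : ℝ) ≠ 0 := by positivity
    rw [rieszMain, Real.log_div hx.ne' hn']
    field_simp
  rw [funext e]
  refine (congrArg (HasSum _) ?_).mp this
  ring

theorem exists_abs_rieszSum_oddFactor_sub_le {a : ℝ} (ha : 1 / 2 < a) (ha1 : a < 1) :
    ∃ K, 0 < K ∧ ∀ x, 0 < x → |rieszSum oddFactor x -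
      ((∑' k : ℕ, 1 / (k : ℝ) ^ 2) / 2 * (∑' n : ℕ, weight n / n) * x ^ 2
        - x / 2 * ((∑' n : ℕ, weight n) * (Real.log x + Real.log 2))
        + (1 - eulerMascheroniConstant - Real.log (2 * π)) / 2 * (∑' n : ℕ, weight n) * x)|
      ≤ K * x ^ a := by
  obtain ⟨K, hK, hKx⟩ := exists_abs_rieszSum_sub_main_le ha.le ha1
  have hs := summable_abs_weight_mul_rpow (b := 1 - a) (by linarith) (by linarith)
  have hS0 : 0 ≤ ∑' n : ℕ, |weight n| * (n : ℝ) ^ (1 - a) := tsum_nonneg fun n => by positivity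
  refine ⟨K * (∑' n : ℕ, |weight n| * (n : ℝ) ^ (1 - a)) + 1, by positivity, fun x hx => ?_⟩
  set S := rieszSum (invFun * ArithmeticFunction.zeta : ArithmeticFunction ℝ) with hS
  have e1 : HasSum (fun n : ℕ => weight n * n * S (x / n)) (rieszSum oddFactor x) := by
    rw [← weight_mul, rieszSum_mul]
    refine hasSum_sum_of_ne_finset_zero fun n hn => ?_
    rcases Nat.eq_zero_or_pos n with rfl | hpos
    · simp
    have : x < n := by
      rw [Finset.mem_Ioc, not_and_or, not_lt, not_le] at hn
      exact (Nat.floor_lt hx.le).1 (hn.resolve_left (by omega))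
    rw [hS, rieszSum_of_lt_one _ ((div_lt_one (by positivity)).2 this), mul_zero]
  have e2 := e1.sub (hasSum_weight_mul_rieszMain hx)
  have e3 : ∀ n : ℕ, ‖weight n * n * S (x / n) - weight n * n * rieszMain (x / n)‖
      ≤ K * x ^ a * (|weight n| * (n : ℝ) ^ (1 - a)) := by
    intro n
    rcases Nat.eq_zero_or_pos n with rfl | hpos
    · simp
    have hn : (0 : ℝ) < n := by positivity
    rw [← mul_sub, norm_mul, norm_mul, Real.norm_eq_abs, Real.norm_natCast, Real.norm_eq_abs]
    calc _ ≤ |weight n| * n * (K * (x / n) ^ a) := by gcongr; exact hKx _ (by positivity)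
      _ = _ := by
        rw [Real.div_rpow hx.le hn.le, Real.rpow_sub hn, Real.rpow_one]
        ring
  rw [← e2.tsum_eq, ← Real.norm_eq_abs]
  refine (tsum_of_norm_bounded (hs.mul_left (K * x ^ a)).hasSum e3).trans ?_
  rw [tsum_mul_left]
  have : 0 ≤ x ^ a := by positivity
  nlinarith

theorem singularSeries_two_mul {m : ℕ} (hm : m ≠ 0) :
    singularSeries (2 * m) = 2 * twinConst * oddFactor m := by
  rw [singularSeries, if_pos (even_two_mul m), ← twinConst, oddFactor,
    ArithmeticFunction.prodPrimeFactors_apply hm,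
    Nat.primeFactors_mul two_ne_zero hm, Finset.prod_filter, Nat.prime_two.primeFactors]
  congr 1
  have : ∀ p ∈ {2} ∪ m.primeFactors, (if 2 < p then ((p : ℝ) - 1) / ((p : ℝ) - 2) else 1)
      = 1 + localExcess p := by
    intro p _
    unfold localExcess
    split_ifs with h
    · have h3 : (3 : ℝ) ≤ p := by exact_mod_cast h
      have a1 : (p : ℝ) - 2 ≠ 0 := by linarith
      field_simp
      ring
    · simp
  rw [Finset.prod_congr rfl this]
  symm
  refine Finset.prod_subset Finset.subset_union_right fun p hp hp' => ?_
  have : p = 2 := by simpa [hp'] using hp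
  simp [this, localExcess]

theorem rieszSum_singularSeries (y : ℝ) :
    rieszSum singularSeries y = 4 * twinConst * rieszSum oddFactor (y / 2) := by
  have hf : ⌊y / 2⌋₊ = ⌊y⌋₊ / 2 := by
    have := Nat.floor_div_natCast y 2
    simpa using this
  rw [rieszSum, rieszSum, hf, Finset.mul_sum]
  symm
  refine Finset.sum_of_injOn (fun m => 2 * m) (fun a _ b _ h => by simpa using h) ?_ ?_ ?_
  · intro m hm
    simp only [Finset.coe_Ioc, Set.mem_Ioc] at hm ⊢
    omega
  · intro h hh hne
    have : ¬ Even h := by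
      rintro ⟨m, rfl⟩
      refine hne ⟨m, ?_, by ring⟩
      simp only [Finset.coe_Ioc, Finset.mem_Ioc, Set.mem_Ioc] at hh ⊢
      omega
    rw [singularSeries, if_neg this, mul_zero]
  · intro m hm
    rw [singularSeries_two_mul (by simp at hm; omega)]
    push_cast
    ring

theorem exists_abs_rieszSum_singularSeries_sub_le {a : ℝ} (ha : 1 / 2 < a) (ha1 : a < 1) :
    ∃ K, 0 < K ∧ ∀ y, 0 < y → |rieszSum singularSeries y -
      (y ^ 2 / 2 - y / 2 * Real.log y +
        (1 - eulerMascheroniConstant - Real.log (2 * π)) / 2 * y)| ≤ K * y ^ a := by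
  obtain ⟨K, hK, hKx⟩ := exists_abs_rieszSum_oddFactor_sub_le ha ha1
  refine ⟨4 * |twinConst| * K + 1, by positivity, fun y hy => ?_⟩
  have h := hKx (y / 2) (by positivity)
  have h1 := twinConst_mul_tsum_weight
  have h2 := twinConst_mul_tsum_weight_div
  set Z := ∑' k : ℕ, 1 / (k : ℝ) ^ 2
  set W₀ := ∑' n : ℕ, weight n
  set W₁ := ∑' n : ℕ, weight n / n
  rw [Real.log_div hy.ne' two_ne_zero, sub_add_cancel] at h
  have e : rieszSum singularSeries y - (y ^ 2 / 2 - y / 2 * Real.log y +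
        (1 - eulerMascheroniConstant - Real.log (2 * π)) / 2 * y) =
      4 * twinConst * (rieszSum oddFactor (y / 2) - (Z / 2 * W₁ * (y / 2) ^ 2
        - y / 2 / 2 * (W₀ * Real.log y)
        + (1 - eulerMascheroniConstant - Real.log (2 * π)) / 2 * W₀ * (y / 2))) := by
    rw [rieszSum_singularSeries]
    linear_combination (y ^ 2 / 2) * h2 + (-(y * Real.log y) +
      (1 - eulerMascheroniConstant - Real.log (2 * π)) * y) * h1
  rw [e, abs_mul, abs_mul, abs_of_pos (by norm_num : (0 : ℝ) < 4)]
  have hle : (y / 2) ^ a ≤ y ^ a := Real.rpow_le_rpow (by positivity) (by linarith) (by linarith)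
  calc _ ≤ 4 * |twinConst| * (K * y ^ a) := by
        gcongr
        exact h.trans (by gcongr)
    _ ≤ _ := by
        have : 0 ≤ y ^ a := by positivity
        nlinarith

theorem rieszSum_eq_sum_max (F : ℕ → ℝ) {x : ℝ} {N : ℕ} (hx : x ≤ N) :
    rieszSum F x = ∑ n ∈ Finset.Ioc 0 N, max (x - n) 0 * F n := by
  rw [rieszSum]
  have hN : ⌊x⌋₊ ≤ N := Nat.floor_le_of_le hx
  rw [← Finset.sum_subset (Finset.Ioc_subset_Ioc_right hN)]
  · refine Finset.sum_congr rfl fun n hn => ?_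
    rw [max_eq_left]
    have hn' := Finset.mem_Ioc.1 hn
    have := Nat.floor_le (Nat.pos_of_floor_pos (hn'.1.trans_le hn'.2)).le
    have h2 : (n : ℝ) ≤ ⌊x⌋₊ := by exact_mod_cast hn'.2
    linarith
  · intro n hn hn'
    have h1 : ⌊x⌋₊ < n := by
      simp only [Finset.mem_Ioc] at hn hn'
      omega
    rw [max_eq_right (by linarith [Nat.lt_of_floor_lt h1]), zero_mul]

theorem continuous_rieszSum (F : ℕ → ℝ) : Continuous (rieszSum F) := by
  refine continuous_iff_continuousAt.2 fun x => ?_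
  obtain ⟨N, hN⟩ := exists_nat_gt x
  have h : ContinuousAt (fun x : ℝ => ∑ n ∈ Finset.Ioc 0 N, max (x - n) 0 * F n) x := by
    fun_prop
  refine h.congr ?_
  filter_upwards [Iio_mem_nhds hN] with y hy
  exact (rieszSum_eq_sum_max F (le_of_lt hy)).symm

theorem hasDerivAt_rieszSum (F : ℕ → ℝ) {x : ℝ} (hx : 0 < x) (hx' : x ∉ Set.range ((↑) : ℕ → ℝ)) :
    HasDerivAt (rieszSum F) (∑ n ∈ Finset.Icc 1 ⌊x⌋₊, F n) x := by
  rw [finset_Icc_one_eq_Ioc_zero]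
  have h1 : HasDerivAt (fun y : ℝ => ∑ n ∈ Finset.Ioc 0 ⌊x⌋₊, (y - n) * F n)
      (∑ n ∈ Finset.Ioc 0 ⌊x⌋₊, F n) x := by
    refine HasDerivAt.fun_sum fun n _ => ?_
    simpa using ((hasDerivAt_id x).sub_const (n : ℝ)).mul_const (F n)
  refine h1.congr_of_eventuallyEq ?_
  have hlt : (⌊x⌋₊ : ℝ) < x := lt_of_le_of_ne (Nat.floor_le hx.le) fun h => hx' ⟨_, h⟩
  filter_upwards [Ioo_mem_nhds hlt (Nat.lt_floor_add_one x)] with y hy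
  have : ⌊y⌋₊ = ⌊x⌋₊ :=
    (Nat.floor_eq_iff ((Nat.cast_nonneg _).trans hy.1.le)).2 ⟨hy.1.le, hy.2⟩
  rw [rieszSum, this]

theorem twinConst_nonneg : 0 ≤ twinConst := by
  refine ge_of_tendsto' hasProd_twinConst fun s => Finset.prod_nonneg fun p _ => ?_
  split_ifs with h
  · have h3 : (3 : ℝ) ≤ p := by exact_mod_cast h
    rw [sub_nonneg, div_le_one (by nlinarith)]
    nlinarith
  · exact zero_le_one

theorem singularSeries_nonneg (d : ℕ) : 0 ≤ singularSeries d := by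
  rw [singularSeries, ← twinConst]
  split_ifs
  · refine mul_nonneg (mul_nonneg zero_le_two twinConst_nonneg) (Finset.prod_nonneg fun p hp => ?_)
    have h : 2 < p := (Finset.mem_filter.1 hp).2
    have h3 : (3 : ℝ) ≤ p := by exact_mod_cast h
    exact div_nonneg (by linarith) (by linarith)
  · exact le_rfl

theorem measurable_epsErr : Measurable epsErr := by
  have h : Measurable fun y : ℝ => ∑ h ∈ Finset.Icc 1 ⌊y⌋₊, singularSeries h :=
    (Measurable.of_discrete (f := fun n : ℕ => ∑ h ∈ Finset.Icc 1 n, singularSeries h)).comp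
      Nat.measurable_floor
  unfold epsErr
  exact (h.sub measurable_id).add (Real.measurable_log.div_const 2)

theorem exists_abs_epsErr_le : ∃ C, 0 < C ∧ ∀ u, 1 ≤ u → |epsErr u| ≤ C * u := by
  obtain ⟨K, hK, hKx⟩ := exists_abs_rieszSum_singularSeries_sub_le (a := 3 / 4)
    (by norm_num) (by norm_num)
  set c := (1 - eulerMascheroniConstant - Real.log (2 * π)) / 2
  refine ⟨4 * (K + 1 + |c|) + 2, by positivity, fun u hu => ?_⟩
  have hS0 : 0 ≤ ∑ h ∈ Finset.Icc 1 ⌊u⌋₊, singularSeries h :=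
    Finset.sum_nonneg fun h _ => singularSeries_nonneg h
  have hS : u * ∑ h ∈ Finset.Icc 1 ⌊u⌋₊, singularSeries h ≤ rieszSum singularSeries (2 * u) := by
    rw [finset_Icc_one_eq_Ioc_zero, rieszSum, Finset.mul_sum]
    refine (Finset.sum_le_sum (g := fun n : ℕ => (2 * u - n) * singularSeries n)
      fun n hn => ?_).trans (Finset.sum_le_sum_of_subset_of_nonneg
        (Finset.Ioc_subset_Ioc_right (Nat.floor_mono (by linarith))) fun n hn _ => ?_)
    · have := (Nat.le_floor_iff (by linarith)).1 (Finset.mem_Ioc.1 hn).2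
      exact mul_le_mul_of_nonneg_right (by linarith) (singularSeries_nonneg n)
    · have := (Nat.le_floor_iff (by linarith)).1 (Finset.mem_Ioc.1 hn).2
      exact mul_nonneg (by linarith) (singularSeries_nonneg n)
  have h := (abs_le.1 (hKx (2 * u) (by linarith))).2
  have h1 : (2 * u) ^ (3 / 4 : ℝ) ≤ (2 * u) ^ 2 := by
    rw [← Real.rpow_natCast (2 * u)]
    exact Real.rpow_le_rpow_of_exponent_le (by linarith) (by norm_num)
  have h2 : 0 ≤ 2 * u / 2 * Real.log (2 * u) :=
    mul_nonneg (by linarith) (Real.log_nonneg (by linarith))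
  have h3 : c * (2 * u) ≤ |c| * (2 * u) ^ 2 := by
    have := le_abs_self c
    have := abs_nonneg c
    calc c * (2 * u) ≤ |c| * (2 * u) := by gcongr
      _ ≤ |c| * (2 * u) ^ 2 := by gcongr; nlinarith
  have h4 : u * ∑ h ∈ Finset.Icc 1 ⌊u⌋₊, singularSeries h ≤ u * (4 * (K + 1 + |c|) * u) := by
    have : K * (2 * u) ^ (3 / 4 : ℝ) ≤ K * (2 * u) ^ 2 := by gcongr
    nlinarith
  have h5 := le_of_mul_le_mul_left h4 (by linarith)
  have h6 := Real.log_nonneg hu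
  have h7 := Real.log_le_self (by linarith : 0 ≤ u)
  rw [epsErr, abs_le]
  have : 0 ≤ (K + 1 + |c|) * u := by positivity
  constructor <;> nlinarith

/-- An antiderivative of `epsErr - Bconst / 2` away from the integers. -/
noncomputable def epsPrimitive (u : ℝ) : ℝ :=
  rieszSum singularSeries u - u ^ 2 / 2 + (u * Real.log u - u) / 2 - Bconst / 2 * u

theorem continuous_epsPrimitive : Continuous epsPrimitive := by
  have := continuous_rieszSum singularSeries
  have := Real.continuous_mul_log
  unfold epsPrimitive
  fun_prop

theorem hasDerivAt_epsPrimitive {x : ℝ} (hx : 0 < x) (hx' : x ∉ Set.range ((↑) : ℕ → ℝ)) :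
    HasDerivAt epsPrimitive (epsErr x - Bconst / 2) x := by
  have h1 := hasDerivAt_rieszSum singularSeries hx hx'
  have h2 := ((hasDerivAt_pow 2 x).div_const 2)
  have h3 := ((Real.hasDerivAt_mul_log hx.ne').sub (hasDerivAt_id x)).div_const 2
  have h4 := (hasDerivAt_id x).const_mul (Bconst / 2)
  refine HasDerivAt.congr_deriv (((h1.sub h2).add h3).sub h4) ?_
  rw [epsErr]
  simp

theorem intervalIntegrable_of_measurable_of_abs_le {g : ℝ → ℝ} {C a b : ℝ} (hg : Measurable g)
    (hab : a ≤ b) (h : ∀ x, a ≤ x → x ≤ b → |g x| ≤ C) : IntervalIntegrable g volume a b := by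
  rw [intervalIntegrable_iff, Set.uIoc_of_le hab]
  refine IntegrableOn.of_bound (by simp) hg.aestronglyMeasurable C ?_
  filter_upwards [ae_restrict_mem measurableSet_Ioc] with x hx
  exact h x hx.1.le hx.2

theorem fErr_eq {y : ℝ} (hy : 1 ≤ y) : fErr y = epsPrimitive y - epsPrimitive 1 := by
  obtain ⟨C, hC, h⟩ := exists_abs_epsErr_le
  rw [fErr]
  refine integral_eq_of_hasDerivAt_off_countable _ _ (Set.countable_range ((↑) : ℕ → ℝ))
    continuous_epsPrimitive.continuousOn (fun x hx => ?_) ?_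
  · rw [min_eq_left hy] at hx
    exact hasDerivAt_epsPrimitive (by linarith [hx.1.1]) hx.2
  · refine (intervalIntegrable_of_measurable_of_abs_le measurable_epsErr hy
      (C := C * y) fun x h1 h2 => (h x h1).trans (by gcongr)).sub (by simp)

theorem exists_abs_fErr_le {a : ℝ} (ha : 1 / 2 < a) (ha1 : a < 1) :
    ∃ K, 0 < K ∧ ∀ y, 1 ≤ y → |fErr y| ≤ K * y ^ a := by
  obtain ⟨K, hK, h⟩ := exists_abs_rieszSum_singularSeries_sub_le ha ha1
  refine ⟨K + |epsPrimitive 1|, by positivity, fun y hy => ?_⟩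
  rw [fErr_eq hy]
  have e : epsPrimitive y = rieszSum singularSeries y -
      (y ^ 2 / 2 - y / 2 * Real.log y +
        (1 - eulerMascheroniConstant - Real.log (2 * π)) / 2 * y) := by
    rw [epsPrimitive, Bconst]; ring
  have h1 := h y (by linarith)
  rw [← e] at h1
  have h2 : 1 ≤ y ^ a := Real.one_le_rpow hy (by linarith)
  calc _ ≤ |epsPrimitive y| + |epsPrimitive 1| := abs_sub _ _
    _ ≤ K * y ^ a + |epsPrimitive 1| * y ^ a := by
        gcongr
        exact le_mul_of_one_le_right (abs_nonneg _) h2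
    _ = _ := by ring

theorem integrableOn_Ioi_of_abs_le_rpow {g : ℝ → ℝ} {C b y : ℝ} (hy : 0 < y) (hb : b < -1)
    (hg : AEStronglyMeasurable g (volume.restrict (Set.Ioi y)))
    (h : ∀ u, y < u → |g u| ≤ C * u ^ b) : IntegrableOn g (Set.Ioi y) := by
  refine Integrable.mono' ((integrableOn_Ioi_rpow_of_lt hb hy).const_mul C) hg ?_
  filter_upwards [ae_restrict_mem measurableSet_Ioi] with u hu
  exact h u hu

theorem continuousOn_fErr : ContinuousOn fErr (Set.Ici 1) :=
  (continuous_epsPrimitive.sub continuous_const).continuousOn.congr fun _ hu => fErr_eq hu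

theorem hasDerivAt_fErr {x : ℝ} (hx : 1 < x) (hx' : x ∉ Set.range ((↑) : ℕ → ℝ)) :
    HasDerivAt fErr (epsErr x - Bconst / 2) x := by
  refine ((hasDerivAt_epsPrimitive (by linarith) hx').sub_const
    (epsPrimitive 1)).congr_of_eventuallyEq ?_
  filter_upwards [Ioi_mem_nhds hx] with u hu
  exact fErr_eq (le_of_lt hu)

theorem integrableOn_epsErr_div {y : ℝ} (hy : 1 ≤ y) :
    IntegrableOn (fun u : ℝ => epsErr u / u ^ 3) (Set.Ioi y) := by
  obtain ⟨C, hC, h⟩ := exists_abs_epsErr_le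
  refine integrableOn_Ioi_of_abs_le_rpow (C := C) (b := -2) (by linarith) (by norm_num)
    (measurable_epsErr.div (measurable_id.pow_const 3)).aestronglyMeasurable fun u hu => ?_
  have hu0 : 0 < u := by linarith
  rw [abs_div, abs_of_pos (by positivity : 0 < u ^ 3), div_le_iff₀ (by positivity),
    Real.rpow_neg hu0.le, Real.rpow_ofNat]
  refine (h u (by linarith)).trans_eq ?_
  field_simp

theorem abs_fErr_div_le {K a u : ℝ} (hu : 0 < u) (h : |fErr u| ≤ K * u ^ a) (n : ℕ) :
    |fErr u / u ^ n| ≤ K * u ^ (a - n) := by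
  rw [abs_div, abs_of_pos (by positivity : 0 < u ^ n), Real.rpow_sub hu, Real.rpow_natCast,
    ← mul_div_assoc]
  gcongr

theorem integrableOn_fErr_div {y : ℝ} (hy : 1 ≤ y) :
    IntegrableOn (fun u : ℝ => fErr u / u ^ 4) (Set.Ioi y) := by
  obtain ⟨K, hK, h⟩ := exists_abs_fErr_le (a := 3 / 4) (by norm_num) (by norm_num)
  refine integrableOn_Ioi_of_abs_le_rpow (C := K) (b := 3 / 4 - (4 : ℕ)) (by linarith)
    (by norm_num) ?_ fun u hu => abs_fErr_div_le (by linarith) (h u (by linarith)) 4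
  refine ContinuousOn.aestronglyMeasurable ?_ measurableSet_Ioi
  refine (continuousOn_fErr.mono fun u hu => ?_).div (by fun_prop) fun u hu => ?_
  · exact hy.trans (le_of_lt hu)
  · have : 0 < u := by linarith [Set.mem_Ioi.1 hu]
    positivity

theorem integral_Ioi_const_div_pow_three {y : ℝ} (hy : 0 < y) (c : ℝ) :
    IntegrableOn (fun u : ℝ => c / u ^ 3) (Set.Ioi y) ∧
      ∫ u in Set.Ioi y, c / u ^ 3 = c / (2 * y ^ 2) := by
  have e : Set.EqOn (fun u : ℝ => c * u ^ (-3 : ℝ)) (fun u => c / u ^ 3) (Set.Ioi y) := by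
    intro u hu
    have hu0 : 0 < u := hy.trans hu
    simp only
    rw [Real.rpow_neg hu0.le, Real.rpow_ofNat, div_eq_mul_inv]
  constructor
  · have h : IntegrableOn (fun u : ℝ => c * u ^ (-3 : ℝ)) (Set.Ioi y) :=
      (integrableOn_Ioi_rpow_of_lt (by norm_num) hy).const_mul c
    exact h.congr_fun e measurableSet_Ioi
  · rw [← setIntegral_congr_fun measurableSet_Ioi e, integral_const_mul,
      integral_Ioi_rpow_of_lt (by norm_num) hy]
    have : (-3 : ℝ) + 1 = -2 := by norm_num
    rw [this, Real.rpow_neg hy.le, Real.rpow_ofNat]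
    field_simp

theorem tendsto_fErr_div_pow_three :
    Filter.Tendsto (fun u => fErr u / u ^ 3) Filter.atTop (nhds 0) := by
  obtain ⟨K, hK, h⟩ := exists_abs_fErr_le (a := 3 / 4) (by norm_num) (by norm_num)
  have ht : Filter.Tendsto (fun u : ℝ => K * u ^ (-(9 / 4) : ℝ)) Filter.atTop (nhds 0) := by
    simpa using (tendsto_rpow_neg_atTop (by norm_num : (0 : ℝ) < 9 / 4)).const_mul K
  refine squeeze_zero_norm' ?_ ht
  filter_upwards [Filter.eventually_ge_atTop 1] with u hu
  have e : (3 / 4 : ℝ) - (3 : ℕ) = -(9 / 4) := by norm_num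
  rw [Real.norm_eq_abs, ← e]
  exact abs_fErr_div_le (by linarith) (h u hu) 3

theorem integral_Ioi_epsErr_div {y : ℝ} (hy : 1 ≤ y) :
    ∫ u in Set.Ioi y, epsErr u / u ^ 3 =
      Bconst / (4 * y ^ 2) - fErr y / y ^ 3 + 3 * ∫ u in Set.Ioi y, fErr u / u ^ 4 := by
  have hy0 : 0 < y := by linarith
  have i1 := integrableOn_epsErr_div hy
  obtain ⟨i2, v2⟩ := integral_Ioi_const_div_pow_three hy0 (Bconst / 2)
  have i3 := (integrableOn_fErr_div hy).const_mul 3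
  have i4 := (i1.sub i2).sub i3
  have hlim := intervalIntegral_tendsto_integral_Ioi y i4 Filter.tendsto_id
  have hFTC : ∀ Y, y ≤ Y → ∫ u in y..Y, (epsErr u / u ^ 3 - Bconst / 2 / u ^ 3 -
      3 * (fErr u / u ^ 4)) = fErr Y / Y ^ 3 - fErr y / y ^ 3 := by
    intro Y hY
    refine integral_eq_of_hasDerivAt_off_countable (fun u => fErr u / u ^ 3) _
      (Set.countable_range ((↑) : ℕ → ℝ)) ?_ (fun x hx => ?_) ?_
    · rw [Set.uIcc_of_le hY]
      refine (continuousOn_fErr.mono fun u hu => ?_).div (by fun_prop) fun u hu => ?_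
      · exact hy.trans hu.1
      · have : 0 < u := hy0.trans_le hu.1
        positivity
    · rw [min_eq_left hY] at hx
      have hx0 : x ≠ 0 := by linarith [hx.1.1]
      refine ((hasDerivAt_fErr (by linarith [hx.1.1]) hx.2).div (hasDerivAt_pow 3 x)
        (pow_ne_zero 3 hx0)).congr_deriv ?_
      field_simp
      push_cast
      ring
    · rw [intervalIntegrable_iff, Set.uIoc_of_le hY]
      exact i4.mono_set Set.Ioc_subset_Ioi_self
  have hlim' : Filter.Tendsto (fun Y : ℝ => ∫ u in y..Y, (epsErr u / u ^ 3 -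
      Bconst / 2 / u ^ 3 - 3 * (fErr u / u ^ 4))) Filter.atTop (nhds (0 - fErr y / y ^ 3)) := by
    refine (tendsto_fErr_div_pow_three.sub_const (fErr y / y ^ 3)).congr' ?_
    filter_upwards [Filter.eventually_ge_atTop y] with Y hY
    exact (hFTC Y hY).symm
  have huniq := tendsto_nhds_unique hlim hlim'
  have hsplit : ∫ u in Set.Ioi y, (epsErr u / u ^ 3 - Bconst / 2 / u ^ 3 -
      3 * (fErr u / u ^ 4)) = (∫ u in Set.Ioi y, epsErr u / u ^ 3) -
        (∫ u in Set.Ioi y, Bconst / 2 / u ^ 3) - 3 * ∫ u in Set.Ioi y, fErr u / u ^ 4 := by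
    have h := integral_sub (i1.sub i2) i3
    simp only [Pi.sub_apply] at h
    rw [h, integral_sub i1 i2, integral_const_mul]
  have : (∫ u in Set.Ioi y, epsErr u / u ^ 3) - Bconst / 2 / (2 * y ^ 2) -
      3 * ∫ u in Set.Ioi y, fErr u / u ^ 4 = 0 - fErr y / y ^ 3 := by
    rw [← v2, ← hsplit]
    exact huniq
  have e : Bconst / 2 / (2 * y ^ 2) = Bconst / (4 * y ^ 2) := by
    field_simp
    norm_num
  rw [e] at this
  linarith

theorem exists_abs_integral_Ioi_epsErr_sub_le {a : ℝ} (ha : 1 / 2 < a) (ha1 : a < 1) :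
    ∃ C, 0 < C ∧ ∀ y, 1 ≤ y →
      |(∫ u in Set.Ioi y, epsErr u / u ^ 3) - Bconst / (4 * y ^ 2)| ≤ C * y ^ (a - 3) := by
  obtain ⟨K, hK, h⟩ := exists_abs_fErr_le ha ha1
  refine ⟨K + 3 * (K * (1 / (3 - a))),
    add_pos hK (mul_pos three_pos (mul_pos hK (one_div_pos.2 (by linarith)))), fun y hy => ?_⟩
  have hy0 : 0 < y := by linarith
  have hb : a - (4 : ℕ) < -1 := by push_cast; linarith
  have h1 := abs_fErr_div_le hy0 (h y hy) 3
  have h2 : |∫ u in Set.Ioi y, fErr u / u ^ 4| ≤ K * (1 / (3 - a)) * y ^ (a - 3) := by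
    rw [← Real.norm_eq_abs]
    refine (norm_integral_le_of_norm_le ((integrableOn_Ioi_rpow_of_lt hb hy0).const_mul K)
      (ae_restrict_of_forall_mem measurableSet_Ioi fun u hu => ?_)).trans_eq ?_
    · have hu' : y < u := hu
      exact abs_fErr_div_le (hy0.trans hu') (h u (hy.trans hu'.le)) 4
    · rw [integral_const_mul, integral_Ioi_rpow_of_lt hb hy0]
      have e : a - (4 : ℕ) + 1 = a - 3 := by push_cast; ring
      have h3 : a - 3 ≠ 0 := by linarith
      have h3' : 3 - a ≠ 0 := by linarith
      rw [e]
      field_simp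
      ring
  rw [integral_Ioi_epsErr_div hy]
  push_cast at h1
  rw [abs_le] at h1 h2 ⊢
  constructor <;> linarith

/-- Formula (5): for `y ≥ 1`, the integrals converge and
`∫_y^∞ ε(u)/u³ du = B/(4y²) - f(y)/y³ + 3 ∫_y^∞ f(u)/u⁴ du`, and consequently
`∫_y^∞ ε(u)/u³ du = B/(4y²) + O(y^{-5/2+ε})` for every `ε > 0`. -/
theorem integral_epsErr_tail :
    (∀ y : ℝ, 1 ≤ y →
      IntegrableOn (fun u : ℝ => epsErr u / u ^ 3) (Set.Ioi y) ∧
      IntegrableOn (fun u : ℝ => fErr u / u ^ 4) (Set.Ioi y) ∧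
      (∫ u in Set.Ioi y, epsErr u / u ^ 3) =
        Bconst / (4 * y ^ 2) - fErr y / y ^ 3 + 3 * ∫ u in Set.Ioi y, fErr u / u ^ 4) ∧
    ∀ ε : ℝ, 0 < ε → ∃ C : ℝ, 0 < C ∧ ∀ y : ℝ, 1 ≤ y →
      |(∫ u in Set.Ioi y, epsErr u / u ^ 3) - Bconst / (4 * y ^ 2)| ≤
        C * y ^ (-(5 : ℝ) / 2 + ε) := by
  refine ⟨fun y hy => ⟨integrableOn_epsErr_div hy, integrableOn_fErr_div hy,
    integral_Ioi_epsErr_div hy⟩, fun ε hε => ?_⟩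
  have h1 : 0 < min ε (1 / 4) := lt_min hε (by norm_num)
  have h2 : min ε (1 / 4) ≤ 1 / 4 := min_le_right _ _
  have h3 : min ε (1 / 4) ≤ ε := min_le_left _ _
  obtain ⟨C, hC, h⟩ := exists_abs_integral_Ioi_epsErr_sub_le (a := 1 / 2 + min ε (1 / 4))
    (by linarith) (by linarith)
  refine ⟨C, hC, fun y hy => (h y hy).trans ?_⟩
  exact mul_le_mul_of_nonneg_left
    (Real.rpow_le_rpow_of_exponent_le hy (by linarith)) hC.le
end
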